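/- Let ℓ ≥ 3 and let h₁,…,h_ℓ ∈ ℤ[x] be nonzero intersective polynomials. Set μ = 1/2 if Σ_{i=1}^{ℓ} 1/deg(h_i) ≥ 1, and μ = 1/4 otherwise. Then there exist constants c, C > 0 such that for every integer N ≥ 2 and every set A ⊆ {1,…,N} satisfying a − a' ≠ h₁(n₁) + ⋯ + h_ℓ(n_ℓ) for all distinct pairs a, a' ∈ A and all integers n₁,…,n_ℓ ≥ 1, one has |A| ≤ C · N · exp(−c·(log N)^{μ}). -/

import Mathlib

/-- A nonzero polynomial `h ∈ ℤ[x]` is *intersective* if for every positive integer `q`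
there is a positive integer `n` with `q ∣ h(n)`. -/
def Intersective (h : Polynomial ℤ) : Prop :=
  h ≠ 0 ∧ ∀ q : ℕ, 0 < q → ∃ n : ℕ, 0 < n ∧ (q : ℤ) ∣ h.eval (n : ℤ)

namespace IntersectiveSums

/-- The additive character `x ↦ exp(2πix)` of the real line. -/
noncomputable def ex (x : ℝ) : ℂ := Complex.exp (Complex.I * ((2 * Real.pi * x : ℝ) : ℂ))

theorem ex_add (x y : ℝ) : ex (x + y) = ex x * ex y := by
  unfold ex; rw [← Complex.exp_add]; congr 1; push_cast; ring

theorem norm_ex (x : ℝ) : ‖ex x‖ = 1 := by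
  unfold ex; rw [mul_comm]; exact Complex.norm_exp_ofReal_mul_I _

theorem ex_intCast (n : ℤ) : ex n = 1 := by
  unfold ex; rw [Complex.exp_eq_one_iff]; exact ⟨n, by push_cast; ring⟩

theorem ex_zero : ex 0 = 1 := by simpa using ex_intCast 0

theorem ex_neg (x : ℝ) : ex (-x) = (starRingEnd ℂ) (ex x) := by
  unfold ex; rw [← Complex.exp_conj]; congr 1
  simp only [map_mul, Complex.conj_I, Complex.conj_ofReal]; push_cast; ring

theorem ex_add_intCast (x : ℝ) (n : ℤ) : ex (x + n) = ex x := by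
  rw [ex_add, ex_intCast, mul_one]

theorem ex_sub_intCast (x : ℝ) (n : ℤ) : ex (x - n) = ex x := by
  have := ex_add_intCast x (-n); push_cast at this; rwa [← sub_eq_add_neg] at this

theorem ex_nat_mul (n : ℕ) (x : ℝ) : ex (n * x) = ex x ^ n := by
  unfold ex; rw [← Complex.exp_nat_mul]; congr 1; push_cast; ring

theorem norm_ex_sub_one (x : ℝ) : ‖ex x - 1‖ = 2 * |Real.sin (Real.pi * x)| := by
  unfold ex; rw [Complex.norm_exp_I_mul_ofReal_sub_one, norm_mul]
  simp only [Real.norm_eq_abs, abs_two]; congr 3; ring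

theorem norm_ex_sub_one_le (x : ℝ) : ‖ex x - 1‖ ≤ 7 * |x| := by
  rw [norm_ex_sub_one]
  have h1 := Real.abs_sin_le_abs (x := Real.pi * x)
  rw [abs_mul, abs_of_pos Real.pi_pos] at h1
  have := Real.pi_lt_d2
  nlinarith [abs_nonneg x]

theorem norm_ex_sub_ex_le (x y : ℝ) : ‖ex x - ex y‖ ≤ 7 * |x - y| := by
  have : ex x - ex y = ex y * (ex (x - y) - 1) := by
    rw [mul_sub, ← ex_add]; simp
  rw [this, norm_mul, norm_ex, one_mul]; exact norm_ex_sub_one_le _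

theorem le_norm_ex_sub_one (x : ℝ) : 4 * |x - round x| ≤ ‖ex x - 1‖ := by
  have h0 : ex x = ex (x - round x) := by
    rw [ex_sub_intCast]
  rw [h0, norm_ex_sub_one]
  have h1 : |x - round x| ≤ 1 / 2 := abs_sub_round x
  set t := x - round x
  have hpi := Real.pi_pos
  have h2 : |Real.sin (Real.pi * t)| = Real.sin (Real.pi * |t|) := by
    rw [← abs_of_pos (a := Real.pi) hpi, ← abs_mul, abs_of_pos (a := Real.pi) hpi]
    rcases abs_cases (Real.pi * t) with ⟨h, h'⟩ | ⟨h, h'⟩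
    · rw [h, abs_of_nonneg]
      apply Real.sin_nonneg_of_nonneg_of_le_pi h'
      rw [← h, abs_mul, abs_of_pos hpi]; nlinarith
    · rw [h, Real.sin_neg, abs_of_nonpos]
      apply Real.sin_nonpos_of_nonpos_of_neg_pi_le h'.le
      have : |Real.pi * t| ≤ Real.pi := by rw [abs_mul, abs_of_pos hpi]; nlinarith
      linarith [neg_abs_le (Real.pi * t)]
  rw [h2]
  have h3 := Real.mul_le_sin (x := Real.pi * |t|) (by positivity) (by nlinarith)
  have : 2 / Real.pi * (Real.pi * |t|) = 2 * |t| := by field_simp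
  linarith

/-- A real number with many multiples close to integers is close to a rational number with
small denominator. -/
theorem recurrent_multiples (β ε R : ℝ) (M : ℕ) (H : Finset ℕ) (hR : 1 ≤ R)
    (hH : H ⊆ Finset.Icc 1 M) (hcard : (M : ℝ) ≤ R * H.card) (hM : 18 * R ^ 2 ≤ M)
    (hε0 : 0 ≤ ε) (hε : 24 * R * ε ≤ 1) (hβ : ∀ h ∈ H, ∃ a : ℤ, |h * β - a| ≤ ε) :
    ∃ q : ℕ, 1 ≤ q ∧ (q : ℝ) ≤ 3 * R ∧ ∃ a : ℤ, |q * β - a| * M ≤ 36 * ε * R ^ 2 := by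
  have hdiff : ∀ h ∈ H, ∀ h' ∈ H, ∃ a : ℤ, |((h' : ℝ) - h) * β - a| ≤ 2 * ε := by
    intro h hh h' hh'
    obtain ⟨a, ha⟩ := hβ h hh
    obtain ⟨a', ha'⟩ := hβ h' hh'
    refine ⟨a' - a, ?_⟩
    have : ((h' : ℝ) - h) * β - ((a' - a : ℤ) : ℝ) = (h' * β - a') - (h * β - a) := by
      push_cast; ring
    rw [this]
    exact (abs_sub _ _).trans (by linarith)
  -- two elements at distance at most `3 * R`
  obtain ⟨q, hq1, hqR, a, ha⟩ : ∃ q : ℕ, 1 ≤ q ∧ (q : ℝ) ≤ 3 * R ∧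
      ∃ a : ℤ, |q * β - a| ≤ 2 * ε := by
    set b := ⌈2 * R⌉₊ with hb
    have hb1 : 2 * R ≤ b := Nat.le_ceil _
    have hb2 : (b : ℝ) < 2 * R + 1 := Nat.ceil_lt_add_one (by linarith)
    have hbpos : 0 < b := by
      have : (0 : ℝ) < b := by linarith
      exact_mod_cast this
    have hlt : (Finset.range (M / b + 1)).card < H.card := by
      rw [Finset.card_range]
      have h1 : ((M / b : ℕ) : ℝ) ≤ M / b := Nat.cast_div_le
      have h2 : (M : ℝ) / b ≤ M / (2 * R) := by gcongr
      have h3 : (M : ℝ) / R ≤ H.card := by rw [div_le_iff₀ (by linarith)]; linarith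
      have h4 : 18 ≤ (M : ℝ) / R := by
        rw [le_div_iff₀ (by linarith)]; nlinarith
      have h5 : (M : ℝ) / (2 * R) = M / R / 2 := by field_simp
      have : ((M / b + 1 : ℕ) : ℝ) < H.card := by push_cast; linarith
      exact_mod_cast this
    obtain ⟨x, hx, y, hy, hxy, hf⟩ := Finset.exists_ne_map_eq_of_card_lt_of_maps_to hlt
      (f := fun h => h / b) (by
        intro h hh
        have := Finset.mem_Icc.mp (hH hh)
        simp only [Finset.coe_range, Set.mem_Iio]
        exact Nat.lt_succ_of_le (Nat.div_le_div_right this.2))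
    wlog hlt' : x < y generalizing x y
    · exact this y hy x hx hxy.symm hf.symm (by omega)
    refine ⟨y - x, by omega, ?_, ?_⟩
    · have h1 := Nat.div_add_mod x b
      have h2 := Nat.div_add_mod y b
      have h3 := Nat.mod_lt y hbpos
      rw [hf] at h1
      have h4 : y - x < b := by omega
      have h5 : ((y - x : ℕ) : ℝ) + 1 ≤ b := by exact_mod_cast h4
      linarith
    · obtain ⟨a, ha⟩ := hdiff x hx y hy
      exact ⟨a, by rw [Nat.cast_sub hlt'.le]; exact ha⟩
  refine ⟨q, hq1, hqR, a, ?_⟩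
  set η := (q : ℝ) * β - a with hη
  rcases eq_or_lt_of_le (abs_nonneg η) with h0 | hτ
  · rw [← h0]; simp; positivity
  set τ := |η|
  set L := ⌊2 * ε / τ⌋₊ + 1 with hL
  have hLτ : 2 * ε < L * τ := by
    have := Nat.lt_floor_add_one (2 * ε / τ)
    rw [div_lt_iff₀ hτ] at this; push_cast [hL]; exact this
  have hL1 : ((L : ℝ) - 1) * τ ≤ 2 * ε := by
    have := Nat.floor_le (a := 2 * ε / τ) (by positivity)
    rw [le_div_iff₀ hτ] at this; push_cast [hL]; linarith
  set I := ⌊2 * R⌋₊ + 1 with hI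
  have hI1 : 2 * R < I := by have := Nat.lt_floor_add_one (2 * R); push_cast [hI]; exact this
  have hI2 : (I : ℝ) ≤ 3 * R := by
    have := Nat.floor_le (a := 2 * R) (by positivity); push_cast [hI]; linarith
  have key : M < I * L * q := by
    by_contra! hcon
    have hcard2 : (Finset.range I ×ˢ H).card ≤ (Finset.Icc 1 (2 * M)).card := by
      apply Finset.card_le_card_of_injOn (fun x => x.2 + x.1 * L * q)
      · rintro ⟨i, h⟩ hx
        simp only [Finset.coe_product, Set.mem_prod, Finset.mem_coe, Finset.mem_range] at hx
        have h1 := Finset.mem_Icc.mp (hH hx.2)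
        simp only [Finset.coe_Icc, Set.mem_Icc]
        have h2 : i * L * q ≤ I * L * q := by gcongr; exact hx.1.le
        omega
      · rintro ⟨i, h⟩ hx ⟨i', h'⟩ hx' hxx
        simp only [Finset.coe_product, Set.mem_prod, Finset.mem_coe, Finset.mem_range] at hx hx' hxx
        by_contra hne
        wlog hii : i' < i generalizing i h i' h'
        · rcases Nat.lt_or_ge i i' with h1 | h1
          · exact this i' h' i h hxx.symm hx' hx (fun hh => hne hh.symm) h1
          · have : i = i' := by omega
            subst this
            apply hne; ext <;> simp; omega
        obtain ⟨n, hn⟩ := hdiff h hx.2 h' hx'.2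
        have hcast : ((h' : ℝ) - h) = ((i : ℝ) - i') * L * q := by
          have : (h : ℝ) + i * L * q = h' + i' * L * q := by exact_mod_cast hxx
          linarith
        have hid : ((h' : ℝ) - h) * β - n =
            ((i : ℝ) - i') * L * η - ((n - (i - i') * L * a : ℤ) : ℝ) := by
          rw [hcast, hη]; push_cast; ring
        rw [hid] at hn
        set n' : ℤ := n - (i - i') * L * a
        have hi1 : (1 : ℝ) ≤ (i : ℝ) - i' := by
          have : (i' : ℝ) + 1 ≤ i := by exact_mod_cast hii
          linarith
        have hi2 : (i : ℝ) - i' ≤ I := by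
          have : (i : ℝ) ≤ I := by exact_mod_cast hx.1.le
          have h' : (0 : ℝ) ≤ i' := by positivity
          linarith
        have habs : |((i : ℝ) - i') * L * η| = ((i : ℝ) - i') * (L * τ) := by
          rw [abs_mul, abs_of_nonneg (by positivity)]; ring
        have hτ2 : τ ≤ 2 * ε := ha
        have hlow : 2 * ε < |((i : ℝ) - i') * L * η| := by
          rw [habs]; nlinarith
        have hLt : L * τ ≤ 4 * ε := by linarith
        have hup : |((i : ℝ) - i') * L * η| ≤ 1 / 2 := by
          rw [habs]
          calc ((i : ℝ) - i') * (L * τ) ≤ (3 * R) * (4 * ε) := by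
                gcongr; linarith
            _ ≤ 1 / 2 := by linarith
        have hn0 : n' = 0 := by
          have h2 : |(n' : ℝ)| < 1 := by
            have h3 : (n' : ℝ) = ((i : ℝ) - i') * L * η - (((i : ℝ) - i') * L * η - n') := by ring
            rw [h3]
            have : ε ≤ 1 / 24 := by nlinarith
            exact lt_of_le_of_lt (abs_sub _ _) (by linarith)
          have h4 : |n'| < 1 := by exact_mod_cast h2
          exact Int.abs_lt_one_iff.mp h4
        rw [hn0] at hn
        simp only [Int.cast_zero, sub_zero] at hn
        linarith
    rw [Finset.card_product, Finset.card_range, Nat.card_Icc] at hcard2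
    have h3 : (I : ℝ) * H.card ≤ 2 * M := by
      have : I * H.card ≤ 2 * M := by omega
      exact_mod_cast this
    have hMpos : (0 : ℝ) < M := by nlinarith
    have : (0 : ℝ) < H.card := by
      by_contra hc
      have : R * (H.card : ℝ) ≤ 0 := by nlinarith
      linarith
    nlinarith
  have hkey : (M : ℝ) < I * L * q := by exact_mod_cast key
  have hLpos : (0 : ℝ) < L := by positivity
  have h9 : (M : ℝ) ≤ 9 * R ^ 2 * L := by
    calc (M : ℝ) ≤ I * L * q := hkey.le
      _ ≤ (3 * R) * L * (3 * R) := by gcongr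
      _ = _ := by ring
  have hL2 : (2 : ℝ) ≤ L := by
    have : 9 * R ^ 2 * 2 ≤ 9 * R ^ 2 * L := by linarith
    exact le_of_mul_le_mul_left this (by positivity)
  calc τ * M ≤ τ * (9 * R ^ 2 * L) := by gcongr
    _ ≤ τ * (9 * R ^ 2 * (2 * (L - 1))) := by gcongr; linarith
    _ = 18 * R ^ 2 * ((L - 1) * τ) := by ring
    _ ≤ 18 * R ^ 2 * (2 * ε) := by gcongr
    _ = _ := by ring

open Finset Polynomial

theorem norm_sum_ex_linear_le (α c : ℝ) (M : ℕ) :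
    ‖∑ x ∈ range M, ex (α * x + c)‖ * (4 * |α - round α|) ≤ 2 := by
  have h1 : ∑ x ∈ range M, ex (α * x + c) = ex c * ∑ x ∈ range M, ex α ^ x := by
    rw [mul_sum]; refine sum_congr rfl fun x _ => ?_
    rw [ex_add, mul_comm α, ex_nat_mul, mul_comm]
  rw [h1, norm_mul, norm_ex, one_mul]
  calc _ ≤ ‖∑ x ∈ range M, ex α ^ x‖ * ‖ex α - 1‖ := by
        gcongr; exact le_norm_ex_sub_one α
    _ = ‖ex α ^ M - 1‖ := by rw [← norm_mul, geom_sum_mul]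
    _ ≤ ‖ex α ^ M‖ + ‖(1 : ℂ)‖ := norm_sub_le _ _
    _ = 2 := by rw [norm_pow, norm_ex]; norm_num

theorem norm_sq_sum_eq (z : ℕ → ℂ) (M : ℕ) :
    ‖∑ x ∈ range M, z x‖ ^ 2 = ∑ x ∈ range M, ‖z x‖ ^ 2 +
      2 * (∑ y ∈ range M, ∑ x ∈ range y, z y * (starRingEnd ℂ) (z x)).re := by
  induction M with
  | zero => simp
  | succ M ih =>
    rw [sum_range_succ, sum_range_succ, sum_range_succ, Complex.add_re, ← mul_sum, ← map_sum]
    rw [add_comm _ (z M), Complex.sq_norm, Complex.normSq_add, ← Complex.sq_norm, ← Complex.sq_norm,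
      ih]
    ring

theorem sum_triangle_eq {E : Type*} [AddCommMonoid E] (F : ℕ → ℕ → E) (M : ℕ) :
    ∑ y ∈ range M, ∑ x ∈ range y, F y x =
      ∑ h ∈ Icc 1 (M - 1), ∑ x ∈ range (M - h), F (x + h) x := by
  rw [sum_sigma', sum_sigma']
  refine sum_bij' (fun p _ => ⟨p.1 - p.2, p.2⟩) (fun p _ => ⟨p.2 + p.1, p.2⟩) ?_ ?_ ?_ ?_ ?_
  · rintro ⟨y, x⟩ h; simp only [mem_sigma, mem_range, mem_Icc] at h ⊢; omega
  · rintro ⟨y, x⟩ h; simp only [mem_sigma, mem_range, mem_Icc] at h ⊢; omega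
  · rintro ⟨y, x⟩ h; simp only [mem_sigma, mem_range] at h ⊢
    congr 1; omega
  · rintro ⟨y, x⟩ h; simp only [mem_sigma, mem_range, mem_Icc] at h ⊢
    congr 1; omega
  · rintro ⟨y, x⟩ h; simp only [mem_sigma, mem_range] at h ⊢
    congr 1; omega

theorem norm_sq_sum_le (z : ℕ → ℂ) (hz : ∀ x, ‖z x‖ ≤ 1) (M : ℕ) :
    ‖∑ x ∈ range M, z x‖ ^ 2 ≤ M +
      2 * ∑ h ∈ Icc 1 (M - 1), ‖∑ x ∈ range (M - h), z (x + h) * (starRingEnd ℂ) (z x)‖ := by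
  rw [norm_sq_sum_eq, sum_triangle_eq (fun y x => z y * (starRingEnd ℂ) (z x))]
  gcongr
  · calc ∑ x ∈ range M, ‖z x‖ ^ 2 ≤ ∑ x ∈ range M, (1 : ℝ) :=
        sum_le_sum fun x _ => pow_le_one₀ (norm_nonneg _) (hz x)
      _ = M := by simp
  · exact (Complex.re_le_norm _).trans (norm_sum_le _ _)

theorem coeff_taylor_sub (g : ℝ[X]) (k : ℕ) (hg : g.natDegree ≤ k + 1) (h : ℝ) :
    (taylor h g - g).coeff k = (k + 1) * h * g.coeff (k + 1) := by
  rw [coeff_sub, taylor_coeff]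
  have hd : (hasseDeriv k g).natDegree < 2 := by
    have := natDegree_hasseDeriv_le g k
    omega
  rw [eval_eq_sum_range' hd, sum_range_succ, sum_range_one, hasseDeriv_coeff, hasseDeriv_coeff]
  have : (1 + k).choose k = k + 1 := by rw [add_comm]; simp
  rw [this]
  simp only [zero_add, Nat.choose_self, add_comm 1 k]
  push_cast; ring

theorem natDegree_taylor_sub_le (g : ℝ[X]) (k : ℕ) (hg : g.natDegree ≤ k + 1) (h : ℝ) :
    (taylor h g - g).natDegree ≤ k := by
  rw [natDegree_le_iff_coeff_eq_zero]
  intro m hm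
  rw [coeff_sub, taylor_coeff]
  have hd : (hasseDeriv m g).natDegree < 1 := by
    have := natDegree_hasseDeriv_le g m
    omega
  rw [eval_eq_sum_range' hd, sum_range_one, hasseDeriv_coeff]
  simp

theorem mul_pow_le_mul_pow_max {R a : ℝ} {C n : ℕ} (hR : 1 ≤ R) (ha : a ≤ C) (hn : n ≤ C) :
    a * R ^ n ≤ C * R ^ C := by
  have := pow_le_pow_right₀ hR hn
  gcongr

theorem abs_sub_round_le_one (x : ℝ) : |x - round x| ≤ 1 :=
  (abs_sub_round x).trans (by norm_num)

theorem norm_sum_ex_le (φ : ℕ → ℝ) (M : ℕ) : ‖∑ x ∈ range M, ex (φ x)‖ ≤ M :=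
  (norm_sum_le _ _).trans (by simp [norm_ex])

/-- If the exponential sum of `g` is large, then so are many of those of its differences. -/
theorem exists_large_differences (g : ℝ[X]) {R : ℝ} {M : ℕ} (hR : 1 ≤ R) (hM : 2 * R ^ 2 ≤ M)
    (hg : M ≤ R * ‖∑ x ∈ range M, ex (g.eval (x : ℝ))‖) :
    ∃ H ⊆ Icc 1 M, (M : ℝ) ≤ 8 * R ^ 2 * #H ∧ ∀ h ∈ H, h < M ∧
      (M : ℝ) ≤ 8 * R ^ 2 *
        ‖∑ x ∈ range (M - h), ex ((taylor (h : ℝ) g - g).eval (x : ℝ))‖ := by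
  classical
  set T : ℕ → ℝ := fun h => ‖∑ x ∈ range (M - h), ex ((taylor (h : ℝ) g - g).eval (x : ℝ))‖ with hT
  have hR2 : 1 ≤ R ^ 2 := one_le_pow₀ hR
  have hM0 : (0 : ℝ) < M := by linarith
  have hTM (h : ℕ) : T h ≤ M := (norm_sum_ex_le _ _).trans (by
    exact_mod_cast Nat.sub_le M h)
  have h1 : ‖∑ x ∈ range M, ex (g.eval (x : ℝ))‖ ^ 2 ≤ M + 2 * ∑ h ∈ Icc 1 (M - 1), T h := by
    refine (norm_sq_sum_le (fun x => ex (g.eval (x : ℝ))) (fun x => (norm_ex _).le) M).trans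
      (le_of_eq ?_)
    congr 2
    refine sum_congr rfl fun h _ => ?_
    rw [hT]
    simp only
    congr 1
    refine sum_congr rfl fun x _ => ?_
    rw [← ex_neg, ← ex_add]
    congr 1
    rw [eval_sub, taylor_eval]; push_cast; ring
  set H := {h ∈ Icc 1 (M - 1) | (M : ℝ) ≤ 8 * R ^ 2 * T h} with hH
  have h2 : 8 * R ^ 2 * ∑ h ∈ Icc 1 (M - 1), T h ≤ 8 * R ^ 2 * (#H * M) + M * M := by
    have : ∀ h ∈ Icc 1 (M - 1), 8 * R ^ 2 * T h ≤
        (if (M : ℝ) ≤ 8 * R ^ 2 * T h then 8 * R ^ 2 * M else 0) + M := by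
      intro h _
      split_ifs with hh
      · have := mul_le_mul_of_nonneg_left (hTM h) (show 0 ≤ 8 * R ^ 2 by positivity)
        linarith
      · linarith
    rw [mul_sum]
    refine (sum_le_sum this).trans ?_
    rw [sum_add_distrib, ← sum_filter, sum_const, sum_const, Nat.card_Icc, nsmul_eq_mul,
      nsmul_eq_mul]
    have h3 : ((M - 1 + 1 - 1 : ℕ) : ℝ) ≤ M := by exact_mod_cast (by omega)
    have := mul_le_mul_of_nonneg_right h3 hM0.le
    linarith
  have h4 : (M : ℝ) ^ 2 ≤ R ^ 2 * ‖∑ x ∈ range M, ex (g.eval (x : ℝ))‖ ^ 2 := by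
    rw [← mul_pow]; exact pow_le_pow_left₀ hM0.le hg 2
  refine ⟨H, (filter_subset _ _).trans (Icc_subset_Icc_right (Nat.sub_le _ _)), ?_, ?_⟩
  · have h5 : (M : ℝ) * M ≤ (8 * R ^ 2 * #H) * M := by nlinarith
    exact le_of_mul_le_mul_right h5 hM0
  · intro h hh
    rw [hH, mem_filter, mem_Icc] at hh
    refine ⟨?_, hh.2⟩
    have : 0 < M := by exact_mod_cast hM0
    omega

theorem inverse_weyl (k : ℕ) : ∃ C : ℕ, ∀ (R : ℝ) (M : ℕ) (g : ℝ[X]), 1 ≤ R → 1 ≤ M →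
    g.natDegree ≤ k + 1 → M ≤ R * ‖∑ x ∈ range M, ex (g.eval (x : ℝ))‖ →
    ∃ q : ℕ, 1 ≤ q ∧ q ≤ C * R ^ C ∧
      ∃ a : ℤ, |q * g.coeff (k + 1) - a| * M ^ (k + 1) ≤ C * R ^ C := by
  classical
  induction k with
  | zero =>
    refine ⟨1, fun R M g hR hM hg h => ⟨1, le_rfl, by simpa using hR, round (g.coeff 1), ?_⟩⟩
    have h1 := norm_sum_ex_linear_le (g.coeff 1) (g.coeff 0) M
    have h2 : ∀ x : ℕ, g.eval (x : ℝ) = g.coeff 1 * x + g.coeff 0 := fun x => by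
      rw [eval_eq_sum_range' (show g.natDegree < 2 by omega), sum_range_succ, sum_range_one]
      ring
    simp only [h2] at h
    set S := ‖∑ x ∈ range M, ex (g.coeff 1 * x + g.coeff 0)‖
    have h3 := mul_le_mul_of_nonneg_left h (abs_nonneg (g.coeff 1 - round (g.coeff 1)))
    simp only [Nat.cast_one, one_mul, zero_add, pow_one]
    nlinarith
  | succ k ih =>
    obtain ⟨C₀, ih⟩ := ih
    set C := C₀ + 1 with hC
    have hC1 : (1 : ℝ) ≤ C := by rw [hC]; push_cast; linarith [(Nat.cast_nonneg C₀ : (0 : ℝ) ≤ C₀)]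
    set a1 : ℕ := 3 * (8 * (C * 8 ^ C)) * (C * 8 ^ C) * (k + 2)
    set n1 : ℕ := 2 * C + 2 + 2 * C
    set a2 : ℕ := 36 * (C * 8 ^ C) * 8 ^ (k + 1) * (8 * (C * 8 ^ C)) ^ 2
    set n2 : ℕ := 2 * C + 2 * (k + 1) + (2 * C + 2) * 2
    set a3 : ℕ := (24 * (8 * (C * 8 ^ C)) ^ 2 * (C * 8 ^ C) * 8 ^ (k + 1)) ^ (k + 2)
    set n3 : ℕ := ((2 * C + 2) * 2 + 2 * C + 2 * (k + 1)) * (k + 2)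
    refine ⟨a1 + a2 + a3 + n1 + n2 + n3 + 1, fun R M g hR hM hg hS => ?_⟩
    set D := a1 + a2 + a3 + n1 + n2 + n3 + 1 with hD
    have hbd : ∀ (a : ℝ) (b n : ℕ), a ≤ b * R ^ n → b ≤ D → n ≤ D → a ≤ D * R ^ D := by
      intro a b n h1 h2 h3
      exact h1.trans (mul_pow_le_mul_pow_max hR (by exact_mod_cast h2) h3)
    set r := 8 * R ^ 2 with hr
    have hR2 : 1 ≤ R ^ 2 := one_le_pow₀ hR
    have hr1 : 1 ≤ r := by linarith
    set Q := C * r ^ C with hQ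
    have hQ1 : 1 ≤ Q := one_le_mul_of_one_le_of_one_le hC1 (one_le_pow₀ hr1)
    set R' := r * Q with hR'
    have hR'1 : 1 ≤ R' := one_le_mul_of_one_le_of_one_le hr1 hQ1
    have hrk : 1 ≤ r ^ (k + 1) := one_le_pow₀ hr1
    by_cases hsmall : (M : ℝ) ≤ 24 * R' ^ 2 * Q * r ^ (k + 1)
    · refine ⟨1, le_rfl, ?_, round (g.coeff (k + 2)), ?_⟩
      · exact hbd _ 1 0 (by simp) (by omega) (by omega)
      · refine hbd _ a3 n3 ?_ (by omega) (by omega)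
        calc _ ≤ 1 * (24 * R' ^ 2 * Q * r ^ (k + 1)) ^ (k + 2) := by
              gcongr
              simpa using abs_sub_round_le_one (g.coeff (k + 2))
          _ = _ := by
              simp only [hR', hQ, hr, a3, n3]; push_cast
              simp only [mul_pow, pow_mul, pow_add]; ring
    push Not at hsmall
    have hQ2 : 1 ≤ Q * r ^ (k + 1) := one_le_mul_of_one_le_of_one_le hQ1 hrk
    have hR'2 : 1 ≤ R' ^ 2 := one_le_pow₀ hR'1
    have hM0 : (0 : ℝ) < M := by exact_mod_cast hM
    have hM24 : 24 * R' ^ 2 ≤ M := by nlinarith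
    have hM2 : 2 * R ^ 2 ≤ M := by
      have : r ≤ R' := le_mul_of_one_le_right (by linarith) hQ1
      nlinarith
    obtain ⟨H, hHM, hHc, hH⟩ := exists_large_differences g hR hM2 hS
    have hk : ∀ h ∈ H, ∃ q : ℕ, 1 ≤ q ∧ (q : ℝ) ≤ Q ∧ ∃ a : ℤ,
        |h * (q * ((k + 2 : ℕ) : ℝ) * g.coeff (k + 2)) - a| ≤ Q * r ^ (k + 1) / M ^ (k + 1) := by
      intro h hh
      obtain ⟨hlt, hT⟩ := hH h hh
      have hle : ((M - h : ℕ) : ℝ) ≤ M := by exact_mod_cast Nat.sub_le M h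
      obtain ⟨q, hq1, hq, a, ha⟩ := ih r (M - h) (taylor (h : ℝ) g - g) hr1 (by omega)
        (natDegree_taylor_sub_le g _ hg _) (hle.trans hT)
      have hC0 : (C₀ : ℝ) * r ^ C₀ ≤ Q :=
        mul_pow_le_mul_pow_max hr1 (by exact_mod_cast Nat.le_succ C₀) (Nat.le_succ C₀)
      refine ⟨q, hq1, hq.trans hC0, a, ?_⟩
      rw [coeff_taylor_sub g _ hg] at ha
      rw [le_div_iff₀ (by positivity)]
      have hT2 : (M : ℝ) ≤ r * (M - h : ℕ) :=
        hT.trans (mul_le_mul_of_nonneg_left (norm_sum_ex_le _ _) (by linarith))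
      calc _ ≤ |(h : ℝ) * (q * ((k + 2 : ℕ) : ℝ) * g.coeff (k + 2)) - a| *
            (r * (M - h : ℕ)) ^ (k + 1) := by gcongr
        _ = r ^ (k + 1) * (|q * (((k + 1 : ℕ) + 1) * h * g.coeff (k + 1 + 1)) - a| *
            (M - h : ℕ) ^ (k + 1)) := by
          rw [mul_pow]; push_cast; ring_nf
        _ ≤ r ^ (k + 1) * (C₀ * r ^ C₀) := by gcongr
        _ ≤ Q * r ^ (k + 1) := by rw [mul_comm]; gcongr
    choose! q hq1 hq a ha using hk
    have hHne : 0 < #H := by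
      rcases Nat.eq_zero_or_pos #H with h | h
      · rw [h] at hHc; simp at hHc; linarith
      · exact h
    have hmaps : ∀ h ∈ H, q h ∈ Icc 1 ⌊Q⌋₊ := fun h hh =>
      mem_Icc.2 ⟨hq1 h hh, Nat.le_floor (hq h hh)⟩
    obtain ⟨q₀, hq₀, hcard⟩ := exists_le_card_fiber_of_nsmul_le_card_of_maps_to
      (b := (#H : ℝ) / Q) hmaps ⟨1, mem_Icc.2 ⟨le_rfl, Nat.le_floor (by simpa using hQ1)⟩⟩ (by
        rw [Nat.card_Icc, nsmul_eq_mul, Nat.add_sub_cancel, mul_div_assoc',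
          div_le_iff₀ (by linarith), mul_comm]
        gcongr
        exact Nat.floor_le (by linarith))
    rw [mem_Icc] at hq₀
    have hq₀Q : (q₀ : ℝ) ≤ Q := (Nat.cast_le.2 hq₀.2).trans (Nat.floor_le (by linarith))
    have hε : Q * r ^ (k + 1) / M ^ (k + 1) ≤ Q * r ^ (k + 1) / M := by
      gcongr
      exact le_self_pow₀ (by exact_mod_cast hM) (by omega)
    obtain ⟨q', hq'1, hq', b, hb⟩ := recurrent_multiples
      (q₀ * ((k + 2 : ℕ) : ℝ) * g.coeff (k + 2)) (Q * r ^ (k + 1) / M ^ (k + 1)) R' M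
      {h ∈ H | q h = q₀} hR'1 ((filter_subset _ _).trans hHM) (by
        rw [div_le_iff₀ (by linarith)] at hcard
        calc (M : ℝ) ≤ r * #H := hHc
          _ ≤ r * (#{h ∈ H | q h = q₀} * Q) := by gcongr
          _ = _ := by rw [hR']; ring) (by linarith) (by positivity) (by
        calc _ ≤ 24 * R' * (Q * r ^ (k + 1) / M) := by gcongr
          _ = (24 * R' * (Q * r ^ (k + 1))) / M := by ring
          _ ≤ 1 := by
            rw [div_le_one hM0]
            refine le_trans ?_ hsmall.le
            have : R' ≤ R' ^ 2 := le_self_pow₀ hR'1 (by norm_num)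
            nlinarith) (by
        intro h hh
        rw [mem_filter] at hh
        have := ha h hh.1
        rw [hh.2] at this
        exact ⟨_, this⟩)
    refine ⟨q' * (q₀ * (k + 2)), Nat.mul_pos hq'1 (Nat.mul_pos hq₀.1 (by omega)), ?_, b, ?_⟩
    · refine hbd _ a1 n1 ?_ (by omega) (by omega)
      push_cast
      calc _ ≤ 3 * R' * (Q * (k + 2)) := by gcongr
        _ = _ := by
          simp only [hR', hQ, hr, a1, n1]; push_cast
          simp only [mul_pow, pow_mul, pow_add]; ring
    · refine hbd _ a2 n2 ?_ (by omega) (by omega)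
      have hpos : (0 : ℝ) < M ^ (k + 1) := by positivity
      calc _ = |(q' : ℝ) * (q₀ * ((k + 2 : ℕ) : ℝ) * g.coeff (k + 2)) - b| * M * M ^ (k + 1) := by
            push_cast; ring_nf
        _ ≤ 36 * (Q * r ^ (k + 1) / M ^ (k + 1)) * R' ^ 2 * M ^ (k + 1) := by gcongr
        _ = 36 * (Q * r ^ (k + 1)) * R' ^ 2 := by field_simp
        _ = _ := by
          simp only [hR', hQ, hr, a2, n2]; push_cast
          simp only [mul_pow, pow_mul, pow_add]; ring

theorem sum_range_mul_eq {E : Type*} [AddCommMonoid E] (f : ℕ → E) (m n : ℕ) :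
    ∑ x ∈ range (m * n), f x = ∑ s ∈ range m, ∑ y ∈ range n, f (m * y + s) := by
  induction n with
  | zero => simp
  | succ n ih =>
    simp only [sum_range_succ, mul_add, mul_one, sum_add_distrib]
    rw [sum_range_add, ih]

theorem sum_range_mul_of_periodic {E : Type*} [AddCommMonoid E] (f : ℕ → E) (q T : ℕ)
    (hf : Function.Periodic f q) : ∑ x ∈ range (q * T), f x = T • ∑ x ∈ range q, f x := by
  rw [sum_range_mul_eq, sum_comm]
  have : ∀ y s, f (q * y + s) = f s := fun y s => by
    have := hf.nat_mul y s
    rw [← this]; congr 1; simp; ring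
  simp [this]

theorem ex_div_eq_of_dvd {q : ℕ} (hq : q ≠ 0) {a b : ℤ} (h : (q : ℤ) ∣ a - b) :
    ex (a / q) = ex (b / q) := by
  obtain ⟨c, hc⟩ := h
  have hq' : (q : ℝ) ≠ 0 := by exact_mod_cast hq
  have : (a : ℝ) / q = b / q + c := by
    field_simp
    have : a = b + q * c := by linarith
    rw [this]; push_cast; ring
  rw [this, ex_add_intCast]

theorem periodic_ex_eval (g : ℤ[X]) (q : ℕ) :
    Function.Periodic (fun x : ℕ => ex (g.eval (x : ℤ) / q)) q := by
  intro x
  rcases eq_or_ne q 0 with rfl | hq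
  · simp
  refine ex_div_eq_of_dvd hq ?_
  have := sub_dvd_eval_sub ((x + q : ℕ) : ℤ) x g
  simpa using this

theorem dvd_coeff_taylor {g : ℤ[X]} {q : ℤ} (h : ∀ j, 1 ≤ j → q ∣ g.coeff j) (s : ℤ) (j : ℕ)
    (hj : 1 ≤ j) : q ∣ (taylor s g).coeff j := by
  have h1 : C q ∣ g - C (g.coeff 0) := by
    rw [C_dvd_iff_dvd_coeff]
    intro i
    rcases Nat.eq_zero_or_pos i with rfl | hi
    · simp
    · rw [coeff_sub, coeff_C_of_ne_zero hi.ne', sub_zero]; exact h i hi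
  obtain ⟨B, hB⟩ := h1
  rw [sub_eq_iff_eq_add.1 hB]
  simp only [map_add, taylor_mul, taylor_C, coeff_add, coeff_C_mul]
  rw [coeff_C_of_ne_zero (by omega), add_zero]
  exact dvd_mul_right _ _

/-- A large complete exponential sum modulo `q` forces a bounded multiple of the nonconstant part
of the polynomial to vanish modulo `q`. -/
theorem dvd_of_large_complete_sum (k : ℕ) : ∃ C : ℕ, ∀ (R : ℝ) (q : ℕ) (g : ℤ[X]), 1 ≤ R → 1 ≤ q →
    g.natDegree ≤ k → q ≤ R * ‖∑ x ∈ range q, ex (g.eval (x : ℤ) / q)‖ →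
    ∃ Q : ℕ, 1 ≤ Q ∧ Q ≤ C * R ^ C ∧ ∀ j, 1 ≤ j → (q : ℤ) ∣ Q * g.coeff j := by
  induction k with
  | zero =>
    refine ⟨1, fun R q g hR hq hg _ => ⟨1, le_rfl, by simpa using hR, fun j hj => ?_⟩⟩
    rw [coeff_eq_zero_of_natDegree_lt (by omega)]; simp
  | succ k ih =>
    obtain ⟨C₁, hC₁⟩ := ih
    obtain ⟨C₂, hC₂⟩ := inverse_weyl k
    refine ⟨C₁ * C₂ ^ (k + 1) + (C₁ + C₂ * (k + 1)), fun R q g hR hq hg hS => ?_⟩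
    have hq0 : (0 : ℝ) < q := by exact_mod_cast hq
    obtain ⟨T, hT⟩ := exists_nat_gt (C₂ * R ^ C₂)
    have hT0 : (0 : ℝ) < T := lt_of_le_of_lt (by positivity) hT
    have hT1 : 1 ≤ T := by exact_mod_cast hT0
    set gr : ℝ[X] := C ((q : ℝ)⁻¹) * g.map (Int.castRingHom ℝ) with hgr
    have hev : ∀ x : ℕ, gr.eval (x : ℝ) = g.eval (x : ℤ) / q := fun x => by
      rw [hgr, eval_mul, eval_C, div_eq_inv_mul]
      congr 1
      have := eval_intCast_map (Int.castRingHom ℝ) g x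
      simp
    obtain ⟨q₁, hq₁, hq₁C, a, ha⟩ := hC₂ R (q * T) gr hR (Nat.mul_pos hq hT1)
      ((natDegree_C_mul_le _ _).trans (natDegree_map_le.trans hg)) (by
        simp only [hev]
        rw [sum_range_mul_of_periodic (fun x : ℕ => ex (g.eval (x : ℤ) / q)) q T
          (periodic_ex_eval g q), nsmul_eq_mul, norm_mul, Complex.norm_natCast]
        push_cast
        nlinarith)
    have hlead : (q : ℤ) ∣ q₁ * g.coeff (k + 1) := by
      have h1 : |q₁ * gr.coeff (k + 1) - a| * (q * T) < T := by
        refine lt_of_le_of_lt ?_ hT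
        refine le_trans ?_ ha
        push_cast
        gcongr
        refine le_self_pow₀ ?_ (by omega)
        exact_mod_cast Nat.mul_pos hq hT1
      have h2 : (q₁ * gr.coeff (k + 1) - a) * q = ((q₁ * g.coeff (k + 1) - a * q : ℤ) : ℝ) := by
        rw [hgr, coeff_C_mul, coeff_map]; push_cast; simp; field_simp
      have h3 : |((q₁ * g.coeff (k + 1) - a * q : ℤ) : ℝ)| < 1 := by
        rw [← h2, abs_mul, abs_of_pos hq0]
        by_contra! h
        nlinarith
      have h4 : q₁ * g.coeff (k + 1) - a * q = 0 := by
        rw [← Int.abs_lt_one_iff]; exact_mod_cast h3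
      exact ⟨a, by linarith⟩
    have hq₁0 : (0 : ℝ) < q₁ := by exact_mod_cast hq₁
    obtain ⟨s, hs, hsS⟩ : ∃ s ∈ range q₁,
        (q : ℝ) ≤ R * ‖∑ y ∈ range q, ex (g.eval ((q₁ * y + s : ℕ) : ℤ) / q)‖ := by
      by_contra! h
      have h1 : (q₁ : ℝ) * q ≤ R * ∑ s ∈ range q₁,
          ‖∑ y ∈ range q, ex (g.eval ((q₁ * y + s : ℕ) : ℤ) / q)‖ := by
        have h2 : ‖∑ x ∈ range (q₁ * q), ex (g.eval (x : ℤ) / q)‖ ≤ ∑ s ∈ range q₁,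
          ‖∑ y ∈ range q, ex (g.eval ((q₁ * y + s : ℕ) : ℤ) / q)‖ := by
          rw [sum_range_mul_eq]; exact norm_sum_le _ _
        rw [mul_comm q₁, sum_range_mul_of_periodic (fun x : ℕ => ex (g.eval (x : ℤ) / q)) q q₁
          (periodic_ex_eval g q), nsmul_eq_mul, norm_mul, Complex.norm_natCast] at h2
        nlinarith
      rw [mul_sum] at h1
      have h3 := sum_lt_sum_of_nonempty ⟨0, mem_range.2 hq₁⟩ h
      rw [sum_const, card_range, nsmul_eq_mul] at h3
      linarith
    set t := taylor (s : ℤ) g with ht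
    set w : ℤ[X] := t.comp (C (q₁ : ℤ) * X) with hw
    have hwc : ∀ j, w.coeff j = q₁ ^ j * t.coeff j := fun j => by
      rw [hw, comp_C_mul_X_coeff]; ring
    have htd : t.natDegree ≤ k + 1 := by rw [ht, natDegree_taylor]; exact hg
    have htl : t.coeff (k + 1) = g.coeff (k + 1) := by
      rw [ht, taylor_coeff]
      have hd : (hasseDeriv (k + 1) g).natDegree < 1 := by
        have := natDegree_hasseDeriv_le g (k + 1)
        omega
      rw [eval_eq_sum_range' hd, sum_range_one, hasseDeriv_coeff]
      simp
    have hwl : (q : ℤ) ∣ w.coeff (k + 1) := by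
      rw [hwc, htl, pow_succ, mul_assoc]; exact Dvd.dvd.mul_left hlead _
    have hwd : w.natDegree ≤ k + 1 := by
      rw [natDegree_le_iff_coeff_eq_zero]
      intro m hm
      rw [hwc, coeff_eq_zero_of_natDegree_lt (lt_of_le_of_lt htd hm), mul_zero]
    set v := w - C (w.coeff (k + 1)) * X ^ (k + 1) with hv
    have hvc : ∀ j, v.coeff j = if j = k + 1 then 0 else w.coeff j := fun j => by
      rw [hv, coeff_sub, coeff_C_mul, coeff_X_pow]; split_ifs with h
      · simp [h]
      · simp
    have hvd : v.natDegree ≤ k := by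
      rw [natDegree_le_iff_coeff_eq_zero]
      intro m hm
      rw [hvc]; split_ifs with h
      · rfl
      · exact coeff_eq_zero_of_natDegree_lt (by omega)
    obtain ⟨Q, hQ1, hQ, hQd⟩ := hC₁ R q v hR hq hvd (by
      have h1 : ∀ y : ℕ, ex (v.eval (y : ℤ) / q) = ex (g.eval ((q₁ * y + s : ℕ) : ℤ) / q) := by
        intro y
        refine ex_div_eq_of_dvd (by omega) ?_
        have : g.eval ((q₁ * y + s : ℕ) : ℤ) = w.eval (y : ℤ) := by
          rw [hw, eval_comp, ht, taylor_eval]; simp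
        rw [this, hv, eval_sub, sub_sub_cancel_left, dvd_neg, eval_mul, eval_C]
        exact Dvd.dvd.mul_right hwl _
      simpa only [h1] using hsS)
    refine ⟨Q * q₁ ^ (k + 1), Nat.mul_pos hQ1 (pow_pos hq₁ _), ?_, ?_⟩
    · push_cast
      calc (Q : ℝ) * q₁ ^ (k + 1) ≤ (C₁ * R ^ C₁) * (C₂ * R ^ C₂) ^ (k + 1) := by gcongr
        _ = ((C₁ * C₂ ^ (k + 1) : ℕ) : ℝ) * R ^ (C₁ + C₂ * (k + 1)) := by
          push_cast; rw [mul_pow, pow_add R, pow_mul R]; ring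
        _ ≤ ((C₁ * C₂ ^ (k + 1) + (C₁ + C₂ * (k + 1)) : ℕ) : ℝ) * _ :=
          mul_pow_le_mul_pow_max hR (by exact_mod_cast Nat.le_add_right _ _) (Nat.le_add_left _ _)
        _ = _ := by push_cast; rfl
    · have h1 : ∀ j, 1 ≤ j → (q : ℤ) ∣ (C ((Q * q₁ ^ (k + 1) : ℕ) : ℤ) * t).coeff j := by
        intro j hj
        rw [coeff_C_mul]
        rcases lt_or_ge (k + 1) j with h | h
        · rw [coeff_eq_zero_of_natDegree_lt (lt_of_le_of_lt htd h)]; simp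
        · have h2 : (q : ℤ) ∣ Q * w.coeff j := by
            rcases eq_or_ne j (k + 1) with rfl | h'
            · exact Dvd.dvd.mul_left hwl _
            · have := hQd j hj
              rwa [hvc, if_neg h'] at this
          rw [hwc] at h2
          have h3 : ((Q * q₁ ^ (k + 1) : ℕ) : ℤ) * t.coeff j =
              Q * (q₁ ^ j * t.coeff j) * q₁ ^ (k + 1 - j) := by
            push_cast
            rw [← Nat.add_sub_of_le h, pow_add, Nat.add_sub_cancel_left]; ring
          rw [h3]; exact Dvd.dvd.mul_right h2 _
      intro j hj
      have h2 := dvd_coeff_taylor h1 (-(s : ℤ)) j hj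
      rw [taylor_mul, taylor_C, coeff_C_mul, ht, taylor_taylor] at h2
      simpa using h2

/-- The average of the exponential sum `x ↦ e(a H(x) / q)` over a full period. -/
noncomputable def completeSum (H : ℤ[X]) (a : ℤ) (q : ℕ) : ℂ :=
  (∑ x ∈ range q, ex ((C a * H).eval (x : ℤ) / q)) / q

/-- Every common divisor of the nonconstant coefficients of `H` divides `Γ`. -/
def ContentDvd (H : ℤ[X]) (Γ : ℕ) : Prop :=
  ∀ n : ℕ, (∀ j, 1 ≤ j → (n : ℤ) ∣ H.coeff j) → n ∣ Γ

theorem modulus_le_of_large_completeSum (k Γ : ℕ) (hΓ : 1 ≤ Γ) : ∃ C : ℕ, ∀ (R : ℝ) (q : ℕ) (a : ℤ)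
    (H : ℤ[X]), 1 ≤ R → 1 ≤ q → IsCoprime a (q : ℤ) → H.natDegree ≤ k → ContentDvd H Γ →
    1 ≤ R * ‖completeSum H a q‖ → q ≤ C * R ^ C := by
  obtain ⟨C₀, hC₀⟩ := dvd_of_large_complete_sum k
  refine ⟨C₀ * Γ + C₀, fun R q a H hR hq haq hH hΓH hS => ?_⟩
  have hq0 : (0 : ℝ) < q := by exact_mod_cast hq
  obtain ⟨Q, hQ1, hQ, hQd⟩ := hC₀ R q (C a * H) hR hq ((natDegree_C_mul_le _ _).trans hH) (by
    rw [completeSum, norm_div, Complex.norm_natCast, mul_div_assoc', le_div_iff₀ hq0] at hS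
    linarith)
  obtain ⟨d, q', Q', hd, hcop, rfl, rfl⟩ := Nat.exists_coprime' (m := q) (n := Q)
    (Nat.gcd_pos_of_pos_left _ hq)
  have h1 : q' ∣ Γ := by
    apply hΓH
    intro j hj
    have h2 := hQd j hj
    rw [coeff_C_mul, mul_left_comm] at h2
    have h3 := haq.symm.dvd_of_dvd_mul_left h2
    push_cast at h3
    rw [mul_right_comm] at h3
    have h4 := Int.dvd_of_mul_dvd_mul_right (by exact_mod_cast hd.ne') h3
    exact (Nat.isCoprime_iff_coprime.2 hcop).dvd_of_dvd_mul_left h4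
  have h2 : q' * d ≤ Γ * (Q' * d) :=
    Nat.mul_le_mul (Nat.le_of_dvd hΓ h1) (Nat.le_mul_of_pos_left _ (Nat.pos_of_mul_pos_right hQ1))
  calc ((q' * d : ℕ) : ℝ) ≤ Γ * (Q' * d : ℕ) := by exact_mod_cast h2
    _ ≤ Γ * (C₀ * R ^ C₀) := by gcongr
    _ = ((C₀ * Γ : ℕ) : ℝ) * R ^ C₀ := by push_cast; ring
    _ ≤ _ := mul_pow_le_mul_pow_max hR (by exact_mod_cast Nat.le_add_right _ _)
      (Nat.le_add_left _ _)

section Weight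

variable {E : Type*} [Field E]

/-- The substitution `X ↦ T ^ p`, `Y ↦ Z T ^ k` from `E[X][Y]` to `E[Z][T]`; the degree in `T` is
the weight for which `X` has weight `p` and `Y` has weight `k`. -/
noncomputable def weightHom (E : Type*) [Field E] (p k : ℕ) : E[X][X] →+* E[X][X] :=
  eval₂RingHom ((mapRingHom C).comp (expand E p : E[X] →+* E[X])) (C X * X ^ k)

theorem weightHom_monomial (p k b d : ℕ) (c : E) :
    weightHom E p k (monomial b (monomial d c)) = monomial (p * d + k * b) (monomial b c) := by
  rw [weightHom, coe_eval₂RingHom, eval₂_monomial]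
  simp only [RingHom.comp_apply, RingHom.coe_coe, expand_monomial, coe_mapRingHom, map_monomial]
  rw [mul_pow, ← C_pow, ← pow_mul, ← mul_assoc, monomial_mul_C, ← C_mul_X_pow_eq_monomial,
    mul_assoc, ← pow_add, C_mul_X_pow_eq_monomial, C_mul_X_pow_eq_monomial, mul_comm d]

theorem coeff_weightHom (p k b d : ℕ) (hp : 0 < p) (P : E[X][X]) :
    ((weightHom E p k P).coeff (p * d + k * b)).coeff b = (P.coeff b).coeff d := by
  induction P using Polynomial.induction_on' with
  | add P Q hP hQ => simp [hP, hQ]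
  | monomial b' f =>
    induction f using Polynomial.induction_on' with
    | add f g hf hg => simp [hf, hg]
    | monomial d' c =>
      rw [weightHom_monomial, coeff_monomial, coeff_monomial]
      by_cases hb : b' = b
      · subst hb
        by_cases hd : d' = d
        · subst hd; simp
        · have : ¬ p * d' + k * b' = p * d + k * b' := by
            intro h; exact hd (Nat.eq_of_mul_eq_mul_left hp (by omega))
          rw [if_neg this, if_pos rfl, coeff_monomial, if_neg hd, coeff_zero]
      · rw [if_neg hb]
        split_ifs
        · rw [coeff_monomial, if_neg hb, coeff_zero]
        · rfl

theorem exists_of_coeff_weightHom_ne_zero {p k b n : ℕ} {P : E[X][X]}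
    (h : ((weightHom E p k P).coeff n).coeff b ≠ 0) : ∃ d, n = p * d + k * b := by
  contrapose! h
  induction P using Polynomial.induction_on' with
  | add P Q hP hQ => simp [hP, hQ]
  | monomial b' f =>
    induction f using Polynomial.induction_on' with
    | add f g hf hg => simp [hf, hg]
    | monomial d' c =>
      rw [weightHom_monomial, coeff_monomial]
      split_ifs with h1
      · rw [coeff_monomial, if_neg]
        rintro rfl
        exact h d' h1.symm
      · simp

theorem weightHom_injective (p k : ℕ) (hp : 0 < p) : Function.Injective (weightHom E p k) := by
  rw [injective_iff_map_eq_zero]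
  intro P hP
  ext b d
  rw [← coeff_weightHom p k b d hp, hP]; simp

/-- Specialisation of the auxiliary variable `Z` in `weightHom` to `γ`. -/
noncomputable def leadHom (p k : ℕ) (γ : E) : E[X][X] →+* E[X] :=
  (mapRingHom (evalRingHom γ)).comp (weightHom E p k)

theorem degree_leadHom_le (p k : ℕ) (γ : E) (P : E[X][X]) :
    (leadHom p k γ P).degree ≤ (weightHom E p k P).degree := degree_map_le

theorem degree_leadHom_of_degree_lt {p k : ℕ} {γ : E} (hp : 0 < p) (hpk : k.Coprime p)
    (hγ : γ ≠ 0) {P : E[X][X]} (hP : P.degree < p) :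
    (leadHom p k γ P).degree = (weightHom E p k P).degree := by
  rcases eq_or_ne P 0 with rfl | hP0
  · simp
  have h0 : weightHom E p k P ≠ 0 := by
    rwa [Ne, map_eq_zero_iff _ (weightHom_injective p k hp)]
  refine degree_map_eq_of_leadingCoeff_ne_zero _ ?_
  set n := (weightHom E p k P).natDegree
  set L := (weightHom E p k P).leadingCoeff with hL
  have hL0 : L ≠ 0 := leadingCoeff_ne_zero.2 h0
  have key : ∀ b, L.coeff b ≠ 0 → b < p ∧ ∃ d, n = p * d + k * b := by
    intro b hb
    obtain ⟨d, hd⟩ := exists_of_coeff_weightHom_ne_zero (n := n) hb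
    refine ⟨?_, d, hd⟩
    by_contra! hbp
    refine hb ?_
    rw [hL, leadingCoeff, show (weightHom E p k P).natDegree = p * d + k * b from hd,
      coeff_weightHom p k b d hp, coeff_eq_zero_of_degree_lt (n := b)]
    · rfl
    exact lt_of_lt_of_le hP (by exact_mod_cast hbp)
  obtain ⟨b, hb⟩ : ∃ b, L.coeff b ≠ 0 := by
    by_contra! h; exact hL0 (by ext; simp [h])
  have hmon : L = monomial b (L.coeff b) := by
    ext b'
    rw [coeff_monomial]
    split_ifs with h
    · rw [h]
    · by_contra hb'
      obtain ⟨h1, d, hd⟩ := key b hb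
      obtain ⟨h2, d', hd'⟩ := key b' hb'
      apply h
      have h3 : k * b ≡ k * b' [MOD p] := by
        have : p * d + k * b = p * d' + k * b' := by omega
        have h4 : p * d + k * b ≡ p * d' + k * b' [MOD p] := by rw [this]
        simpa [Nat.ModEq] using h4
      have h5 := Nat.ModEq.cancel_left_of_coprime (by rwa [Nat.coprime_comm] at hpk) h3
      exact Nat.ModEq.eq_of_lt_of_lt h5 h1 h2
  rw [hmon, coe_evalRingHom, eval_monomial]
  exact mul_ne_zero hb (pow_ne_zero _ hγ)

/-- The Artin–Schreier relation `Y ^ p - Y - F(X)`. -/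
noncomputable def artinSchreier (p : ℕ) (F : E[X]) : E[X][X] := X ^ p - (X + C F)

theorem monic_artinSchreier {p : ℕ} (hp : 2 ≤ p) (F : E[X]) : (artinSchreier p F).Monic := by
  refine monic_X_pow_sub ?_
  refine (degree_add_le _ _).trans_lt (max_lt ?_ ?_)
  · rw [degree_X]; exact_mod_cast (by omega : 1 < p)
  · exact degree_C_le.trans_lt (by exact_mod_cast (by omega : 0 < p))

theorem natDegree_artinSchreier {p : ℕ} (hp : 2 ≤ p) (F : E[X]) :
    (artinSchreier p F).natDegree = p := by
  rw [artinSchreier, natDegree_sub_eq_left_of_natDegree_lt, natDegree_X_pow]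
  rw [natDegree_X_add_C, natDegree_X_pow]; omega

theorem weightHom_artinSchreier (p k : ℕ) (F : E[X]) :
    weightHom E p k (artinSchreier p F) =
      (C X * X ^ k) ^ p - (C X * X ^ k + (expand E p F).map C) := by
  simp [artinSchreier, weightHom]

theorem leadHom_artinSchreier (p k : ℕ) (γ : E) (F : E[X]) :
    leadHom p k γ (artinSchreier p F) =
      (C γ * X ^ k) ^ p - (C γ * X ^ k + expand E p F) := by
  rw [leadHom, RingHom.comp_apply, weightHom_artinSchreier]
  have : (evalRingHom γ).comp (C : E →+* E[X]) = RingHom.id E := by ext; simp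
  simp [Polynomial.map_map, Polynomial.map_pow, this]

theorem degree_leadHom_artinSchreier_lt {p k : ℕ} {γ : E} (hp : 2 ≤ p) {F : E[X]} (hk : 1 ≤ k)
    (hF : F.natDegree = k) (hγ : γ ^ p = F.leadingCoeff) :
    (leadHom p k γ (artinSchreier p F)).degree < (weightHom E p k (artinSchreier p F)).degree := by
  have hkp : k < k * p := by nlinarith
  have h1 : (leadHom p k γ (artinSchreier p F)).degree < (k * p : ℕ) := by
    rw [degree_lt_iff_coeff_zero]
    intro m hm
    rw [leadHom_artinSchreier, mul_pow, ← pow_mul, ← C_pow, coeff_sub, coeff_add, coeff_C_mul,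
      coeff_C_mul, coeff_X_pow, coeff_X_pow, if_neg (by omega : ¬ m = k)]
    rcases eq_or_lt_of_le hm with rfl | h
    · rw [mul_comm k p, coeff_expand_mul' (by omega), ← hF, hγ]; simp
    · rw [if_neg (by omega), coeff_eq_zero_of_natDegree_lt]
      · simp
      · rw [natDegree_expand, hF]; exact h
  refine h1.trans_le (le_degree_of_ne_zero ?_)
  rw [weightHom_artinSchreier, mul_pow, ← pow_mul, ← C_pow, coeff_sub, coeff_add, coeff_C_mul,
      coeff_C_mul, coeff_X_pow, coeff_X_pow, if_neg (by omega : ¬ k * p = k), if_pos rfl, coeff_map,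
      mul_comm k p, coeff_expand_mul' (by omega)]
  intro h
  have := congr_arg (fun f : E[X] => f.coeff p) h
  simp [coeff_X_pow, coeff_C, show p ≠ 0 by omega] at this

theorem degree_leadHom_lt_of_dvd {p k : ℕ} {γ : E} (hp : 2 ≤ p) {F : E[X]} (hk : 1 ≤ k)
    (hF : F.natDegree = k) (hγ : γ ^ p = F.leadingCoeff) {P : E[X][X]} (hP : P ≠ 0)
    (h : artinSchreier p F ∣ P) :
    (leadHom p k γ P).degree < (weightHom E p k P).degree := by
  obtain ⟨Q, rfl⟩ := h
  have hQ : Q ≠ 0 := right_ne_zero_of_mul hP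
  rw [map_mul, map_mul, degree_mul, degree_mul]
  have h1 := degree_leadHom_artinSchreier_lt hp hk hF hγ
  have h2 := degree_leadHom_le p k γ Q
  have h3 : (weightHom E p k Q).degree ≠ ⊥ := by
    rw [Ne, degree_eq_bot, map_eq_zero_iff _ (weightHom_injective p k (by omega))]; exact hQ
  calc _ ≤ (leadHom p k γ (artinSchreier p F)).degree + (weightHom E p k Q).degree := by gcongr
    _ < _ := WithBot.add_lt_add_right h3 h1

theorem degree_weightHom_modByMonic_le {p k : ℕ} {γ : E} (hp : 2 ≤ p) {F : E[X]} (hk : 1 ≤ k)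
    (hpk : k.Coprime p) (hF : F.natDegree = k) (hγ : γ ^ p = F.leadingCoeff) (hγ0 : γ ≠ 0)
    (P : E[X][X]) :
    (weightHom E p k (P %ₘ artinSchreier p F)).degree ≤ (weightHom E p k P).degree := by
  have hmon := monic_artinSchreier hp F
  by_contra! h
  set R := P %ₘ artinSchreier p F with hR
  have hRd : R.degree < p := by
    have := degree_modByMonic_lt P hmon
    rwa [degree_eq_natDegree hmon.ne_zero, natDegree_artinSchreier hp] at this
  have h1 : artinSchreier p F ∣ P - R := by
    refine ⟨P /ₘ artinSchreier p F, ?_⟩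
    have := modByMonic_add_div P (artinSchreier p F)
    linear_combination -this
  have hne : P - R ≠ 0 := by
    intro h0; rw [sub_eq_zero.1 h0] at h; exact lt_irrefl _ h
  have h2 := degree_leadHom_lt_of_dvd hp hk hF hγ hne h1
  have h3 := degree_leadHom_of_degree_lt (by omega) hpk hγ0 hRd
  have h4 := degree_leadHom_le p k γ P
  rw [map_sub, map_sub, degree_sub_eq_right_of_degree_lt h, degree_sub_eq_right_of_degree_lt, h3]
    at h2
  · exact lt_irrefl _ h2
  · rw [h3]; exact h4.trans_lt h

end Weight

section Stepanov

variable {E : Type*} [Field E]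

/-- The polynomial in `E[X][Y]` with coefficients `c` at the monomials `X ^ a Y ^ b`. -/
noncomputable def boxPoly {l p : ℕ} (c : Fin l × Fin p → E) : E[X][X] :=
  ∑ j, monomial (j.2 : ℕ) (monomial (j.1 : ℕ) (c j))

theorem boxPoly_sub {l p : ℕ} (c c' : Fin l × Fin p → E) :
    boxPoly (c - c') = boxPoly c - boxPoly c' := by
  simp [boxPoly, sum_sub_distrib]

theorem coeff_boxPoly {l p : ℕ} (c : Fin l × Fin p → E) (j : Fin l × Fin p) :
    ((boxPoly c).coeff (j.2 : ℕ)).coeff (j.1 : ℕ) = c j := by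
  rw [boxPoly, finsetSum_coeff, finsetSum_coeff, sum_eq_single j]
  · simp
  · intro i _ hij
    rw [coeff_monomial]
    split_ifs with h
    · rw [coeff_monomial, if_neg]
      intro h'; exact hij (Prod.ext (Fin.ext h') (Fin.ext h))
    · simp
  · simp

theorem degree_boxPoly_lt {l p : ℕ} (c : Fin l × Fin p → E) : (boxPoly c).degree < p := by
  rw [boxPoly, ← mem_degreeLT]
  refine Submodule.sum_mem _ fun j _ => ?_
  rw [mem_degreeLT]
  exact (degree_monomial_le _ _).trans_lt (by exact_mod_cast j.2.2)

theorem degree_weightHom_boxPoly_le {l p : ℕ} (k : ℕ) (c : Fin l × Fin p → E) :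
    (weightHom E p k (boxPoly c)).degree ≤ (p * (l - 1) + k * (p - 1) : ℕ) := by
  rw [boxPoly, map_sum, ← mem_degreeLE]
  refine Submodule.sum_mem _ fun j _ => ?_
  rw [mem_degreeLE, weightHom_monomial]
  refine (degree_monomial_le _ _).trans ?_
  have h1 := j.1.2
  have h2 := j.2.2
  have h3 : p * (j.1 : ℕ) + k * (j.2 : ℕ) ≤ p * (l - 1) + k * (p - 1) := by
    gcongr <;> omega
  exact_mod_cast h3

theorem boxPoly_ne_zero {l p : ℕ} {c : Fin l × Fin p → E} (hc : c ≠ 0) : boxPoly c ≠ 0 := by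
  intro h
  apply hc
  ext j
  rw [← coeff_boxPoly c j, h]; simp

/-- The monomial `X ^ a Y ^ b` in `E[X][Y]`. -/
noncomputable def mon (E : Type*) [Field E] (a b : ℕ) : E[X][X] := monomial b (monomial a 1)

theorem degree_weightHom_mon (p k a b : ℕ) :
    (weightHom E p k (mon E a b)).degree = (p * a + k * b : ℕ) := by
  rw [mon, weightHom_monomial, degree_monomial]
  simp

theorem weight_injective {p k a b a' b' : ℕ} (hpk : k.Coprime p) (hb : b < p) (hb' : b' < p)
    (h : p * a + k * b = p * a' + k * b') : a = a' ∧ b = b' := by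
  have h3 : k * b ≡ k * b' [MOD p] := by
    have h4 : p * a + k * b ≡ p * a' + k * b' [MOD p] := by rw [h]
    simpa [Nat.ModEq] using h4
  have h5 := Nat.ModEq.cancel_left_of_coprime (by rwa [Nat.coprime_comm] at hpk) h3
  have h6 := Nat.ModEq.eq_of_lt_of_lt h5 hb hb'
  subst h6
  exact ⟨Nat.eq_of_mul_eq_mul_left (by omega : 0 < p) (by omega), rfl⟩

/-- Non-vanishing of Bombieri's auxiliary function on the Artin–Schreier curve. -/
theorem not_dvd_sum_boxPoly {p k l m s : ℕ} {γ : E} (hp : 2 ≤ p) {F : E[X]} (hk : 1 ≤ k)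
    (hpk : k.Coprime p) (hF : F.natDegree = k) (hγ : γ ^ p = F.leadingCoeff) (hγ0 : γ ≠ 0)
    (hs : p * (l - 1) + k * (p - 1) < s) (c : Fin m × Fin p → Fin l × Fin p → E) (hc : c ≠ 0) :
    ¬ artinSchreier p F ∣ ∑ i, boxPoly (c i) * mon E i.1 i.2 ^ s := by
  intro hdvd
  set f : Fin m × Fin p → E[X][X] := fun i => boxPoly (c i) * mon E i.1 i.2 ^ s with hf
  have hΘ : ∀ i, (leadHom p k γ (f i)).degree = (weightHom E p k (f i)).degree := by
    intro i
    rw [hf]; simp only [map_mul, map_pow, degree_mul, degree_pow]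
    rw [degree_leadHom_of_degree_lt (by omega) hpk hγ0 (degree_boxPoly_lt _),
      degree_leadHom_of_degree_lt (by omega) hpk hγ0 (P := mon E i.1 i.2)]
    exact (degree_monomial_le _ _).trans_lt (by exact_mod_cast i.2.2)
  have hinj : ∀ i i', f i ≠ 0 → f i' ≠ 0 → (weightHom E p k (f i)).degree =
      (weightHom E p k (f i')).degree → i = i' := by
    have key : ∀ i, f i ≠ 0 → ∃ d < s, (weightHom E p k (f i)).degree =
        (d + s * (p * i.1 + k * i.2) : ℕ) := by
      intro i hi
      have h0 : weightHom E p k (boxPoly (c i)) ≠ 0 := by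
        rw [Ne, map_eq_zero_iff _ (weightHom_injective p k (by omega))]
        exact left_ne_zero_of_mul hi
      refine ⟨(weightHom E p k (boxPoly (c i))).natDegree, ?_, ?_⟩
      · exact (natDegree_le_of_degree_le (degree_weightHom_boxPoly_le k (c i))).trans_lt hs
      · rw [hf]; simp only [map_mul, map_pow, degree_mul, degree_pow]
        rw [degree_weightHom_mon, degree_eq_natDegree h0]
        push_cast; simp [mul_add]
    intro i i' hi hi' h
    obtain ⟨d, hd, h1⟩ := key i hi
    obtain ⟨d', hd', h2⟩ := key i' hi'
    rw [h1, h2] at h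
    have h3 : d + s * (p * i.1 + k * i.2) = d' + s * (p * i'.1 + k * i'.2) := by exact_mod_cast h
    have h4 : p * (i.1 : ℕ) + k * i.2 = p * i'.1 + k * i'.2 := by
      have h5 := congr_arg (· / s) h3
      simp only [Nat.add_mul_div_left _ _ (show 0 < s by omega), Nat.div_eq_of_lt hd,
        Nat.div_eq_of_lt hd'] at h5
      omega
    obtain ⟨h5, h6⟩ := weight_injective hpk i.2.2 i'.2.2 h4
    exact Prod.ext (Fin.ext h5) (Fin.ext h6)
  have hne : ∀ i, leadHom p k γ (f i) ≠ 0 → f i ≠ 0 := by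
    intro i hi h; rw [h] at hi; simp at hi
  have hne' : ∀ i, weightHom E p k (f i) ≠ 0 → f i ≠ 0 := by
    intro i hi h; rw [h] at hi; simp at hi
  have h1 : (leadHom p k γ (∑ i, f i)).degree = univ.sup fun i => (leadHom p k γ (f i)).degree := by
    rw [map_sum]
    refine degree_sum_eq_of_disjoint _ _ ?_
    rintro i ⟨-, hi⟩ j ⟨-, hj⟩ hij h
    simp only [Function.comp_apply, hΘ] at h
    exact hij (hinj i j (hne i hi) (hne j hj) h)
  have h2 : (weightHom E p k (∑ i, f i)).degree =
      univ.sup fun i => (weightHom E p k (f i)).degree := by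
    rw [map_sum]
    refine degree_sum_eq_of_disjoint _ _ ?_
    rintro i ⟨-, hi⟩ j ⟨-, hj⟩ hij h
    exact hij (hinj i j (hne' i hi) (hne' j hj) h)
  have hne0 : ∑ i, f i ≠ 0 := by
    intro h0
    obtain ⟨i, hi⟩ := Function.ne_iff.1 hc
    have h3 : f i ≠ 0 := by
      rw [hf]
      refine mul_ne_zero (boxPoly_ne_zero hi) (pow_ne_zero _ ?_)
      rw [mon, Ne, monomial_eq_zero_iff, monomial_eq_zero_iff]; exact one_ne_zero
    rw [h0, map_zero, degree_zero] at h2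
    have h4 : (weightHom E p k (f i)).degree ≤ ⊥ := by
      rw [h2]; exact le_sup (f := fun i => (weightHom E p k (f i)).degree) (mem_univ i)
    rw [le_bot_iff, degree_eq_bot, map_eq_zero_iff _ (weightHom_injective p k (by omega))] at h4
    exact h3 h4
  have h5 := degree_leadHom_lt_of_dvd hp hk hF hγ hne0 hdvd
  rw [h1, h2] at h5
  simp only [hΘ] at h5
  exact lt_irrefl _ h5

theorem evalEval_artinSchreier (p : ℕ) (F : E[X]) (x y : E) :
    evalEval x y (artinSchreier p F) = y ^ p - (y + F.eval x) := by
  simp [artinSchreier, evalEval]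

theorem card_le_of_vanishing {p W : ℕ} [Fact p.Prime] [CharP E p] [Fintype E] [DecidableEq E]
    {F : E[X]} {V : E[X][X]}
    (hV : ¬ artinSchreier p F ∣ V) {d : ℕ}
    (hd : ∀ b, p * ((V %ₘ artinSchreier p F).coeff b).natDegree ≤ W)
    (hdW : W ≤ p * d)
    (hvan : ∀ x y : E, y ^ p - y = F.eval x → evalEval x y V = 0) :
    #{x : E | ∃ y : E, y ^ p - y = F.eval x} ≤ d := by
  have hp := (Fact.out : p.Prime).two_le
  have hmon := monic_artinSchreier hp F
  set G := V %ₘ artinSchreier p F with hG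
  have hG0 : G ≠ 0 := by
    rwa [Ne, hG, modByMonic_eq_zero_iff_dvd hmon]
  have hGd : G.natDegree < p := by
    have := natDegree_modByMonic_lt V hmon (by
      intro h; have := natDegree_artinSchreier hp F; rw [h] at this; simp at this; omega)
    rwa [natDegree_artinSchreier hp] at this
  obtain ⟨b, hb⟩ : ∃ b, G.coeff b ≠ 0 := by
    by_contra! h; exact hG0 (by ext1; simp [h])
  have hvanG : ∀ x y : E, y ^ p - y = F.eval x → evalEval x y G = 0 := by
    intro x y h
    have h1 := modByMonic_add_div V (artinSchreier p F)
    have h2 := congr_arg (evalEvalRingHom x y) h1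
    simp only [map_add, map_mul, coe_evalEvalRingHom, evalEval_artinSchreier, hvan x y h] at h2
    rw [← h] at h2
    simpa using h2
  have hroot : ∀ x ∈ ({x : E | ∃ y : E, y ^ p - y = F.eval x} : Finset E),
      x ∈ (G.coeff b).roots.toFinset := by
    intro x hx
    rw [mem_filter] at hx
    obtain ⟨-, y, hy⟩ := hx
    rw [Multiset.mem_toFinset, mem_roots hb, IsRoot.def]
    let _ : Algebra (ZMod p) E := ZMod.algebra E p
    have h0 : G.map (evalRingHom x) = 0 := by
      refine eq_zero_of_natDegree_lt_card_of_eval_eq_zero _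
        (f := fun i : ZMod p => y + algebraMap (ZMod p) E i) ?_ ?_ ?_
      · intro i j hij
        exact (algebraMap (ZMod p) E).injective (add_left_cancel hij)
      · intro i
        rw [map_evalRingHom_eval]
        refine hvanG x _ ?_
        rw [add_pow_char, ← map_pow, ZMod.pow_card, ← hy]; ring
      · rw [ZMod.card]; exact natDegree_map_le.trans_lt hGd
    have := congr_arg (fun f : E[X] => f.coeff b) h0
    simpa using this
  refine (card_le_card hroot).trans ((Multiset.toFinset_card_le _).trans ((card_roots' _).trans ?_))
  exact Nat.le_of_mul_le_mul_left ((hd b).trans hdW) (by omega)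

end Stepanov

theorem stepanov_dim_lt {p k l u : ℕ} (hp : 2 ≤ p) (hk : 1 ≤ k) (hl : 1 ≤ l) (hu : u = l + k)
    (hku : (k + 2) ^ 2 ≤ u) :
    (p * u) * (p * (l - 1) + k * (p - 1)) + (p * (u + k + 1) + k * (p - 1)) + 1 <
      (l * p) * ((u + k + 2) * p) := by
  have h1 : u * (l - 1 + k) + (2 * k + 1) < l * (u + k + 2) := by
    obtain ⟨l, rfl⟩ := Nat.exists_eq_add_of_le' hl
    subst hu
    simp only [Nat.add_sub_cancel]
    nlinarith
  have h2 : p * (p - 1) + p = p * p := by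
    obtain ⟨p, rfl⟩ := Nat.exists_eq_add_of_le' (show 1 ≤ p by omega)
    simp only [Nat.add_sub_cancel]; ring
  have h3 : p * 1 ≤ p * p := Nat.mul_le_mul_left _ (by omega)
  have h4 : p * u ≤ p * u * k := Nat.le_mul_of_pos_right _ hk
  have h5 : k * (p - 1) + k = k * p := by
    obtain ⟨p, rfl⟩ := Nat.exists_eq_add_of_le' (show 1 ≤ p by omega)
    simp only [Nat.add_sub_cancel]; ring
  calc (p * u) * (p * (l - 1) + k * (p - 1)) + (p * (u + k + 1) + k * (p - 1)) + 1
      ≤ (p * u) * (p * (l - 1) + k * (p - 1)) + (p * u * k + p * (2 * k + 1)) := by nlinarith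
    _ = p * p * u * (l - 1) + u * k * (p * (p - 1) + p) + p * (2 * k + 1) := by ring
    _ = p * p * u * (l - 1) + u * k * (p * p) + p * 1 * (2 * k + 1) := by rw [h2]; ring
    _ ≤ p * p * u * (l - 1) + u * k * (p * p) + p * p * (2 * k + 1) := by gcongr
    _ = p * p * (u * (l - 1 + k) + (2 * k + 1)) := by ring
    _ < p * p * (l * (u + k + 2)) := by gcongr
    _ = _ := by ring

theorem stepanov {p k n : ℕ} [Fact p.Prime] {E : Type*} [Field E] [Fintype E] [DecidableEq E]
    [CharP E p] (F : E[X]) (hF : F.natDegree = k) (hk : 1 ≤ k) (hkp : k < p)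
    (hE : Fintype.card E = (p ^ (n + 1)) ^ 2) (hn : (k + 2) ^ 2 ≤ p ^ n) :
    #{x : E | ∃ y : E, y ^ p - y = F.eval x} ≤ p ^ (n + 1) * p ^ n +
      (p * (2 * k + 1) + 1) * p ^ n := by
  have hpp := (Fact.out : p.Prime)
  have hp := hpp.two_le
  have hpk : k.Coprime p := by
    rw [Nat.coprime_comm, hpp.coprime_iff_not_dvd]
    intro h; exact absurd (Nat.le_of_dvd hk h) (by omega)
  obtain ⟨γ, hγ⟩ : ∃ γ : E, γ ^ p = F.leadingCoeff := by
    obtain ⟨γ, h⟩ := (bijective_frobenius E p).2 F.leadingCoeff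
    exact ⟨γ, h⟩
  have hγ0 : γ ≠ 0 := by
    rintro rfl
    rw [zero_pow (by omega), eq_comm, leadingCoeff_eq_zero] at hγ
    rw [hγ] at hF; simp at hF; omega
  set u := p ^ n with hu
  obtain ⟨l, hl⟩ : ∃ l, u = l + k := Nat.exists_eq_add_of_le' (by nlinarith)
  have hl1 : 1 ≤ l := by nlinarith
  set s := p ^ (n + 1) with hs
  have hspu : s = p * u := by rw [hs, hu, pow_succ']
  set m := u + k + 2 with hm
  have hmon := monic_artinSchreier hp F
  set U : (Fin m × Fin p → Fin l × Fin p → E) → E[X][X] :=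
    fun c => ∑ i, boxPoly (c i) ^ s * mon E i.1 i.2 with hU
  have hUsub : ∀ c c', U (c - c') = U c - U c' := by
    intro c c'
    rw [hU]; simp only [Pi.sub_apply, boxPoly_sub, ← sum_sub_distrib]
    refine sum_congr rfl fun i _ => ?_
    rw [hs, sub_pow_char_pow, sub_mul]
  set B := p * (l - 1) + k * (p - 1) with hB
  set D := p * (m - 1) + k * (p - 1) with hD
  have hmonD : ∀ i : Fin m × Fin p, p * (i.1 : ℕ) + k * i.2 ≤ D := by
    intro i
    have h1 := i.1.2
    have h2 := i.2.2
    rw [hD]; gcongr <;> omega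
  have hUd : ∀ c, (weightHom E p k (U c)).degree ≤ (s * B + D : ℕ) := by
    intro c
    rw [hU]; simp only [map_sum]
    refine (degree_sum_le _ _).trans (Finset.sup_le fun i _ => ?_)
    rw [map_mul, map_pow, degree_mul, degree_pow, degree_weightHom_mon]
    have h1 := degree_weightHom_boxPoly_le k (c i)
    calc _ ≤ s • ((B : ℕ) : WithBot ℕ) + ((D : ℕ) : WithBot ℕ) :=
          add_le_add (nsmul_le_nsmul_right h1 s) (by exact_mod_cast hmonD i)
      _ = _ := by push_cast; simp
  obtain ⟨c, hc0, hc⟩ : ∃ c, c ≠ 0 ∧ artinSchreier p F ∣ U c := by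
    have hcard : Fintype.card (Fin (s * B + D + 1) → E) <
        Fintype.card (Fin m × Fin p → Fin l × Fin p → E) := by
      simp only [Fintype.card_fun, Fintype.card_prod, Fintype.card_fin]
      rw [← pow_mul]
      refine Nat.pow_lt_pow_right Fintype.one_lt_card ?_
      have := stepanov_dim_lt hp hk hl1 hl hn
      rw [hspu]; exact this
    obtain ⟨c, c', hne, h⟩ := Fintype.exists_ne_map_eq_of_card_lt
      (fun c (t : Fin (s * B + D + 1)) => (leadHom p k γ (U c %ₘ artinSchreier p F)).coeff t) hcard
    refine ⟨c - c', sub_ne_zero.2 hne, ?_⟩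
    rw [← modByMonic_eq_zero_iff_dvd hmon, hUsub, sub_modByMonic]
    set P := U c %ₘ artinSchreier p F - U c' %ₘ artinSchreier p F with hP
    have hd1 : ∀ c, (leadHom p k γ (U c %ₘ artinSchreier p F)).natDegree < s * B + D + 1 := by
      intro c
      refine Nat.lt_succ_of_le (natDegree_le_of_degree_le ?_)
      exact (degree_leadHom_le _ _ _ _).trans
        ((degree_weightHom_modByMonic_le hp hk hpk hF hγ hγ0 _).trans (hUd c))
    have hΘ : leadHom p k γ P = 0 := by
      rw [hP, map_sub, sub_eq_zero]
      ext t
      rcases lt_or_ge t (s * B + D + 1) with ht | ht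
      · exact congr_fun h ⟨t, ht⟩
      · rw [coeff_eq_zero_of_natDegree_lt ((hd1 c).trans_le ht),
          coeff_eq_zero_of_natDegree_lt ((hd1 c').trans_le ht)]
    have hPd : P.degree < p := by
      have hr : ∀ Q : E[X][X], (Q %ₘ artinSchreier p F).degree < p := fun Q => by
        have := degree_modByMonic_lt Q hmon
        rwa [degree_eq_natDegree hmon.ne_zero, natDegree_artinSchreier hp] at this
      exact (degree_sub_le _ _).trans_lt (max_lt (hr _) (hr _))
    have := degree_leadHom_of_degree_lt (by omega) hpk hγ0 hPd
    rw [hΘ, degree_zero, eq_comm, degree_eq_bot,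
      map_eq_zero_iff _ (weightHom_injective p k (by omega))] at this
    exact this
  have hBs : B < s := by
    obtain ⟨l', rfl⟩ := Nat.exists_eq_add_of_le' hl1
    obtain ⟨p', hp'⟩ := Nat.exists_eq_add_of_le' (show 1 ≤ p by omega)
    rw [hspu, hl, hB, hp']; simp only [Nat.add_sub_cancel]; nlinarith
  set V : E[X][X] := ∑ i, boxPoly (c i) * mon E i.1 i.2 ^ s with hV
  have hVd : (weightHom E p k V).degree ≤ (B + s * D : ℕ) := by
    rw [hV]; simp only [map_sum]
    refine (degree_sum_le _ _).trans (Finset.sup_le fun i _ => ?_)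
    rw [map_mul, map_pow, degree_mul, degree_pow, degree_weightHom_mon]
    have h1 := degree_weightHom_boxPoly_le k (c i)
    calc _ ≤ ((B : ℕ) : WithBot ℕ) + s • ((D : ℕ) : WithBot ℕ) :=
          add_le_add h1 (nsmul_le_nsmul_right (by exact_mod_cast hmonD i) s)
      _ = _ := by push_cast; simp
  refine card_le_of_vanishing (W := B + s * D) (V := V)
    (not_dvd_sum_boxPoly hp hk hpk hF hγ hγ0 hBs c hc0) ?_ ?_ ?_
  · intro b
    set G := V %ₘ artinSchreier p F with hG
    rcases eq_or_ne (G.coeff b) 0 with h0 | h0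
    · rw [h0]; simp
    have h1 : (weightHom E p k G).coeff (p * (G.coeff b).natDegree + k * b) ≠ 0 := by
      intro h
      have := coeff_weightHom p k b (G.coeff b).natDegree (by omega) G
      rw [h, coeff_zero, eq_comm, coeff_natDegree, leadingCoeff_eq_zero] at this
      exact h0 this
    have h2 := le_degree_of_ne_zero h1
    have h3 := h2.trans ((degree_weightHom_modByMonic_le hp hk hpk hF hγ hγ0 V).trans hVd)
    have h4 : p * (G.coeff b).natDegree + k * b ≤ B + s * D := by exact_mod_cast h3
    omega
  · obtain ⟨l', rfl⟩ := Nat.exists_eq_add_of_le' hl1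
    obtain ⟨p', hp'⟩ := Nat.exists_eq_add_of_le' (show 1 ≤ p by omega)
    have h1 : B ≤ p * u := by rw [← hspu]; exact hBs.le
    have h2 : D ≤ p * (u + 2 * k + 1) := by
      rw [hD, hm, show u + k + 2 - 1 = u + k + 1 by omega, hp']; simp only [Nat.add_sub_cancel]
      nlinarith
    calc B + s * D ≤ p * u + s * (p * (u + 2 * k + 1)) := by gcongr
      _ = _ := by rw [hspu]; ring
  · intro x y hxy
    have h1 : evalEval x y (U c) = 0 := by
      obtain ⟨Q, hQ⟩ := hc
      have h2 := congr_arg (evalEvalRingHom x y) hQ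
      simp only [map_mul, coe_evalEvalRingHom, evalEval_artinSchreier] at h2
      rw [h2, ← hxy]; ring
    have h2 : evalEval x y V ^ s = evalEval x y (U c) := by
      rw [← coe_evalEvalRingHom, hV, hU]
      simp only [map_sum, map_mul, map_pow]
      rw [hs, sum_pow_char_pow]
      refine sum_congr rfl fun i _ => ?_
      rw [mul_pow, ← pow_mul, ← hs, ← sq, ← hE, FiniteField.pow_card]
    rw [h1] at h2
    exact eq_zero_of_pow_eq_zero h2

/-- Additive Hilbert 90 over a finite prime field. -/
theorem exists_pow_sub_of_trace_eq_zero {p : ℕ} [Fact p.Prime] {E : Type*} [Field E] [Finite E]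
    [Algebra (ZMod p) E] {x : E} (hx : Algebra.trace (ZMod p) E x = 0) :
    ∃ y : E, y ^ p - y = x := by
  have hp := Fact.out (p := p.Prime)
  have := charP_of_injective_algebraMap (algebraMap (ZMod p) E).injective p
  have := Module.Finite.of_finite (R := ZMod p) (M := E)
  let φ : E →ₗ[ZMod p] E :=
    (FiniteField.frobeniusAlgHom (ZMod p) E).toLinearMap - LinearMap.id
  have hφ : ∀ y, φ y = y ^ p - y := fun y => by
    simp [φ, FiniteField.frobeniusAlgHom, ZMod.card]
  have hker : Module.finrank (ZMod p) (LinearMap.ker φ) ≤ 1 := by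
    have h1 := FiniteField.pow_finrank_eq_natCard p (LinearMap.ker φ)
    have h2 : Nat.card (LinearMap.ker φ) ≤ p := by
      classical
      have h3 : ((LinearMap.ker φ : Submodule (ZMod p) E) : Set E) ⊆
          ((X ^ p - X : E[X]).roots.toFinset : Set E) := by
        intro y hy
        have : φ y = 0 := hy
        rw [hφ] at this
        simp [FiniteField.X_pow_card_sub_X_ne_zero E hp.one_lt, this]
      have h4 := Set.ncard_le_ncard h3 (Finset.finite_toSet _)
      rw [Set.ncard_coe_finset] at h4
      refine (Nat.card_coe_set_eq _).le.trans (h4.trans ?_)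
      refine (Multiset.toFinset_card_le _).trans ((card_roots' _).trans ?_)
      rw [FiniteField.X_pow_card_sub_X_natDegree_eq E hp.one_lt]
    rw [← h1] at h2
    exact (Nat.pow_le_pow_iff_right hp.one_lt).1 (by simpa using h2)
  have htr : Module.finrank (ZMod p) (LinearMap.ker (Algebra.trace (ZMod p) E)) + 1 =
      Module.finrank (ZMod p) E := by
    have h1 := LinearMap.finrank_range_add_finrank_ker (Algebra.trace (ZMod p) E)
    rw [LinearMap.range_eq_top.2 (Algebra.trace_surjective (ZMod p) E), finrank_top,
      Module.finrank_self] at h1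
    omega
  have hle : LinearMap.range φ ≤ LinearMap.ker (Algebra.trace (ZMod p) E) := by
    rintro _ ⟨y, rfl⟩
    rw [LinearMap.mem_ker, hφ, map_sub]
    rw [sub_eq_zero]
    apply (algebraMap (ZMod p) E).injective
    rw [FiniteField.algebraMap_trace_eq_sum_pow, FiniteField.algebraMap_trace_eq_sum_pow,
      Nat.card_zmod]
    have h0 : Module.finrank (ZMod p) E ≠ 0 := Module.finrank_pos.ne'
    have h5 : y ^ p ^ Module.finrank (ZMod p) E = y := by
      have := Fintype.ofFinite E
      rw [FiniteField.pow_finrank_eq_card, FiniteField.pow_card]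
    have h6 := sum_range_succ (fun i => y ^ p ^ i) (Module.finrank (ZMod p) E)
    rw [sum_range_succ'] at h6
    simp only [h5, pow_zero, pow_one] at h6
    rw [← add_right_cancel h6]
    exact sum_congr rfl fun i _ => by rw [← pow_mul, pow_succ, mul_comm]
  have heq := Submodule.eq_of_le_of_finrank_le hle (by
    have h1 := LinearMap.finrank_range_add_finrank_ker φ
    omega)
  have : x ∈ LinearMap.range φ := heq ▸ hx
  obtain ⟨y, hy⟩ := this
  exact ⟨y, (hφ y).symm.trans hy⟩

theorem norm_sum_addChar_trace_le {p k n : ℕ} [Fact p.Prime] {E : Type*} [Field E] [Fintype E]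
    [Algebra (ZMod p) E] (f : (ZMod p)[X]) (hf : f.natDegree = k) (hk : 1 ≤ k)
    (hkp : k < p) (hE : Fintype.card E = (p ^ (n + 1)) ^ 2) (hn : (k + 2) ^ 2 ≤ p ^ n)
    (ψ : AddChar (ZMod p) ℂ) (hψ : ψ ≠ 1) :
    ‖∑ x : E, ψ (Algebra.trace (ZMod p) E (aeval x f))‖ ≤ p * ((p * (2 * k + 1) + 1) * p ^ n) := by
  classical
  have hp := Fact.out (p := p.Prime)
  have := charP_of_injective_algebraMap (algebraMap (ZMod p) E).injective p
  have := Module.Finite.of_finite (R := ZMod p) (M := E)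
  set T : E → ZMod p := fun x => Algebra.trace (ZMod p) E (aeval x f)
  set B : ℕ := p ^ (n + 1) * p ^ n + (p * (2 * k + 1) + 1) * p ^ n
  have hN : ∀ t, #{x : E | T x = t} ≤ B := by
    intro t
    obtain ⟨γ, hγ⟩ := Algebra.trace_surjective (ZMod p) E t
    have h1 := stepanov (p := p) (k := k) (n := n) (f.map (algebraMap (ZMod p) E) - C γ)
      (by rw [natDegree_sub_C, natDegree_map, hf]) hk hkp hE hn
    refine (card_le_card ?_).trans h1
    intro x hx
    simp only [mem_filter, mem_univ, true_and, T] at hx ⊢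
    have := exists_pow_sub_of_trace_eq_zero (p := p) (x := aeval x f - γ)
      (by rw [map_sub, hx, hγ, sub_self])
    simpa [eval_map_algebraMap] using this
  have hsum : ∑ x : E, ψ (T x) = ∑ t, (#{x : E | T x = t} : ℂ) * ψ t := by
    rw [← sum_fiberwise univ T]
    refine sum_congr rfl fun t _ => ?_
    rw [sum_congr rfl (g := fun _ => ψ t) (fun x hx => by rw [(mem_filter.1 hx).2]), sum_const,
      nsmul_eq_mul]
  have hcard : ∑ t, #{x : E | T x = t} = p * (p ^ (n + 1) * p ^ n) := by
    rw [← card_eq_sum_card_fiberwise (fun _ _ => mem_univ _), card_univ, hE]; ring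
  have hz : ∑ t, ψ t = 0 := AddChar.sum_eq_zero_of_ne_one hψ
  have h2 : ∑ x : E, ψ (T x) = -∑ t, ((B - #{x : E | T x = t} : ℕ) : ℂ) * ψ t := by
    rw [hsum, ← sum_neg_distrib]
    have : ∑ t, (B : ℂ) * ψ t = 0 := by rw [← mul_sum, hz, mul_zero]
    rw [← sub_zero (∑ t, (#{x : E | T x = t} : ℂ) * ψ t), ← this, ← sum_sub_distrib]
    refine sum_congr rfl fun t _ => ?_
    rw [Nat.cast_sub (hN t)]; ring
  rw [h2, norm_neg]
  refine (norm_sum_le _ _).trans ?_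
  have h3 : ∀ t, ‖((B - #{x : E | T x = t} : ℕ) : ℂ) * ψ t‖ = ((B - #{x : E | T x = t} : ℕ) : ℝ) :=
    fun t => by rw [norm_mul, AddChar.norm_apply, mul_one, Complex.norm_natCast]
  simp only [h3]
  rw [← Nat.cast_sum, sum_tsub_distrib _ (fun t _ => hN t), hcard, sum_const, card_univ, ZMod.card,
    smul_eq_mul]
  have : p * B - p * (p ^ (n + 1) * p ^ n) = p * ((p * (2 * k + 1) + 1) * p ^ n) := by
    simp only [B]; rw [mul_add, Nat.add_sub_cancel_left]
  rw [this]; push_cast; rfl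

/-- The power series `-X e' / e`; for `e = ∏ (1 - α X)` its coefficients are the power sums of
the `α`. -/
noncomputable def powerSumSeries {K : Type*} [Field K] (e : PowerSeries K) : PowerSeries K :=
  -(PowerSeries.X * PowerSeries.derivative K e * e⁻¹)

section PowerSumSeries

variable {K L : Type*} [Field K] [Field L]

theorem powerSumSeries_mul_self {e : PowerSeries K} (he : PowerSeries.constantCoeff e ≠ 0) :
    powerSumSeries e * e = -(PowerSeries.X * PowerSeries.derivative K e) := by
  rw [powerSumSeries, neg_mul, mul_assoc, PowerSeries.inv_mul_cancel _ he, mul_one]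

theorem eq_powerSumSeries {e P : PowerSeries K} (he : PowerSeries.constantCoeff e ≠ 0)
    (h : P * e = -(PowerSeries.X * PowerSeries.derivative K e)) : P = powerSumSeries e := by
  rw [powerSumSeries, ← neg_mul, ← h, mul_assoc, PowerSeries.mul_inv_cancel _ he, mul_one]

theorem powerSumSeries_one : powerSumSeries (1 : PowerSeries K) = 0 := by
  simp [powerSumSeries]

theorem powerSumSeries_mul {e e' : PowerSeries K} (he : PowerSeries.constantCoeff e ≠ 0)
    (he' : PowerSeries.constantCoeff e' ≠ 0) :
    powerSumSeries (e * e') = powerSumSeries e + powerSumSeries e' := by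
  symm
  refine eq_powerSumSeries (by simp [he, he']) ?_
  have h1 := powerSumSeries_mul_self he
  have h2 := powerSumSeries_mul_self he'
  rw [Derivation.leibniz, smul_eq_mul, smul_eq_mul]
  linear_combination e' * h1 + e * h2

theorem powerSumSeries_linear (a : K) (j : ℕ) :
    PowerSeries.coeff (j + 1) (powerSumSeries (1 - PowerSeries.C a * PowerSeries.X)) =
      a ^ (j + 1) := by
  have h : PowerSeries.mk (fun j => if j = 0 then 0 else a ^ j) =
      powerSumSeries (1 - PowerSeries.C a * PowerSeries.X) := by
    refine eq_powerSumSeries (by simp) ?_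
    ext n
    rw [mul_sub, mul_one, mul_left_comm]
    rcases n with _ | n
    · simp
    · simp only [map_sub]
      rcases n with _ | n
      · simp [PowerSeries.coeff_C_mul]
      · simp [PowerSeries.coeff_succ_X_mul, PowerSeries.coeff_C_mul,
          PowerSeries.coeff_X, pow_succ, mul_comm]
  rw [← h]; simp

theorem coeff_powerSumSeries_prod (s : Multiset K) (j : ℕ) :
    PowerSeries.coeff (j + 1)
      (powerSumSeries (s.map fun a => 1 - PowerSeries.C a * PowerSeries.X).prod) =
      (s.map fun a => a ^ (j + 1)).sum := by
  induction s using Multiset.induction with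
  | empty => simp [powerSumSeries_one]
  | cons a s ih =>
    rw [Multiset.map_cons, Multiset.prod_cons, powerSumSeries_mul (by simp), map_add, ih,
      powerSumSeries_linear, Multiset.map_cons, Multiset.sum_cons]
    rw [map_multiset_prod, Multiset.map_map]
    refine Multiset.prod_ne_zero ?_
    simp [Multiset.mem_replicate]

theorem map_powerSumSeries (φ : K →+* L) {e : PowerSeries K}
    (he : PowerSeries.constantCoeff e ≠ 0) :
    PowerSeries.map φ (powerSumSeries e) = powerSumSeries (PowerSeries.map φ e) := by
  refine eq_powerSumSeries (by
    rw [← PowerSeries.coeff_zero_eq_constantCoeff_apply, PowerSeries.coeff_map]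
    simpa using he) ?_
  rw [← map_mul, powerSumSeries_mul_self he, map_neg, map_mul, PowerSeries.map_X]
  congr 2
  ext n
  simp [PowerSeries.coeff_derivative]

theorem coeff_powerSumSeries_sub {e e' : PowerSeries K} {k : ℕ}
    (he : PowerSeries.constantCoeff e = 1) (he' : PowerSeries.constantCoeff e' = 1)
    (h : ∀ i < k, PowerSeries.coeff i e = PowerSeries.coeff i e') :
    (∀ i < k, PowerSeries.coeff i (powerSumSeries e) = PowerSeries.coeff i (powerSumSeries e')) ∧
    PowerSeries.coeff k (powerSumSeries e) = PowerSeries.coeff k (powerSumSeries e') -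
      k * (PowerSeries.coeff k e - PowerSeries.coeff k e') := by
  have key : ∀ d : PowerSeries K, PowerSeries.constantCoeff d = 1 → ∀ n,
      PowerSeries.coeff n (powerSumSeries d) = -(n * PowerSeries.coeff n d) -
        ∑ i ∈ range n, PowerSeries.coeff i (powerSumSeries d) * PowerSeries.coeff (n - i) d := by
    intro d hd n
    have h1 := congrArg (PowerSeries.coeff n) (powerSumSeries_mul_self (e := d) (by simp [hd]))
    rw [PowerSeries.coeff_mul, Nat.sum_antidiagonal_eq_sum_range_succ_mk, sum_range_succ] at h1
    simp only [Nat.sub_self, PowerSeries.coeff_zero_eq_constantCoeff, hd, mul_one] at h1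
    have h2 : PowerSeries.coeff n (-(PowerSeries.X * PowerSeries.derivative K d)) =
        -(n * PowerSeries.coeff n d) := by
      rcases n with _ | n
      · simp
      · rw [map_neg, PowerSeries.coeff_succ_X_mul, PowerSeries.coeff_derivative]; push_cast; ring
    rw [h2] at h1
    exact eq_sub_of_add_eq' h1
  have h0 : PowerSeries.coeff 0 (powerSumSeries e) = 0 := by rw [key e he]; simp
  have h0' : PowerSeries.coeff 0 (powerSumSeries e') = 0 := by rw [key e' he']; simp
  have h1 : ∀ i < k, PowerSeries.coeff i (powerSumSeries e) =
      PowerSeries.coeff i (powerSumSeries e') := by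
    intro i
    induction i using Nat.strong_induction_on with
    | _ i ih =>
      intro hi
      rw [key e he, key e' he', h i hi]
      congr 1
      refine sum_congr rfl fun m hm => ?_
      rw [mem_range] at hm
      rw [ih m hm (by omega), h (i - m) (by omega)]
  refine ⟨h1, ?_⟩
  rw [key e he, key e' he']
  have : ∑ i ∈ range k, PowerSeries.coeff i (powerSumSeries e) * PowerSeries.coeff (k - i) e =
      ∑ i ∈ range k, PowerSeries.coeff i (powerSumSeries e') * PowerSeries.coeff (k - i) e' := by
    refine sum_congr rfl fun m hm => ?_
    rw [mem_range] at hm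
    rcases Nat.eq_zero_or_pos m with rfl | hm0
    · rw [h0, h0', zero_mul, zero_mul]
    · rw [h1 m hm, h (k - m) (by omega)]
  rw [this]; ring

/-- The `j`-th power sum of the roots of a monic polynomial, in terms of its coefficients. -/
noncomputable def rootPowerSum (g : K[X]) (j : ℕ) : K :=
  PowerSeries.coeff j (powerSumSeries (g.reverse : PowerSeries K))

theorem constantCoeff_reverse {g : K[X]} (hg : g.Monic) :
    PowerSeries.constantCoeff (g.reverse : PowerSeries K) = 1 := by
  simp [hg.leadingCoeff]

theorem rootPowerSum_mul {g g' : K[X]} (hg : g.Monic) (hg' : g'.Monic) (j : ℕ) :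
    rootPowerSum (g * g') j = rootPowerSum g j + rootPowerSum g' j := by
  rw [rootPowerSum, reverse_mul_of_domain, Polynomial.coe_mul, powerSumSeries_mul, map_add]
  · rfl
  · simp [hg.leadingCoeff]
  · simp [hg'.leadingCoeff]

theorem rootPowerSum_map (φ : K →+* L) {g : K[X]} (hg : g.Monic) (j : ℕ) :
    φ (rootPowerSum g j) = rootPowerSum (g.map φ) j := by
  have h : (g.map φ).reverse = g.reverse.map φ := by
    rw [Polynomial.reverse, Polynomial.reverse, natDegree_map, reflect_map]
  rw [rootPowerSum, rootPowerSum, h, polynomial_map_coe, ← map_powerSumSeries, PowerSeries.coeff_map]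
  simp [hg.leadingCoeff]

theorem rootPowerSum_of_splits {g : K[X]} (hg : g.Monic) (hs : g.Splits) (j : ℕ) :
    rootPowerSum g (j + 1) = (g.roots.map fun a => a ^ (j + 1)).sum := by
  have h : ∀ s : Multiset K, (((s.map fun a => X - C a).prod.reverse : K[X]) : PowerSeries K) =
      (s.map fun a => 1 - PowerSeries.C a * PowerSeries.X).prod := by
    intro s
    induction s using Multiset.induction with
    | empty =>
      have : (1 : K[X]).reverse = 1 := by simpa using reverse_C (1 : K)
      simp [this]
    | cons a s ih =>
      rw [Multiset.map_cons, Multiset.prod_cons, reverse_mul_of_domain, Polynomial.coe_mul, ih,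
        Multiset.map_cons, Multiset.prod_cons]
      congr 1
      have : (X - C a : K[X]).reverse = 1 - C a * X := by
        ext n
        rw [coeff_reverse, natDegree_X_sub_C]
        rcases n with _ | _ | n
        · simp
        · simp [coeff_one, coeff_X]
        · rw [revAt_eq_self_of_lt (by omega)]
          simp [coeff_one, coeff_X]
      rw [this]; simp
  rw [rootPowerSum]
  conv_lhs => rw [hs.eq_prod_roots_of_monic hg]
  rw [h, coeff_powerSumSeries_prod]

end PowerSumSeries

section LFunction

variable {F : Type*} [Field F]

theorem finite_monic_natDegree_eq [Finite F] (n : ℕ) :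
    {g : F[X] | g.Monic ∧ g.natDegree = n}.Finite := by
  have : Finite (degreeLT F (n + 1)) := Module.finite_of_finite F
  refine (Set.toFinite (degreeLT F (n + 1) : Set F[X])).subset ?_
  rintro g ⟨_, hg⟩
  simp only [SetLike.mem_coe, mem_degreeLT]
  exact degree_le_natDegree.trans_lt (by rw [hg]; exact_mod_cast Nat.lt_succ_self n)

/-- The monic polynomials of degree `n` over a finite field. -/
noncomputable def monics (F : Type*) [Field F] [Finite F] (n : ℕ) : Finset F[X] :=
  (finite_monic_natDegree_eq (F := F) n).toFinset

@[simp] theorem mem_monics [Finite F] {n : ℕ} {g : F[X]} :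
    g ∈ monics F n ↔ g.Monic ∧ g.natDegree = n := by
  simp [monics]

/-- The sum of `f` over the roots of `g`, in terms of the coefficients of `g`
(for `f` without constant term). -/
noncomputable def rootSum (f g : F[X]) : F :=
  ∑ j ∈ range f.natDegree, f.coeff (j + 1) * rootPowerSum g (j + 1)

theorem rootSum_mul (f : F[X]) {g g' : F[X]} (hg : g.Monic) (hg' : g'.Monic) :
    rootSum f (g * g') = rootSum f g + rootSum f g' := by
  simp only [rootSum, rootPowerSum_mul hg hg', mul_add, sum_add_distrib]

theorem rootSum_one (f : F[X]) : rootSum f 1 = 0 := by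
  have := rootSum_mul f (g := 1) (g' := 1) monic_one monic_one
  rw [mul_one] at this
  simpa using this

theorem map_rootSum {L : Type*} [Field L] (φ : F →+* L) {f g : F[X]} (hf : f.coeff 0 = 0)
    (hg : g.Monic) (hs : (g.map φ).Splits) :
    φ (rootSum f g) = ((g.map φ).roots.map fun a => (f.map φ).eval a).sum := by
  have h : ∀ a, (f.map φ).eval a = ∑ j ∈ range f.natDegree, φ (f.coeff (j + 1)) * a ^ (j + 1) := by
    intro a
    rw [eval_map, eval₂_eq_sum_range, sum_range_succ', hf]; simp
  simp only [h, Multiset.sum_map_sum]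
  rw [rootSum, map_sum]
  refine sum_congr rfl fun j _ => ?_
  rw [map_mul, rootPowerSum_map φ hg, rootPowerSum_of_splits (hg.map φ) hs,
    Multiset.sum_map_mul_left]

theorem rootSum_add_monomial {f g : F[X]} {n k : ℕ} (hfk : f.natDegree = k) (hk : 1 ≤ k)
    (hkn : k ≤ n) (hg : g.Monic) (hgn : g.natDegree = n) (t : F) :
    (g + C t * X ^ (n - k)).Monic ∧ (g + C t * X ^ (n - k)).natDegree = n ∧
      rootSum f (g + C t * X ^ (n - k)) = rootSum f g - k * f.coeff k * t := by
  have hdeg : (C t * X ^ (n - k) : F[X]).degree < g.degree := by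
    refine (degree_C_mul_X_pow_le _ _).trans_lt ?_
    rw [degree_eq_natDegree hg.ne_zero, hgn]
    exact_mod_cast (by omega : n - k < n)
  have hm : (g + C t * X ^ (n - k)).Monic := hg.add_of_left hdeg
  have hd : (g + C t * X ^ (n - k)).natDegree = n := by
    rw [natDegree_add_eq_left_of_degree_lt hdeg, hgn]
  refine ⟨hm, hd, ?_⟩
  have hco : ∀ i ≤ n, PowerSeries.coeff i ((g + C t * X ^ (n - k)).reverse : PowerSeries F) =
      PowerSeries.coeff i (g.reverse : PowerSeries F) + if i = k then t else 0 := by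
    intro i hi
    rw [Polynomial.coeff_coe, Polynomial.coeff_coe, coeff_reverse, coeff_reverse, hd, hgn,
      revAt_le hi, coeff_add, coeff_C_mul_X_pow]
    congr 1
    exact if_congr (by omega) rfl rfl
  obtain ⟨h1, h2⟩ := coeff_powerSumSeries_sub (k := k) (constantCoeff_reverse hm)
    (constantCoeff_reverse hg) (fun i hi => by rw [hco i (by omega), if_neg hi.ne, add_zero])
  rw [hco k hkn, if_pos rfl] at h2
  obtain ⟨k, rfl⟩ := Nat.exists_eq_add_of_le' hk
  rw [rootSum, rootSum, hfk, sum_range_succ, sum_range_succ]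
  have h3 : ∀ j ∈ range k, f.coeff (j + 1) * rootPowerSum (g + C t * X ^ (n - (k + 1))) (j + 1) =
      f.coeff (j + 1) * rootPowerSum g (j + 1) := by
    intro j hj
    rw [mem_range] at hj
    rw [rootPowerSum, h1 (j + 1) (by omega), rootPowerSum]
  rw [sum_congr rfl h3]
  rw [rootPowerSum, h2, rootPowerSum]
  ring

/-- Coefficients of the `L`-function of an additive character of a polynomial. -/
noncomputable def lCoeff [Finite F] (ψ : AddChar F ℂ) (f : F[X]) (n : ℕ) : ℂ :=
  ∑ g ∈ monics F n, ψ (rootSum f g)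

theorem lCoeff_zero [Finite F] (ψ : AddChar F ℂ) (f : F[X]) : lCoeff ψ f 0 = 1 := by
  have : monics F 0 = {1} := by
    ext g
    simp only [mem_monics, mem_singleton]
    constructor
    · rintro ⟨h1, h2⟩; exact h1.natDegree_eq_zero.1 h2
    · rintro rfl; simp
  rw [lCoeff, this, sum_singleton, rootSum_one, AddChar.map_zero_eq_one]

theorem lCoeff_eq_zero [Finite F] {ψ : AddChar F ℂ} (hψ : ψ ≠ 1) {f : F[X]} {k n : ℕ}
    (hfk : f.natDegree = k) (hk : (k : F) ≠ 0) (hkn : k ≤ n) : lCoeff ψ f n = 0 := by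
  have hk1 : 1 ≤ k := Nat.one_le_iff_ne_zero.2 (by rintro rfl; simp at hk)
  obtain ⟨u, hu⟩ : ∃ u, ψ u ≠ 1 := by
    by_contra! h
    exact hψ (by ext u; simp [h u])
  have hfc : f.coeff k ≠ 0 := by
    rw [← hfk, coeff_natDegree, leadingCoeff_ne_zero]
    rintro rfl; simp at hfk; omega
  set t : F := -u / (k * f.coeff k)
  have ht : -(k * f.coeff k * t) = u := by simp only [t]; field_simp
  have h : lCoeff ψ f n = lCoeff ψ f n * ψ u := by
    conv_rhs => rw [lCoeff, sum_mul]
    rw [lCoeff]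
    symm
    refine sum_bij' (fun g _ => g + C t * X ^ (n - k)) (fun g _ => g + C (-t) * X ^ (n - k))
      ?_ ?_ ?_ ?_ ?_
    · intro g hg
      rw [mem_monics] at hg ⊢
      obtain ⟨h1, h2, _⟩ := rootSum_add_monomial hfk hk1 hkn hg.1 hg.2 t
      exact ⟨h1, h2⟩
    · intro g hg
      rw [mem_monics] at hg ⊢
      obtain ⟨h1, h2, _⟩ := rootSum_add_monomial hfk hk1 hkn hg.1 hg.2 (-t)
      exact ⟨h1, h2⟩
    · intro g _; rw [C_neg]; ring
    · intro g _; rw [C_neg]; ring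
    · intro g hg
      rw [mem_monics] at hg
      rw [(rootSum_add_monomial hfk hk1 hkn hg.1 hg.2 t).2.2, sub_eq_add_neg, ht,
        AddChar.map_add_eq_mul]
  by_contra h0
  exact hu (mul_left_cancel₀ h0 (by rw [← h, mul_one]))

end LFunction

section LFunction

open UniqueFactorizationMonoid

variable {F : Type*} [Field F]

theorem finite_monic_irreducible_natDegree_le [Finite F] (n : ℕ) :
    {g : F[X] | g.Monic ∧ Irreducible g ∧ g.natDegree ≤ n}.Finite := by
  refine ((range (n + 1)).finite_toSet.biUnion fun i _ =>
    finite_monic_natDegree_eq (F := F) i).subset ?_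
  rintro g ⟨h1, _, h3⟩
  simp only [Set.mem_iUnion]
  exact ⟨g.natDegree, by simp; omega, h1, rfl⟩

/-- The monic irreducible polynomials of degree at most `n` over a finite field. -/
noncomputable def monicIrreducibles (F : Type*) [Field F] [Finite F] (n : ℕ) : Finset F[X] :=
  (finite_monic_irreducible_natDegree_le (F := F) n).toFinset

@[simp] theorem mem_monicIrreducibles [Finite F] {n : ℕ} {g : F[X]} :
    g ∈ monicIrreducibles F n ↔ g.Monic ∧ Irreducible g ∧ g.natDegree ≤ n := by
  simp [monicIrreducibles]

open Classical in
theorem natDegree_eq_sum_monicIrreducibles [Finite F] {n : ℕ} {g : F[X]} (hg : g.Monic)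
    (hgn : g.natDegree = n) :
    n = ∑ P ∈ monicIrreducibles F n, P.natDegree * #{e ∈ Icc 1 n | P ^ e ∣ g} := by
  have hprod : (normalizedFactors g).prod = g := by
    have := prod_normalizedFactors_eq (a := g) hg.ne_zero
    rwa [hg.normalize_eq_self] at this
  have hmon : ∀ P ∈ normalizedFactors g, P.Monic := fun P hP => by
    have h1 := normalize_normalized_factor P hP
    rw [← h1]; exact monic_normalize (irreducible_of_normalized_factor P hP).ne_zero
  have hnat : n = ((normalizedFactors g).map natDegree).sum := by
    rw [← natDegree_multiset_prod_of_monic _ hmon, hprod, hgn]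
  have hsub : (normalizedFactors g).toFinset ⊆ monicIrreducibles F n := by
    intro P hP
    rw [Multiset.mem_toFinset] at hP
    rw [mem_monicIrreducibles]
    refine ⟨hmon P hP, irreducible_of_normalized_factor P hP, ?_⟩
    rw [← hgn]
    exact natDegree_le_of_dvd (dvd_of_mem_normalizedFactors hP) hg.ne_zero
  have h2 := hnat
  rw [Finset.sum_multiset_map_count] at h2
  conv_lhs => rw [h2]
  rw [sum_subset hsub]
  · refine sum_congr rfl fun P hP => ?_
    rw [mem_monicIrreducibles] at hP
    rw [smul_eq_mul, mul_comm]
    congr 1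
    have hpow : ∀ e, P ^ e ∣ g ↔ e ≤ (normalizedFactors g).count P := by
      intro e
      rw [pow_dvd_iff_le_emultiplicity, emultiplicity_eq_count_normalizedFactors hP.2.1 hg.ne_zero,
        hP.1.normalize_eq_self, Nat.cast_le]
    have hle : (normalizedFactors g).count P ≤ n := by
      have h3 : P ^ (normalizedFactors g).count P ∣ g := (hpow _).2 le_rfl
      have h4 := natDegree_le_of_dvd h3 hg.ne_zero
      rw [natDegree_pow, hgn] at h4
      exact (Nat.le_mul_of_pos_right _ hP.2.1.natDegree_pos).trans h4
    have : {e ∈ Icc 1 n | P ^ e ∣ g} = Icc 1 ((normalizedFactors g).count P) := by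
      ext e
      simp only [mem_filter, mem_Icc, hpow]
      omega
    rw [this, Nat.card_Icc, Nat.add_sub_cancel]
  · intro P _ hP
    rw [Multiset.mem_toFinset] at hP
    rw [Multiset.count_eq_zero_of_notMem hP, zero_smul]

open Classical in
theorem sum_monics_of_dvd [Finite F] (ψ : AddChar F ℂ) (f : F[X]) {Q : F[X]} (hQ : Q.Monic)
    (n : ℕ) : ∑ g ∈ monics F n with Q ∣ g, ψ (rootSum f g) =
      if Q.natDegree ≤ n then ψ (rootSum f Q) * lCoeff ψ f (n - Q.natDegree) else 0 := by
  split_ifs with h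
  · rw [lCoeff, mul_sum]
    symm
    refine sum_bij (fun g _ => Q * g) ?_ ?_ ?_ ?_
    · intro g hg
      rw [mem_monics] at hg
      simp only [mem_filter, mem_monics, dvd_mul_right, and_true]
      exact ⟨hQ.mul hg.1, by rw [hQ.natDegree_mul hg.1, hg.2]; omega⟩
    · intro g _ g' _ hgg
      exact mul_left_cancel₀ hQ.ne_zero hgg
    · intro g hg
      simp only [mem_filter, mem_monics] at hg
      obtain ⟨⟨h1, h2⟩, q, rfl⟩ := hg
      have hq : q.Monic := hQ.of_mul_monic_left h1
      refine ⟨q, ?_, rfl⟩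
      rw [mem_monics]
      rw [hQ.natDegree_mul hq] at h2
      exact ⟨hq, by omega⟩
    · intro g hg
      rw [mem_monics] at hg
      rw [rootSum_mul f hQ hg.1, AddChar.map_add_eq_mul]
  · rw [filter_false_of_mem, sum_empty]
    intro g hg hd
    rw [mem_monics] at hg
    exact h (hg.2 ▸ natDegree_le_of_dvd hd hg.1.ne_zero)

theorem rootSum_pow (f : F[X]) {g : F[X]} (hg : g.Monic) (e : ℕ) :
    rootSum f (g ^ e) = e • rootSum f g := by
  induction e with
  | zero => rw [pow_zero, rootSum_one, zero_smul]
  | succ e ih => rw [pow_succ, rootSum_mul f (hg.pow e) hg, ih, succ_nsmul]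

/-- Coefficients of the logarithmic derivative of the Euler product. -/
noncomputable def eulerSum [Finite F] (ψ : AddChar F ℂ) (f : F[X]) (n j : ℕ) : ℂ :=
  ∑ P ∈ monicIrreducibles F n, ∑ e ∈ Icc 1 n,
    if e * P.natDegree = j then P.natDegree * ψ (rootSum f P) ^ e else 0

theorem natCast_mul_lCoeff [Finite F] (ψ : AddChar F ℂ) (f : F[X]) (n : ℕ) :
    (n : ℂ) * lCoeff ψ f n = ∑ j ∈ Icc 1 n, eulerSum ψ f n j * lCoeff ψ f (n - j) := by
  classical
  have h1 : (n : ℂ) * lCoeff ψ f n = ∑ P ∈ monicIrreducibles F n, ∑ e ∈ Icc 1 n,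
      (P.natDegree : ℂ) * ∑ g ∈ monics F n with P ^ e ∣ g, ψ (rootSum f g) := by
    rw [lCoeff, mul_sum]
    have : ∀ g ∈ monics F n, (n : ℂ) * ψ (rootSum f g) = ∑ P ∈ monicIrreducibles F n,
        ∑ e ∈ Icc 1 n, (P.natDegree : ℂ) * if P ^ e ∣ g then ψ (rootSum f g) else 0 := by
      intro g hg
      rw [mem_monics] at hg
      conv_lhs => rw [natDegree_eq_sum_monicIrreducibles hg.1 hg.2]
      rw [Nat.cast_sum, sum_mul]
      refine sum_congr rfl fun P _ => ?_
      rw [← mul_sum, ← sum_filter, sum_const, nsmul_eq_mul]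
      push_cast; ring
    rw [sum_congr rfl this, sum_comm]
    refine sum_congr rfl fun P _ => ?_
    rw [sum_comm]
    refine sum_congr rfl fun e _ => ?_
    rw [← mul_sum, sum_filter]
  rw [h1]
  simp only [eulerSum, sum_mul]
  conv_rhs => rw [sum_comm]
  refine sum_congr rfl fun P hP => ?_
  conv_rhs => rw [sum_comm]
  refine sum_congr rfl fun e he => ?_
  rw [mem_monicIrreducibles] at hP
  rw [sum_monics_of_dvd ψ f (hP.1.pow e), natDegree_pow, rootSum_pow f hP.1,
    AddChar.map_nsmul_eq_pow]
  simp only [ite_mul, zero_mul, sum_ite_eq]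
  have : 1 ≤ e * P.natDegree := Nat.mul_pos (mem_Icc.1 he).1 hP.2.1.natDegree_pos
  by_cases h : e * P.natDegree ≤ n
  · rw [if_pos h, if_pos (mem_Icc.2 ⟨this, h⟩)]; ring
  · rw [if_neg h, if_neg (fun h' => h (mem_Icc.1 h').2), mul_zero]

end LFunction

section LFunction

variable {F : Type*} [Field F]

open IntermediateField in
theorem trace_aeval_eq [Finite F] {E : Type*} [Field E] [Finite E] [Algebra F E] {f : F[X]}
    (hf : f.coeff 0 = 0) (x : E) :
    (minpoly F x).natDegree ∣ Module.finrank F E ∧ Algebra.trace F E (aeval x f) =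
      (Module.finrank F E / (minpoly F x).natDegree) • rootSum f (minpoly F x) := by
  classical
  have := Module.Finite.of_finite (R := F) (M := E)
  have hx : IsIntegral F x := .of_finite F x
  have hfr : Module.finrank F F⟮x⟯ = (minpoly F x).natDegree := adjoin.finrank hx
  have hmul := Module.finrank_mul_finrank F F⟮x⟯ E
  have hdiv : Module.finrank F E / (minpoly F x).natDegree = Module.finrank F⟮x⟯ E := by
    rw [← hfr, ← hmul, Nat.mul_div_cancel_left _ Module.finrank_pos]
  refine ⟨hfr ▸ ⟨_, hmul.symm⟩, ?_⟩
  have h1 : aeval x f = algebraMap F⟮x⟯ E (aeval (AdjoinSimple.gen F x) f) := by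
    rw [← aeval_algebraMap_apply, AdjoinSimple.algebraMap_gen]
  rw [h1, ← Algebra.trace_trace (S := F⟮x⟯), Algebra.trace_algebraMap, map_nsmul, hdiv]
  congr 1
  apply (algebraMap F (AlgebraicClosure F)).injective
  have hsep : (minpoly F x).Separable := Algebra.IsSeparable.isSeparable F x
  have hnd : ((minpoly F x).map (algebraMap F (AlgebraicClosure F))).roots.Nodup :=
    nodup_roots hsep.map
  rw [trace_eq_sum_embeddings (AlgebraicClosure F),
    map_rootSum _ hf (minpoly.monic hx) (IsAlgClosed.splits _)]
  have h2 : ((((minpoly F x).map (algebraMap F (AlgebraicClosure F))).roots.map fun a =>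
      (f.map (algebraMap F (AlgebraicClosure F))).eval a).sum) =
      ∑ a ∈ ((minpoly F x).aroots (AlgebraicClosure F)).toFinset,
        (f.map (algebraMap F (AlgebraicClosure F))).eval a := by
    rw [Finset.sum_eq_multiset_sum, Multiset.toFinset_val, aroots,
      Multiset.dedup_eq_self.2 hnd]
  rw [h2]
  refine sum_bij (fun σ _ => (algHomAdjoinIntegralEquiv F hx σ : AlgebraicClosure F)) ?_ ?_ ?_ ?_
  · intro σ _
    rw [Multiset.mem_toFinset]
    exact (algHomAdjoinIntegralEquiv F hx σ).2
  · intro σ _ τ _ h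
    exact (algHomAdjoinIntegralEquiv F hx).injective (Subtype.ext h)
  · intro a ha
    rw [Multiset.mem_toFinset] at ha
    exact ⟨(algHomAdjoinIntegralEquiv F hx).symm ⟨a, ha⟩, mem_univ _, by simp⟩
  · intro σ _
    have h3 : (algHomAdjoinIntegralEquiv F hx σ : AlgebraicClosure F) =
        σ (AdjoinSimple.gen F x) := rfl
    rw [h3, eval_map_algebraMap, aeval_algHom_apply]

theorem card_minpoly_eq [Finite F] {E : Type*} [Field E] [Fintype E] [DecidableEq F[X]]
    [Algebra F E] {P : F[X]} (hP : Irreducible P) (hm : P.Monic)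
    (hd : P.natDegree ∣ Module.finrank F E) :
    #{x : E | minpoly F x = P} = P.natDegree := by
  classical
  have := Module.Finite.of_finite (R := F) (M := E)
  have : Fact (Irreducible P) := ⟨hP⟩
  have hfr : Module.finrank F (AdjoinRoot P) = P.natDegree := by
    rw [(AdjoinRoot.powerBasis hP.ne_zero).finrank, AdjoinRoot.powerBasis_dim]
  have h1 := FiniteField.natCard_algHom_of_finrank_dvd (F := F) (K := AdjoinRoot P) (L := E)
    (hfr ▸ hd)
  rw [hfr] at h1
  rw [← h1, Nat.card_congr (AdjoinRoot.equiv E F P hP.ne_zero)]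
  rw [← Fintype.card_subtype, ← Nat.card_eq_fintype_card]
  refine Nat.card_congr (Equiv.subtypeEquivRight fun x => ?_)
  rw [mem_aroots]
  constructor
  · rintro rfl; exact ⟨hP.ne_zero, minpoly.aeval F x⟩
  · rintro ⟨_, h⟩; exact (minpoly.eq_of_irreducible_of_monic hP h hm).symm

theorem sum_trace_eq_eulerSum [Finite F] {E : Type*} [Field E] [Fintype E] [Algebra F E]
    (ψ : AddChar F ℂ) {f : F[X]} (hf : f.coeff 0 = 0) {n j : ℕ} (hj : Module.finrank F E = j)
    (hjn : j ≤ n) :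
    ∑ x : E, ψ (Algebra.trace F E (aeval x f)) = eulerSum ψ f n j := by
  classical
  have := Module.Finite.of_finite (R := F) (M := E)
  have hj0 : 0 < j := hj ▸ Module.finrank_pos
  have hmaps : ∀ x ∈ (univ : Finset E), minpoly F x ∈ monicIrreducibles F n := by
    intro x _
    have hx : IsIntegral F x := .of_finite F x
    rw [mem_monicIrreducibles]
    refine ⟨minpoly.monic hx, minpoly.irreducible hx, ?_⟩
    have h1 := (trace_aeval_eq hf x).1
    rw [hj] at h1
    exact (Nat.le_of_dvd hj0 h1).trans hjn
  rw [← sum_fiberwise_of_maps_to hmaps, eulerSum]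
  refine sum_congr rfl fun P hP => ?_
  rw [mem_monicIrreducibles] at hP
  have h1 : ∀ x ∈ ({x : E | minpoly F x = P} : Finset E),
      ψ (Algebra.trace F E (aeval x f)) = ψ (rootSum f P) ^ (j / P.natDegree) := by
    intro x hx
    rw [mem_filter] at hx
    rw [(trace_aeval_eq hf x).2, hx.2, hj, AddChar.map_nsmul_eq_pow]
  rw [sum_congr rfl h1, sum_const, nsmul_eq_mul]
  have hpos := hP.2.1.natDegree_pos
  by_cases hd : P.natDegree ∣ j
  · rw [card_minpoly_eq hP.2.1 hP.1 (hj ▸ hd)]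
    rw [sum_eq_single_of_mem (j / P.natDegree), if_pos (Nat.div_mul_cancel hd)]
    · exact mem_Icc.2 ⟨Nat.div_pos (Nat.le_of_dvd hj0 hd) hpos, (Nat.div_le_self _ _).trans hjn⟩
    · intro e _ he
      rw [if_neg]
      rintro rfl
      exact he (Nat.mul_div_cancel _ hpos).symm
  · have h2 : ({x : E | minpoly F x = P} : Finset E) = ∅ := by
      refine filter_false_of_mem fun x _ h => hd ?_
      have := (trace_aeval_eq hf x).1
      rwa [h, hj] at this
    rw [h2, card_empty, Nat.cast_zero, zero_mul, sum_eq_zero]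
    intro e _
    rw [if_neg]
    rintro rfl
    exact hd (dvd_mul_left _ _)

end LFunction

theorem norm_le_one_of_powerSums_bounded {ι : Type*} [Fintype ι] {z : ι → ℂ} {C : ℝ}
    (h : ∀ n : ℕ, ‖∑ i, z i ^ n‖ ≤ C) (i : ι) : ‖z i‖ ≤ 1 := by
  have : Nonempty ι := ⟨i⟩
  obtain ⟨m, -, hm⟩ := exists_max_image univ (fun i => ‖z i‖) ⟨i, mem_univ i⟩
  refine (hm i (mem_univ i)).trans ?_
  by_contra! hρ
  have hz0 : z m ≠ 0 := fun h => by rw [h, norm_zero] at hρ; linarith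
  have hC : 0 ≤ C := (norm_nonneg _).trans (h 0)
  have hρ0 : 0 < ‖z m‖ := by linarith
  have hρ1 : ‖z m‖⁻¹ < 1 := inv_lt_one_of_one_lt₀ hρ
  set B : ℝ := C * (1 - ‖z m‖⁻¹)⁻¹ with hB
  have hB0 : 0 ≤ B := mul_nonneg hC (inv_nonneg.2 (by linarith))
  have key : ∀ t : ℝ, 0 ≤ t → t < 1 → (1 - t)⁻¹ ≤ B := by
    intro t ht0 ht1
    have hle : ∀ i, ‖(t : ℂ) * (z i / z m)‖ ≤ t := by
      intro i
      rw [norm_mul, norm_div, Complex.norm_real, Real.norm_of_nonneg ht0]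
      exact mul_le_of_le_one_right ht0 ((div_le_one hρ0).2 (hm i (mem_univ i)))
    have hlt : ∀ i, ‖(t : ℂ) * (z i / z m)‖ < 1 := fun i => (hle i).trans_lt ht1
    have hs : HasSum (fun n : ℕ => ∑ i, ((t : ℂ) * (z i / z m)) ^ n)
        (∑ i, (1 - (t : ℂ) * (z i / z m))⁻¹) :=
      hasSum_sum fun i _ => hasSum_geometric_of_norm_lt_one (hlt i)
    have hb : ∀ n : ℕ, ‖∑ i, ((t : ℂ) * (z i / z m)) ^ n‖ ≤ C * ‖z m‖⁻¹ ^ n := by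
      intro n
      have : ∑ i, ((t : ℂ) * (z i / z m)) ^ n = (t / z m) ^ n * ∑ i, z i ^ n := by
        rw [mul_sum]
        refine sum_congr rfl fun i _ => ?_
        rw [← mul_pow]; congr 1; ring
      rw [this, norm_mul, mul_comm, norm_pow, norm_div, Complex.norm_real,
        Real.norm_of_nonneg ht0]
      have h2 : t / ‖z m‖ ≤ ‖z m‖⁻¹ := by
        rw [div_eq_mul_inv]; exact mul_le_of_le_one_left (by positivity) ht1.le
      gcongr
      exact h n
    have hsum : HasSum (fun n : ℕ => C * ‖z m‖⁻¹ ^ n) B :=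
      (hasSum_geometric_of_lt_one (by positivity) hρ1).mul_left C
    have h1 : ‖∑ i, (1 - (t : ℂ) * (z i / z m))⁻¹‖ ≤ B := hs.norm_le_of_bounded hsum hb
    have hre : ∀ i, 0 ≤ ((1 - (t : ℂ) * (z i / z m))⁻¹).re := by
      intro i
      rw [Complex.inv_re]
      refine div_nonneg ?_ (Complex.normSq_nonneg _)
      rw [Complex.sub_re, Complex.one_re]
      linarith [(Complex.re_le_norm ((t : ℂ) * (z i / z m))).trans (hle i)]
    calc (1 - t)⁻¹ = ((1 - (t : ℂ) * (z m / z m))⁻¹).re := by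
          rw [div_self hz0, mul_one, ← Complex.ofReal_one, ← Complex.ofReal_sub,
            ← Complex.ofReal_inv, Complex.ofReal_re]
      _ ≤ ∑ i, ((1 - (t : ℂ) * (z i / z m))⁻¹).re :=
          single_le_sum (f := fun i => ((1 - (t : ℂ) * (z i / z m))⁻¹).re)
            (fun i _ => hre i) (mem_univ m)
      _ = (∑ i, (1 - (t : ℂ) * (z i / z m))⁻¹).re := by rw [Complex.re_sum]
      _ ≤ _ := (Complex.re_le_norm _).trans h1
  have h2 := key (1 - (B + 2)⁻¹) (by
    rw [sub_nonneg]; exact inv_le_one_of_one_le₀ (by linarith)) (by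
    have : 0 < (B + 2)⁻¹ := by positivity
    linarith)
  rw [sub_sub_cancel, inv_inv] at h2
  linarith

theorem exists_roots_of_log_deriv {c S : ℕ → ℂ} {k : ℕ} (hk : 1 ≤ k) (hc0 : c 0 = 1)
    (hck : ∀ n, k ≤ n → c n = 0)
    (h : ∀ n : ℕ, (n : ℂ) * c n = ∑ j ∈ Icc 1 n, S j * c (n - j)) :
    ∃ s : Multiset ℂ, s.card ≤ k - 1 ∧
      ∀ j, 1 ≤ j → S j = -(s.map fun a => a ^ j).sum := by
  obtain ⟨m, rfl⟩ := Nat.exists_eq_add_of_le' hk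
  rw [Nat.add_sub_cancel]
  set D : ℂ[X] := ∑ d ∈ range (m + 1), C (c d) * X ^ d with hD
  have hDc : ∀ n, D.coeff n = c n := by
    intro n
    rw [hD, finsetSum_coeff]
    simp only [coeff_C_mul_X_pow, sum_ite_eq, mem_range]
    split_ifs with hn
    · rfl
    · rw [hck n (by omega)]
  have hDdeg : D.natDegree ≤ m := natDegree_le_iff_coeff_eq_zero.2 fun n hn => by
    rw [hDc, hck n (by omega)]
  set g : ℂ[X] := reflect m D with hg
  have hgdeg' : g.natDegree ≤ m := (natDegree_reflect_le).trans (by simp [hDdeg])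
  have hgm : g.coeff m = 1 := by
    rw [hg, coeff_reflect, revAt_le le_rfl, Nat.sub_self, hDc, hc0]
  have hgdeg : g.natDegree = m :=
    le_antisymm hgdeg' (le_natDegree_of_ne_zero (by rw [hgm]; exact one_ne_zero))
  have hmon : g.Monic := by rw [Monic, leadingCoeff, hgdeg, hgm]
  have hrev : g.reverse = D := by
    rw [Polynomial.reverse, hgdeg, hg]
    ext n
    rw [coeff_reflect, coeff_reflect, revAt_invol]
  refine ⟨g.roots, (card_roots' g).trans hgdeg.le, ?_⟩
  intro j hj
  obtain ⟨j, rfl⟩ := Nat.exists_eq_add_of_le' hj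
  rw [← rootPowerSum_of_splits hmon (IsAlgClosed.splits g), rootPowerSum, hrev]
  have hcc : PowerSeries.constantCoeff (D : PowerSeries ℂ) ≠ 0 := by
    rw [← PowerSeries.coeff_zero_eq_constantCoeff_apply, Polynomial.coeff_coe, hDc, hc0]
    exact one_ne_zero
  have hP : PowerSeries.mk (fun n => if n = 0 then 0 else -S n) =
      powerSumSeries (D : PowerSeries ℂ) := by
    refine eq_powerSumSeries hcc ?_
    ext n
    have h1 : PowerSeries.coeff n (-(PowerSeries.X * PowerSeries.derivative ℂ (D : PowerSeries ℂ)))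
        = -(n * c n) := by
      rcases n with _ | n
      · simp
      · rw [map_neg, PowerSeries.coeff_succ_X_mul, PowerSeries.coeff_derivative,
          Polynomial.coeff_coe, hDc]
        push_cast; ring
    rw [h1, h, PowerSeries.coeff_mul, Nat.sum_antidiagonal_eq_sum_range_succ_mk,
      ← sum_neg_distrib]
    have h2 : range n.succ = insert 0 (Icc 1 n) := by ext i; simp; omega
    rw [h2, sum_insert (by simp)]
    simp only [PowerSeries.coeff_mk, if_true, zero_mul, zero_add, Polynomial.coeff_coe, hDc]
    refine sum_congr rfl fun i hi => ?_
    rw [if_neg (by have := mem_Icc.1 hi; omega), neg_mul]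
  rw [← hP]; simp

theorem weil_of_coeff_zero {p k : ℕ} [Fact p.Prime] {f : (ZMod p)[X]} (hf : f.natDegree = k)
    (hf0 : f.coeff 0 = 0) (hk : 1 ≤ k) (hkp : k < p) {ψ : AddChar (ZMod p) ℂ} (hψ : ψ ≠ 1) :
    ‖∑ x : ZMod p, ψ (f.eval x)‖ ≤ k * √p := by
  classical
  have hp := Fact.out (p := p.Prime)
  have hk0 : (k : ZMod p) ≠ 0 := by
    rw [Ne, ZMod.natCast_eq_zero_iff]
    exact Nat.not_dvd_of_pos_of_lt hk hkp
  let _ : ∀ j, Fintype (GaloisField p j) := fun j => Fintype.ofFinite _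
  set S : ℕ → ℂ := fun j =>
    ∑ x : GaloisField p j, ψ (Algebra.trace (ZMod p) (GaloisField p j) (aeval x f)) with hS
  have hSe : ∀ n j, 1 ≤ j → j ≤ n → eulerSum ψ f n j = S j := fun n j hj hjn =>
    (sum_trace_eq_eulerSum ψ hf0 (GaloisField.finrank p (by omega)) hjn).symm
  obtain ⟨s, hscard, hs⟩ := exists_roots_of_log_deriv (c := lCoeff ψ f) (S := S) hk
    (lCoeff_zero ψ f) (fun n hn => lCoeff_eq_zero hψ hf hk0 hn) (fun n => by
      rw [natCast_mul_lCoeff]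
      refine sum_congr rfl fun j hj => ?_
      rw [mem_Icc] at hj
      rw [hSe n j hj.1 hj.2])
  have hp0 : (0 : ℝ) < p := by exact_mod_cast hp.pos
  have hbound : ∀ n : ℕ, (k + 2) ^ 2 ≤ n →
      ‖S (2 * (n + 1))‖ ≤ (p * (2 * k + 1) + 1) * (p : ℝ) ^ (n + 1) := by
    intro n hn
    have h1 := norm_sum_addChar_trace_le (E := GaloisField p (2 * (n + 1))) (n := n) f hf hk hkp
      (by rw [← Nat.card_eq_fintype_card, GaloisField.card p _ (by omega), ← pow_mul, mul_comm])
      (hn.trans (Nat.lt_pow_self hp.one_lt).le) ψ hψ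
    refine h1.trans (le_of_eq ?_)
    ring
  have hsq : ∀ a ∈ s, ‖a‖ ≤ √p := by
    set z : s.ToType → ℂ := fun i => (i : ℂ) ^ 2 / p
    have hz : ∀ n : ℕ, 1 ≤ n → ∑ i, z i ^ n = -S (2 * n) / p ^ n := by
      intro n hn
      rw [hs _ (by omega), neg_neg, ← Multiset.map_univ, ← Finset.sum_eq_multiset_sum, sum_div]
      refine sum_congr rfl fun i _ => ?_
      simp only [z]
      rw [div_pow, ← pow_mul]
    set C0 : ℝ := p * (2 * k + 1) + 1
    have hC0 : 0 ≤ C0 := by positivity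
    have hbd : ∀ n : ℕ, ‖∑ i, z i ^ n‖ ≤
        C0 + ∑ m ∈ range ((k + 2) ^ 2 + 1), ‖∑ i, z i ^ m‖ := by
      intro n
      by_cases hn : n < (k + 2) ^ 2 + 1
      · have : ‖∑ i, z i ^ n‖ ≤ _ := single_le_sum (f := fun m => ‖∑ i, z i ^ m‖)
          (fun i _ => norm_nonneg _) (mem_range.2 hn)
        linarith
      · have h1 : 0 ≤ ∑ m ∈ range ((k + 2) ^ 2 + 1), ‖∑ i, z i ^ m‖ :=
          sum_nonneg fun _ _ => norm_nonneg _
        have h2 : ‖∑ i, z i ^ n‖ ≤ C0 := by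
          obtain ⟨n, rfl⟩ := Nat.exists_eq_add_of_le' (show 1 ≤ n by omega)
          rw [hz _ (by omega), norm_div, norm_neg, norm_pow, Complex.norm_natCast,
            div_le_iff₀ (by positivity)]
          exact hbound n (by omega)
        linarith
    intro a ha
    have h3 : ∀ i : s.ToType, ‖(i : ℂ)‖ ≤ √p := by
      intro i
      have h4 := norm_le_one_of_powerSums_bounded hbd i
      simp only [z] at h4
      rw [norm_div, norm_pow, Complex.norm_natCast, div_le_one hp0] at h4
      exact Real.le_sqrt_of_sq_le h4
    exact h3 ⟨a, ⟨0, Multiset.count_pos.2 ha⟩⟩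
  have h1 : ∑ x : ZMod p, ψ (f.eval x) = S 1 := by
    rw [← hSe 1 1 le_rfl le_rfl, ← sum_trace_eq_eulerSum (E := ZMod p) ψ hf0
      (Module.finrank_self _) le_rfl]
    simp
  rw [h1, hs 1 le_rfl, norm_neg]
  have h2 : ‖(s.map fun a => a ^ 1).sum‖ ≤ (s.map fun a => ‖a‖).sum := by
    simpa using norm_multiset_sum_le s
  refine h2.trans ((Multiset.sum_le_card_nsmul _ (√p) ?_).trans ?_)
  · intro x hx
    obtain ⟨a, ha, rfl⟩ := Multiset.mem_map.1 hx
    exact hsq a ha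
  · rw [Multiset.card_map, nsmul_eq_mul]
    gcongr
    omega

/-- Weil's bound for additive character sums of polynomials over prime fields. -/
theorem weil {p k : ℕ} [Fact p.Prime] {f : (ZMod p)[X]} (hf : f.natDegree = k)
    (hk : 1 ≤ k) (hkp : k < p) {ψ : AddChar (ZMod p) ℂ} (hψ : ψ ≠ 1) :
    ‖∑ x : ZMod p, ψ (f.eval x)‖ ≤ k * √p := by
  have h1 := weil_of_coeff_zero (f := f - C (f.coeff 0)) (k := k) (by rw [natDegree_sub_C, hf])
    (by simp) hk hkp hψ
  have h2 : ∑ x : ZMod p, ψ (f.eval x) =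
      ψ (f.coeff 0) * ∑ x : ZMod p, ψ ((f - C (f.coeff 0)).eval x) := by
    rw [mul_sum]
    refine sum_congr rfl fun x _ => ?_
    rw [← AddChar.map_add_eq_mul, eval_sub, eval_C, add_sub_cancel]
  rw [h2, norm_mul, AddChar.norm_apply, one_mul]
  exact h1

theorem sum_range_affine_of_periodic {E : Type*} [AddCommMonoid E] {F : ℕ → E} {m n : ℕ}
    (hF : Function.Periodic F n) (hn : 0 < n) (hmn : Nat.Coprime m n) (s : ℕ) :
    ∑ y ∈ range n, F (m * y + s) = ∑ y ∈ range n, F y := by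
  have hinj : Set.InjOn (fun y => (m * y + s) % n) (range n : Set ℕ) := by
    intro y hy y' hy' h
    simp only [coe_range, Set.mem_Iio] at hy hy'
    have h1 : m * y + s ≡ m * y' + s [MOD n] := h
    have h2 := Nat.ModEq.cancel_left_of_coprime hmn.symm (Nat.ModEq.add_right_cancel' s h1)
    rwa [Nat.ModEq, Nat.mod_eq_of_lt hy, Nat.mod_eq_of_lt hy'] at h2
  have himg : (range n).image (fun y => (m * y + s) % n) = range n := by
    refine eq_of_subset_of_card_le ?_ ?_
    · intro y hy
      obtain ⟨z, _, rfl⟩ := mem_image.1 hy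
      exact mem_range.2 (Nat.mod_lt _ hn)
    · rw [card_image_of_injOn hinj]
  conv_rhs => rw [← himg, sum_image hinj]
  exact sum_congr rfl fun y _ => (hF.map_mod_nat _).symm

theorem sum_range_mul_coprime {F G : ℕ → ℂ} {m n : ℕ} (hF : Function.Periodic F m)
    (hG : Function.Periodic G n) (hn : 0 < n) (hmn : Nat.Coprime m n) :
    ∑ x ∈ range (m * n), F x * G x = (∑ x ∈ range m, F x) * ∑ x ∈ range n, G x := by
  rw [sum_range_mul_eq, sum_mul]
  refine sum_congr rfl fun s _ => ?_
  rw [← sum_range_affine_of_periodic hG hn hmn s, mul_sum]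
  refine sum_congr rfl fun y _ => ?_
  congr 1
  rw [mul_comm m y, add_comm]
  exact hF.nat_mul y s

theorem completeSum_mul {q₁ q₂ : ℕ} (hq₁ : 0 < q₁) (hq₂ : 0 < q₂) (h : Nat.Coprime q₁ q₂) {a : ℤ}
    (ha : IsCoprime a ((q₁ * q₂ : ℕ) : ℤ)) (H : ℤ[X]) :
    ∃ a₁ a₂ : ℤ, IsCoprime a₁ (q₁ : ℤ) ∧ IsCoprime a₂ (q₂ : ℤ) ∧
      completeSum H a (q₁ * q₂) = completeSum H a₁ q₁ * completeSum H a₂ q₂ := by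
  obtain ⟨u, v, huv⟩ := Nat.isCoprime_iff_coprime.2 h
  push_cast at ha
  have ha1 : IsCoprime a (q₁ : ℤ) := ha.of_mul_right_left
  have ha2 : IsCoprime a (q₂ : ℤ) := ha.of_mul_right_right
  have hv : IsCoprime v (q₁ : ℤ) := ⟨q₂, u, by linear_combination huv⟩
  have hu : IsCoprime u (q₂ : ℤ) := ⟨q₁, v, by linear_combination huv⟩
  refine ⟨a * v, a * u, ha1.mul_left hv, ha2.mul_left hu, ?_⟩
  have h1 : (q₁ : ℝ) ≠ 0 := by positivity
  have h2 : (q₂ : ℝ) ≠ 0 := by positivity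
  rw [completeSum, completeSum, completeSum, div_mul_div_comm,
    ← sum_range_mul_coprime (periodic_ex_eval _ _) (periodic_ex_eval _ _) hq₂ h, ← Nat.cast_mul]
  congr 1
  refine sum_congr rfl fun x _ => ?_
  rw [← ex_add]
  congr 1
  have huv' : (u : ℝ) * q₁ + v * q₂ = 1 := by exact_mod_cast huv
  simp only [eval_mul, eval_C]
  push_cast
  field_simp
  linear_combination (-(a : ℝ) * ((H.eval (x : ℤ) : ℤ) : ℝ)) * huv'

theorem ex_div_eq_one_iff {q : ℕ} (hq : q ≠ 0) {b : ℤ} : ex (b / q) = 1 ↔ (q : ℤ) ∣ b := by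
  have hq0 : (q : ℝ) ≠ 0 := by exact_mod_cast hq
  constructor
  · intro h
    have h1 := le_norm_ex_sub_one ((b : ℝ) / q)
    rw [h, sub_self, norm_zero] at h1
    have h2 : |(b : ℝ) / q - round ((b : ℝ) / q)| = 0 := le_antisymm (by linarith) (abs_nonneg _)
    rw [abs_eq_zero, sub_eq_zero, div_eq_iff hq0] at h2
    exact ⟨round ((b : ℝ) / q), by rw [mul_comm]; exact_mod_cast h2⟩
  · intro h
    rw [ex_div_eq_of_dvd hq (b := 0) (by simpa using h)]
    simp [ex_zero]

theorem sum_ex_mul_div_eq_zero {q : ℕ} (hq : q ≠ 0) {b : ℤ} (h : ¬ (q : ℤ) ∣ b) :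
    ∑ y ∈ range q, ex (((b * y : ℤ) : ℝ) / q) = 0 := by
  have hq0 : (q : ℝ) ≠ 0 := by exact_mod_cast hq
  have h1 : ∀ y : ℕ, ex (((b * y : ℤ) : ℝ) / q) = ex (b / q) ^ y := by
    intro y
    rw [← ex_nat_mul]; congr 1; push_cast; ring
  simp only [h1]
  have h2 := mul_neg_geom_sum (ex (b / q)) q
  have h3 : ex (b / q) ^ q = 1 := by
    rw [← ex_nat_mul, mul_div_cancel₀ _ hq0, ex_intCast]
  rw [h3, sub_self, mul_eq_zero] at h2
  refine h2.resolve_left ?_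
  rw [sub_eq_zero, eq_comm, ex_div_eq_one_iff hq]
  exact h

theorem sum_range_eq_sum_zmod {p : ℕ} [NeZero p] {E : Type*} [AddCommMonoid E] (g : ZMod p → E) :
    ∑ x ∈ range p, g (x : ZMod p) = ∑ x : ZMod p, g x := by
  refine sum_nbij' (fun x => (x : ZMod p)) ZMod.val ?_ ?_ ?_ ?_ ?_
  · simp
  · intro x _; exact mem_range.2 x.val_lt
  · intro x hx; exact ZMod.val_cast_of_lt (mem_range.1 hx)
  · intro x _; exact ZMod.natCast_zmod_val x
  · simp

theorem norm_completeSum_prime_le {p k : ℕ} (hp : p.Prime) (hkp : k < p) {H : ℤ[X]} {a : ℤ}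
    (ha : IsCoprime a (p : ℤ)) (hH : H.natDegree ≤ k) (hc : ∃ j, 1 ≤ j ∧ ¬ (p : ℤ) ∣ H.coeff j) :
    ‖completeSum H a p‖ ≤ k / √p := by
  have : Fact p.Prime := ⟨hp⟩
  have hp0 : (0 : ℝ) < p := by exact_mod_cast hp.pos
  set f : (ZMod p)[X] := (C a * H).map (Int.castRingHom (ZMod p)) with hf
  have hψ : (ZMod.stdAddChar (N := p)) ≠ 1 := by
    intro h
    have := ZMod.isPrimitive_stdAddChar p (one_ne_zero)
    apply this
    rw [AddChar.mulShift_one, h]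
  have hval : ∀ x : ℕ, ex ((C a * H).eval (x : ℤ) / p) = ZMod.stdAddChar (f.eval (x : ZMod p)) := by
    intro x
    have h1 : f.eval (x : ZMod p) = (((C a * H).eval (x : ℤ) : ℤ) : ZMod p) := by
      rw [hf, eval_map, show ((x : ZMod p)) = Int.castRingHom (ZMod p) (x : ℤ) by simp,
        eval₂_hom]; rfl
    rw [h1, ZMod.stdAddChar_coe, ex]
    congr 1
    push_cast
    ring
  have hdeg : f.natDegree ≤ k := natDegree_map_le.trans ((natDegree_C_mul_le _ _).trans hH)
  have hdeg1 : 1 ≤ f.natDegree := by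
    obtain ⟨j, hj1, hj⟩ := hc
    refine hj1.trans (le_natDegree_of_ne_zero ?_)
    rw [hf, coeff_map, coeff_C_mul]
    simp only [eq_intCast]
    rw [Ne, ZMod.intCast_zmod_eq_zero_iff_dvd]
    exact fun h => hj (ha.symm.dvd_of_dvd_mul_left h)
  have h1 := weil (f := f) rfl hdeg1 (hdeg.trans_lt hkp) hψ
  rw [completeSum, norm_div, Complex.norm_natCast, sum_congr rfl (fun x _ => hval x),
    sum_range_eq_sum_zmod (fun x => ZMod.stdAddChar (f.eval x)), div_le_div_iff₀ hp0 (by positivity)]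
  calc _ ≤ (f.natDegree * √p) * √p := by gcongr
    _ = f.natDegree * p := by rw [mul_assoc, Real.mul_self_sqrt hp0.le]
    _ ≤ _ := by gcongr

theorem card_roots_mod_pow_le {p k : ℕ} (hp : p.Prime) {D : ℤ[X]} (hD : D.natDegree ≤ k)
    (hc : ∃ j, ¬ (p : ℤ) ∣ D.coeff j) (i : ℕ) :
    #{s ∈ range (p ^ (i + 1)) | (p : ℤ) ∣ D.eval ((s : ℕ) : ℤ)} ≤ p ^ i * k := by
  classical
  have : Fact p.Prime := ⟨hp⟩
  set f : (ZMod p)[X] := D.map (Int.castRingHom (ZMod p)) with hf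
  have hval : ∀ x : ℕ, (p : ℤ) ∣ D.eval (x : ℤ) ↔ f.eval (x : ZMod p) = 0 := by
    intro x
    have h1 : f.eval (x : ZMod p) = ((D.eval (x : ℤ) : ℤ) : ZMod p) := by
      rw [hf, eval_map, show ((x : ZMod p)) = Int.castRingHom (ZMod p) (x : ℤ) by simp,
        eval₂_hom]; rfl
    rw [h1, ZMod.intCast_zmod_eq_zero_iff_dvd]
  have hf0 : f ≠ 0 := by
    obtain ⟨j, hj⟩ := hc
    intro h
    apply hj
    rw [← ZMod.intCast_zmod_eq_zero_iff_dvd]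
    have := congrArg (fun g => g.coeff j) h
    simpa [hf, coeff_map] using this
  rw [card_filter]
  simp only [hval]
  have hper : Function.Periodic (fun s : ℕ => if f.eval (s : ZMod p) = 0 then 1 else 0) p := by
    intro s; simp
  rw [pow_succ', sum_range_mul_of_periodic _ p (p ^ i) hper,
    sum_range_eq_sum_zmod (fun s => if f.eval s = 0 then 1 else 0), smul_eq_mul]
  gcongr
  rw [← card_filter]
  have h2 : ({x : ZMod p | f.eval x = 0} : Finset (ZMod p)) ⊆ f.roots.toFinset := by
    intro x hx
    rw [mem_filter] at hx
    rw [Multiset.mem_toFinset, mem_roots hf0]; exact hx.2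
  exact (card_le_card h2).trans ((Multiset.toFinset_card_le _).trans
    ((card_roots' f).trans (natDegree_map_le.trans hD)))

theorem norm_completeSum_prime_pow_le {p k i : ℕ} (hp : p.Prime) (hkp : k < p) {H : ℤ[X]} {a : ℤ}
    (ha : IsCoprime a (p : ℤ)) (hH : H.natDegree ≤ k) (hc : ∃ j, 1 ≤ j ∧ ¬ (p : ℤ) ∣ H.coeff j) :
    ‖completeSum H a (p ^ (i + 2))‖ ≤ k / p := by
  classical
  have hp0 : (p : ℝ) ≠ 0 := by exact_mod_cast hp.pos.ne'
  set A : ℤ[X] := C a * H with hA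
  set D := derivative A with hD
  have hDdeg : D.natDegree ≤ k :=
    (natDegree_derivative_le _).trans ((Nat.sub_le _ _).trans ((natDegree_C_mul_le _ _).trans hH))
  have hDc : ∃ j, ¬ (p : ℤ) ∣ D.coeff j := by
    obtain ⟨j, hj1, hj⟩ := hc
    obtain ⟨j, rfl⟩ := Nat.exists_eq_add_of_le' hj1
    have hjk : j + 1 ≤ k := by
      by_contra h
      exact hj (by rw [coeff_eq_zero_of_natDegree_lt (by omega)]; exact dvd_zero _)
    refine ⟨j, fun h => ?_⟩
    rw [hD, coeff_derivative, hA, coeff_C_mul] at h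
    have hp' : Prime (p : ℤ) := Nat.prime_iff_prime_int.1 hp
    rcases hp'.dvd_or_dvd h with h | h
    · exact hj (ha.symm.dvd_of_dvd_mul_left h)
    · have : p ∣ j + 1 := by exact_mod_cast h
      have := Nat.le_of_dvd (by omega) this
      omega
  have hterm : ∀ s y : ℕ, ex (A.eval ((p ^ (i + 1) * y + s : ℕ) : ℤ) / (p ^ (i + 2) : ℕ)) =
      ex (A.eval (s : ℤ) / (p ^ (i + 2) : ℕ)) * ex (((D.eval (s : ℤ) * y : ℤ) : ℝ) / p) := by
    intro s y
    rw [← ex_add]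
    have h1 : A.eval (s : ℤ) / ((p ^ (i + 2) : ℕ) : ℝ) + ((D.eval (s : ℤ) * y : ℤ) : ℝ) / p =
        ((A.eval (s : ℤ) + D.eval (s : ℤ) * (p ^ (i + 1) * y) : ℤ) : ℝ) / ((p ^ (i + 2) : ℕ) : ℝ) := by
      push_cast
      field_simp
      ring
    rw [h1]
    refine ex_div_eq_of_dvd (pow_ne_zero _ hp.pos.ne') ?_
    obtain ⟨c, hc⟩ := A.binomExpansion (s : ℤ) (p ^ (i + 1) * y)
    rw [show ((p ^ (i + 1) * y + s : ℕ) : ℤ) = s + p ^ (i + 1) * y by push_cast; ring, hc]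
    refine ⟨c * p ^ i * y ^ 2, ?_⟩
    push_cast
    ring
  have hsum : ‖∑ x ∈ range (p ^ (i + 2)), ex (A.eval (x : ℤ) / (p ^ (i + 2) : ℕ))‖ ≤
      p ^ (i + 1) * k := by
    conv_lhs => rw [show range (p ^ (i + 2)) = range (p ^ (i + 1) * p) by rw [← pow_succ]]
    rw [sum_range_mul_eq]
    simp only [hterm, ← mul_sum]
    calc _ ≤ ∑ s ∈ range (p ^ (i + 1)), if (p : ℤ) ∣ D.eval ((s : ℕ) : ℤ) then (p : ℝ) else 0 := by
          refine (norm_sum_le _ _).trans (sum_le_sum fun s _ => ?_)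
          rw [norm_mul, norm_ex, one_mul]
          split_ifs with h
          · exact norm_sum_ex_le (fun y => ((D.eval ((s : ℕ) : ℤ) * y : ℤ) : ℝ) / p) p
          · rw [sum_ex_mul_div_eq_zero hp.pos.ne' h, norm_zero]
      _ = #{s ∈ range (p ^ (i + 1)) | (p : ℤ) ∣ D.eval ((s : ℕ) : ℤ)} * (p : ℝ) := by
          rw [← sum_filter, sum_const, nsmul_eq_mul]
      _ ≤ (p ^ i * k : ℕ) * (p : ℝ) := by
          gcongr
          exact card_roots_mod_pow_le hp hDdeg hDc i
      _ = _ := by push_cast; ring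
  rw [completeSum, norm_div, Complex.norm_natCast]
  refine (div_le_div_of_nonneg_right hsum (by positivity)).trans (le_of_eq ?_)
  push_cast
  field_simp
  ring

/-- The multiplicative function with value `A p^(-3/2) r^j` at a prime power `p^j`. -/
noncomputable def weight (A r : ℝ) (n : ℕ) : ℝ :=
  n.factorization.prod fun p j => A / (p * √p) * r ^ j

theorem weight_one (A r : ℝ) : weight A r 1 = 1 := by simp [weight]

theorem weight_mul (A r : ℝ) {m n : ℕ} (h : Nat.Coprime m n) :
    weight A r (m * n) = weight A r m * weight A r n := by
  rw [weight, Nat.factorization_mul_of_coprime h, Finsupp.prod_add_index_of_disjoint]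
  · rfl
  · simpa using h.disjoint_primeFactors

theorem weight_nonneg {A r : ℝ} (hA : 0 ≤ A) (hr : 0 ≤ r) (n : ℕ) : 0 ≤ weight A r n := by
  rw [weight, Finsupp.prod]
  positivity

theorem weight_prime_pow (A r : ℝ) {p : ℕ} (hp : p.Prime) {j : ℕ} (hj : 0 < j) :
    weight A r (p ^ j) = A / (p * √p) * r ^ j := by
  rw [weight, hp.factorization_pow, Finsupp.prod, Finsupp.support_single _ hj.ne']
  simp

theorem summable_inv_mul_sqrt : Summable fun n : ℕ => ((n : ℝ) * √n)⁻¹ := by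
  convert Real.summable_nat_rpow_inv.mpr (show (1 : ℝ) < 3 / 2 by norm_num) using 3 with n
  rcases Nat.eq_zero_or_pos n with rfl | hn
  · simp
  · rw [Real.sqrt_eq_rpow, ← Real.rpow_one_add' (by positivity) (by norm_num)]
    norm_num

theorem sum_weight_le {A r : ℝ} (hA : 0 ≤ A) (hr : 0 ≤ r) (hr1 : r < 1) :
    ∃ W : ℝ, ∀ Y : ℕ, ∑ q ∈ Icc 1 Y, weight A r q ≤ W := by
  have hshift : ∀ {p : ℕ}, p.Prime → HasSum (fun n : ℕ => weight A r (p ^ n))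
      (1 + A / (p * √p) * (r * (1 - r)⁻¹)) := by
    intro p hp
    rw [← hasSum_nat_add_iff' 1]
    simp only [range_one, sum_singleton, pow_zero, weight_one, add_sub_cancel_left]
    refine (((hasSum_geometric_of_lt_one hr hr1).mul_left r).mul_left (A / (p * √p))).congr_fun ?_
    intro n
    rw [weight_prime_pow _ _ hp (Nat.succ_pos n), pow_succ']
  have hsummable : ∀ {p : ℕ}, p.Prime → Summable fun n : ℕ => ‖weight A r (p ^ n)‖ := by
    intro p hp
    simpa only [Real.norm_of_nonneg (weight_nonneg hA hr _)] using (hshift hp).summable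
  set D := A * (r * (1 - r)⁻¹) with hD
  have hD0 : 0 ≤ D := by have : 0 < 1 - r := by linarith
                         positivity
  refine ⟨Real.exp (D * ∑' n : ℕ, ((n : ℝ) * √n)⁻¹), fun Y => ?_⟩
  obtain ⟨h1, h2⟩ := EulerProduct.summable_and_hasSum_smoothNumbers_prod_primesBelow_tsum
    (f := weight A r) (weight_one A r) (weight_mul A r) hsummable (Y + 1)
  have hmem : ∀ q ∈ Icc 1 Y, q ∈ Nat.smoothNumbers (Y + 1) := by
    intro q hq
    rw [mem_Icc] at hq
    rw [Nat.mem_smoothNumbers_iff_forall_le]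
    exact ⟨by omega, fun p hp _ _ => by omega⟩
  calc ∑ q ∈ Icc 1 Y, weight A r q
      = ∑ q ∈ (Icc 1 Y).subtype (· ∈ Nat.smoothNumbers (Y + 1)), weight A r q := by
        rw [← sum_subtype_of_mem _ hmem]
    _ ≤ ∏ p ∈ Nat.primesBelow (Y + 1), ∑' n : ℕ, weight A r (p ^ n) :=
        sum_le_hasSum _ (fun _ _ => weight_nonneg hA hr _) h2
    _ ≤ ∏ p ∈ Nat.primesBelow (Y + 1), Real.exp (D * ((p : ℝ) * √p)⁻¹) := by
        refine prod_le_prod (fun p _ => tsum_nonneg fun _ => weight_nonneg hA hr _) fun p hp => ?_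
        rw [(hshift (Nat.prime_of_mem_primesBelow hp)).tsum_eq]
        refine le_trans (le_of_eq ?_) (Real.add_one_le_exp _)
        rw [hD]
        ring
    _ ≤ _ := by
        rw [← Real.exp_sum, ← mul_sum]
        gcongr
        exact summable_inv_mul_sqrt.sum_le_tsum _ fun _ _ => by positivity

theorem norm_completeSum_le_one (H : ℤ[X]) (a : ℤ) (q : ℕ) : ‖completeSum H a q‖ ≤ 1 := by
  rw [completeSum, norm_div, Complex.norm_natCast]
  refine div_le_one_of_le₀ ?_ (by positivity)
  exact norm_sum_ex_le (fun x => (((C a * H).eval (x : ℤ) : ℤ) : ℝ) / q) q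

theorem norm_completeSum_prime_pow_decay (k Γ : ℕ) (hΓ : 1 ≤ Γ) : ∃ B r : ℝ, 1 ≤ B ∧ 0 < r ∧ r < 1 ∧
    ∀ (p j : ℕ) (a : ℤ) (H : ℤ[X]), p.Prime → IsCoprime a ((p ^ j : ℕ) : ℤ) → H.natDegree ≤ k →
      ContentDvd H Γ → ‖completeSum H a (p ^ j)‖ ≤ B * r ^ j := by
  obtain ⟨C, hC⟩ := modulus_le_of_large_completeSum k Γ hΓ
  refine ⟨C + 1, (2 : ℝ)⁻¹ ^ ((C + 1 : ℕ) : ℝ)⁻¹, by linarith [(Nat.cast_nonneg C : (0 : ℝ) ≤ C)],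
    by positivity, Real.rpow_lt_one (by norm_num) (by norm_num) (by positivity), ?_⟩
  intro p j a H hp ha hH hΓH
  set G := ‖completeSum H a (p ^ j)‖ with hG
  rcases (norm_nonneg (completeSum H a (p ^ j))).eq_or_lt with h0 | h0
  · rw [hG, ← h0]; positivity
  have h1 : G ≤ 1 := norm_completeSum_le_one _ _ _
  have h2 := hC G⁻¹ (p ^ j) a H ((one_le_inv₀ h0).2 h1) (Nat.one_le_pow _ _ hp.pos) ha hH hΓH
    (by rw [inv_mul_cancel₀ h0.ne'])
  rw [inv_pow, ← div_eq_mul_inv, le_div_iff₀ (by positivity)] at h2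
  have h3 : G ^ (C + 1) ≤ (C + 1) * (2 : ℝ)⁻¹ ^ j := by
    have hpj : (2 : ℝ) ^ j ≤ ((p ^ j : ℕ) : ℝ) := by
      push_cast
      gcongr
      exact_mod_cast hp.two_le
    have h4 : 2 ^ j * G ^ C ≤ C + 1 := by
      have := mul_le_mul_of_nonneg_right hpj (pow_nonneg h0.le C)
      linarith
    have h5 : G ^ (C + 1) ≤ G ^ C := pow_le_pow_of_le_one h0.le h1 (Nat.le_succ C)
    rw [inv_pow, ← div_eq_mul_inv, le_div_iff₀ (by positivity)]
    nlinarith [pow_pos (show (0 : ℝ) < 2 by norm_num) j]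
  refine le_of_pow_le_pow_left₀ (Nat.succ_ne_zero C) (by positivity) (h3.trans ?_)
  rw [mul_pow, ← pow_mul, mul_comm j, pow_mul, ← Real.rpow_natCast (_ ^ (_ : ℝ)),
    ← Real.rpow_mul (by norm_num), inv_mul_cancel₀ (by positivity), Real.rpow_one]
  gcongr
  exact le_self_pow₀ (by linarith [(Nat.cast_nonneg C : (0 : ℝ) ≤ C)]) (Nat.succ_ne_zero C)

theorem norm_completeSum_cube_le_weight (k Γ : ℕ) (hΓ : 1 ≤ Γ) :
    ∃ A r : ℝ, 0 ≤ A ∧ 0 ≤ r ∧ r < 1 ∧ ∀ (q : ℕ) (a : ℤ) (H : ℤ[X]), 1 ≤ q →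
      IsCoprime a (q : ℤ) → H.natDegree ≤ k → ContentDvd H Γ →
        ‖completeSum H a q‖ ^ 3 ≤ weight A r q := by
  obtain ⟨B, r, hB, hr, hr1, hdec⟩ := norm_completeSum_prime_pow_decay k Γ hΓ
  set D : ℝ := ((k + Γ : ℕ) : ℝ) with hD
  have hD0 : 1 ≤ D := by rw [hD]; exact_mod_cast (by omega)
  set A : ℝ := k ^ 3 / r + k ^ 2 * B + B * (D * √D) with hA
  have hA0 : 0 ≤ A := by positivity
  have hpp : ∀ (p j : ℕ) (a : ℤ) (H : ℤ[X]), p.Prime → 0 < j → IsCoprime a ((p ^ j : ℕ) : ℤ) →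
      H.natDegree ≤ k → ContentDvd H Γ →
        ‖completeSum H a (p ^ j)‖ ^ 3 ≤ A / (p * √p) * r ^ j := by
    intro p j a H hp hj ha hH hΓH
    have hp1 : (1 : ℝ) ≤ p := by exact_mod_cast hp.one_le
    have hd := hdec p j a H hp ha hH hΓH
    set G := ‖completeSum H a (p ^ j)‖ with hG
    have hG0 : 0 ≤ G := norm_nonneg _
    have hG1 : G ≤ 1 := norm_completeSum_le_one _ _ _
    rw [div_mul_eq_mul_div, le_div_iff₀ (by positivity)]
    rcases le_or_gt p (k + Γ) with hpk | hpk
    · have hpD : (p : ℝ) ≤ D := by rw [hD]; exact_mod_cast hpk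
      calc G ^ 3 * (p * √p) ≤ G * (D * √D) := by
            have : G ^ 3 ≤ G := by simpa using pow_le_pow_of_le_one hG0 hG1 (show 1 ≤ 3 by norm_num)
            gcongr
        _ ≤ B * r ^ j * (D * √D) := by gcongr
        _ = (B * (D * √D)) * r ^ j := by ring
        _ ≤ A * r ^ j := by
            gcongr
            rw [hA]
            have : 0 ≤ (k : ℝ) ^ 3 / r + k ^ 2 * B := by positivity
            linarith
    · have hc : ∃ i, 1 ≤ i ∧ ¬ (p : ℤ) ∣ H.coeff i := by
        by_contra! h
        have := Nat.le_of_dvd hΓ (hΓH p h)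
        omega
      have hap : IsCoprime a (p : ℤ) := by
        push_cast at ha
        exact (IsCoprime.pow_right_iff hj).1 ha
      have hsq : √(p : ℝ) * √p = p := Real.mul_self_sqrt (by positivity)
      obtain rfl | ⟨i, rfl⟩ : j = 1 ∨ ∃ i, j = i + 2 := by
        rcases j with _ | _ | j
        · omega
        · simp
        · exact Or.inr ⟨j, rfl⟩
      · have h1 := norm_completeSum_prime_le hp (by omega) hap hH hc
        rw [pow_one] at hG
        rw [← hG] at h1
        have hs : 0 < √(p : ℝ) := by positivity
        rw [le_div_iff₀ hs] at h1
        calc G ^ 3 * (p * √p) = (G * √p) ^ 3 := by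
                linear_combination (-G ^ 3 * √p) * hsq
          _ ≤ (k : ℝ) ^ 3 := by gcongr
          _ = k ^ 3 / r * r ^ 1 := by field_simp
          _ ≤ A * r ^ 1 := by
            gcongr
            rw [hA]
            have : 0 ≤ (k : ℝ) ^ 2 * B + B * (D * √D) := by positivity
            linarith
      · have h1 := norm_completeSum_prime_pow_le hp (by omega) hap hH hc (i := i)
        rw [← hG, le_div_iff₀ (by positivity)] at h1
        have hsp : √(p : ℝ) ≤ p := by
          rw [Real.sqrt_le_left (by positivity)]
          nlinarith
        calc G ^ 3 * (p * √p) ≤ G ^ 3 * (p * p) := by gcongr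
          _ = (G * p) ^ 2 * G := by ring
          _ ≤ (k : ℝ) ^ 2 * (B * r ^ (i + 2)) := by gcongr
          _ = (k ^ 2 * B) * r ^ (i + 2) := by ring
          _ ≤ A * r ^ (i + 2) := by
            gcongr
            rw [hA]
            have : 0 ≤ (k : ℝ) ^ 3 / r + B * (D * √D) := by positivity
            linarith
  refine ⟨A, r, hA0, hr.le, hr1, fun q => ?_⟩
  induction q using Nat.recOnPosPrimePosCoprime with
  | prime_pow p j hp hj =>
    intro a H _ ha hH hΓH
    rw [weight_prime_pow _ _ hp hj]
    exact hpp p j a H hp hj ha hH hΓH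
  | zero => intro _ _ h; omega
  | one =>
    intro a H _ _ _ _
    rw [weight_one]
    exact pow_le_one₀ (norm_nonneg _) (norm_completeSum_le_one _ _ _)
  | coprime m n hm hn hmn ihm ihn =>
    intro a H _ ha hH hΓH
    obtain ⟨a₁, a₂, h1, h2, h3⟩ := completeSum_mul (by omega) (by omega) hmn ha H
    rw [h3, norm_mul, mul_pow, weight_mul _ _ hmn]
    exact mul_le_mul (ihm a₁ H hm.le h1 hH hΓH) (ihn a₂ H hn.le h2 hH hΓH) (by positivity)
      (weight_nonneg hA0 hr.le _)

/-- A summable majorant for products of three normalized complete exponential sums. -/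
theorem exists_majorant_completeSum (k Γ : ℕ) (hΓ : 1 ≤ Γ) :
    ∃ (v : ℕ → ℝ) (W : ℝ), (∀ q, 0 ≤ v q) ∧ (∀ Y : ℕ, ∑ q ∈ Icc 1 Y, v q ≤ W) ∧
      ∀ (q : ℕ) (a : ℤ) (H : Fin 3 → ℤ[X]), 1 ≤ q → IsCoprime a (q : ℤ) →
        (∀ i, (H i).natDegree ≤ k) → (∀ i, ContentDvd (H i) Γ) →
          ∏ i, ‖completeSum (H i) a q‖ ≤ v q := by
  obtain ⟨A, r, hA, hr, hr1, hw⟩ := norm_completeSum_cube_le_weight k Γ hΓ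
  obtain ⟨W, hW⟩ := sum_weight_le hA hr hr1
  refine ⟨weight A r, W, weight_nonneg hA hr, hW, fun q a H hq ha hk hΓH => ?_⟩
  refine le_of_pow_le_pow_left₀ three_ne_zero (weight_nonneg hA hr _) ?_
  rw [← prod_pow]
  refine (prod_le_prod (fun _ _ => by positivity) fun i _ =>
    hw q a (H i) hq ha (hk i) (hΓH i)).trans (by simp)

theorem exists_padicInt_root {h : ℤ[X]} (hh : Intersective h) (p : ℕ) [Fact p.Prime] :
    ∃ z : ℤ_[p], aeval z h = 0 := by
  have hp := (Fact.out : p.Prime)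
  choose n hn using fun j => (hh.2 (p ^ j) (pow_pos hp.pos j))
  obtain ⟨z, φ, hφ, hz⟩ := CompactSpace.tendsto_subseq fun j => (n j : ℤ_[p])
  refine ⟨z, ?_⟩
  have h1 : Filter.Tendsto (fun j => aeval ((n (φ j) : ℕ) : ℤ_[p]) h) Filter.atTop
      (nhds (aeval z h)) := (h.continuous_aeval.tendsto z).comp hz
  have h2 : Filter.Tendsto (fun j => aeval ((n (φ j) : ℕ) : ℤ_[p]) h) Filter.atTop (nhds 0) := by
    have hp2 : ((p : ℝ)⁻¹) < 1 := inv_lt_one_of_one_lt₀ (by exact_mod_cast hp.one_lt)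
    refine squeeze_zero_norm (fun j => ?_)
      (tendsto_pow_atTop_nhds_zero_of_lt_one (by positivity) hp2 |>.comp hφ.tendsto_atTop)
    have h3 : aeval ((n (φ j) : ℕ) : ℤ_[p]) h = ((h.eval (n (φ j) : ℤ) : ℤ) : ℤ_[p]) := by
      have := aeval_algebraMap_apply ℤ_[p] ((n (φ j) : ℕ) : ℤ) h
      simpa using this
    rw [h3]
    have := (PadicInt.norm_int_le_pow_iff_dvd (p := p)).2 (hn (φ j)).2
    simpa [zpow_neg] using this
  exact tendsto_nhds_unique h1 h2

theorem eq_of_pow_mul_eq_pow_mul {R : Type*} [CommRing R] [IsDomain R] {z : R} {u v : R[X]}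
    {m n : ℕ} (hu : u.eval z ≠ 0) (hv : v.eval z ≠ 0)
    (h : (X - C z) ^ m * u = (X - C z) ^ n * v) : u = v := by
  wlog hmn : m ≤ n generalizing m n u v
  · exact (this hv hu h.symm (by omega)).symm
  obtain ⟨i, rfl⟩ := Nat.exists_eq_add_of_le hmn
  rw [pow_add, mul_assoc] at h
  have h1 := mul_left_cancel₀ (pow_ne_zero m (X_sub_C_ne_zero z)) h
  rcases Nat.eq_zero_or_pos i with rfl | hi
  · simpa using h1
  · rw [h1] at hu
    simp [hi.ne'] at hu

theorem exists_cofactor_dvd_of_irreducible {h : ℤ[X]} (h0 : h ≠ 0) {f : ℚ[X]} (hf : Irreducible f) :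
    ∃ N : ℕ, 1 ≤ N ∧ ∀ (p : ℕ) [Fact p.Prime] (z : ℤ_[p]) (m : ℕ) (u : ℤ_[p][X]),
      aeval (z : ℚ_[p]) f = 0 → h.map (Int.castRingHom ℤ_[p]) = (X - C z) ^ m * u →
        u.eval z ≠ 0 → u.eval z ∣ (N : ℤ_[p]) := by
  set hQ := h.map (Int.castRingHom ℚ) with hhQ
  have hQ0 : hQ ≠ 0 := (Polynomial.map_ne_zero_iff (RingHom.injective_int _)).2 h0
  obtain ⟨w, hw, hfw⟩ := (FiniteMultiplicity.of_not_isUnit hf.not_isUnit hQ0).exists_eq_pow_mul_and_not_dvd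
  set e := multiplicity f hQ
  have hcop : IsCoprime f (derivative f ^ e * w) :=
    (hf.separable.pow_right).mul_right ((hf.coprime_iff_not_dvd).2 hfw)
  obtain ⟨A, B, hAB⟩ := hcop
  obtain ⟨b, hb, hB⟩ := IsLocalization.integerNormalization_spec (nonZeroDivisors ℤ) B
  set B' := IsLocalization.integerNormalization (nonZeroDivisors ℤ) B
  have hb0 : b ≠ 0 := nonZeroDivisors.ne_zero hb
  refine ⟨b.natAbs, Int.natAbs_pos.2 hb0, fun p _ z m u hz hfac hu => ?_⟩
  set ι := algebraMap ℚ ℚ_[p]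
  set Z : ℚ_[p] := (z : ℚ_[p])
  set uQ := u.map (algebraMap ℤ_[p] ℚ_[p]) with huQ
  have huZ : uQ.eval Z = ((u.eval z : ℤ_[p]) : ℚ_[p]) := by
    rw [huQ, show Z = algebraMap ℤ_[p] ℚ_[p] z from rfl, eval_map_algebraMap, aeval_algebraMap_apply]
    simp [aeval_def]
  obtain ⟨f₁, hf₁⟩ := dvd_iff_isRoot.2 (show IsRoot (f.map ι) Z by
    rw [IsRoot, eval_map_algebraMap, hz])
  have hder : (derivative f).aeval Z = f₁.eval Z := by
    rw [← eval_map_algebraMap, ← derivative_map, hf₁]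
    simp
  have hab : aeval Z B * (f₁.eval Z ^ e * aeval Z w) = 1 := by
    have := congrArg (aeval Z) hAB
    simpa [hz, hder] using this
  have hkey : uQ = f₁ ^ e * w.map ι := by
    refine eq_of_pow_mul_eq_pow_mul (m := m) (n := e) (z := Z) ?_ ?_ ?_
    · rw [huZ]
      exact fun h => hu (Subtype.ext h)
    · intro h
      rw [eval_mul, eval_pow, eval_map_algebraMap] at h
      rw [h, mul_zero] at hab
      exact zero_ne_one hab
    · have h1 : (h.map (Int.castRingHom ℤ_[p])).map (algebraMap ℤ_[p] ℚ_[p]) = hQ.map ι := by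
        rw [hhQ, Polynomial.map_map, Polynomial.map_map]
        congr 1
      rw [hfac, hw, Polynomial.map_mul, Polynomial.map_mul, Polynomial.map_pow, Polynomial.map_pow,
        hf₁, Polynomial.map_sub, map_X, map_C, mul_pow, mul_assoc] at h1
      exact h1
  have h2 : ((aeval z B' : ℤ_[p]) : ℚ_[p]) * ((u.eval z : ℤ_[p]) : ℚ_[p]) = b := by
    rw [← huZ, hkey, eval_mul, eval_pow, eval_map_algebraMap]
    have h3 : ((aeval z B' : ℤ_[p]) : ℚ_[p]) = b * aeval Z B := by
      have h4 : ((aeval z B' : ℤ_[p]) : ℚ_[p]) = aeval Z B' :=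
        (aeval_algebraMap_apply ℚ_[p] z B').symm
      rw [h4, ← aeval_map_algebraMap ℚ, hB, map_zsmul, zsmul_eq_mul]
    rw [h3, mul_assoc, hab, mul_one]
  have h3 : aeval z B' * u.eval z = (b : ℤ_[p]) := Subtype.ext (by push_cast; exact h2)
  have h4 : (b : ℤ_[p]) ∣ ((b.natAbs : ℕ) : ℤ_[p]) := by
    have : (b : ℤ) ∣ ((b.natAbs : ℕ) : ℤ) := Int.dvd_natAbs.2 dvd_rfl
    have := map_dvd (Int.castRingHom ℤ_[p]) this
    simpa using this
  exact (Dvd.intro_left _ h3).trans h4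

/-- The cofactors at `p`-adic roots of a polynomial, for all primes `p`, divide a common integer. -/
theorem exists_cofactor_dvd {h : ℤ[X]} (h0 : h ≠ 0) :
    ∃ N : ℕ, 1 ≤ N ∧ ∀ (p : ℕ) [Fact p.Prime] (z : ℤ_[p]) (m : ℕ) (u : ℤ_[p][X]),
      aeval z h = 0 → h.map (Int.castRingHom ℤ_[p]) = (X - C z) ^ m * u →
        u.eval z ≠ 0 → u.eval z ∣ (N : ℤ_[p]) := by
  classical
  set hQ := h.map (Int.castRingHom ℚ) with hhQ
  have hQ0 : hQ ≠ 0 := (Polynomial.map_ne_zero_iff (RingHom.injective_int _)).2 h0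
  choose! N hN1 hN using fun (f : ℚ[X]) (hf : Irreducible f) =>
    exists_cofactor_dvd_of_irreducible h0 hf
  set S := (UniqueFactorizationMonoid.normalizedFactors hQ).toFinset with hS
  have hirr : ∀ f ∈ S, Irreducible f := fun f hf =>
    UniqueFactorizationMonoid.irreducible_of_normalized_factor f (Multiset.mem_toFinset.1 hf)
  refine ⟨∏ f ∈ S, N f, Nat.one_le_iff_ne_zero.2 (prod_ne_zero_iff.2 fun f hf =>
    Nat.one_le_iff_ne_zero.1 (hN1 f (hirr f hf))), fun p _ z m u hz hfac hu => ?_⟩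
  have hzQ : aeval (z : ℚ_[p]) hQ = 0 := by
    rw [hhQ, show Int.castRingHom ℚ = algebraMap ℤ ℚ from rfl, aeval_map_algebraMap]
    have : ((aeval z h : ℤ_[p]) : ℚ_[p]) = aeval (z : ℚ_[p]) h :=
      (aeval_algebraMap_apply ℚ_[p] z h).symm
    rw [← this, hz]
    rfl
  have hint : IsIntegral ℚ (z : ℚ_[p]) := isAlgebraic_iff_isIntegral.1 ⟨hQ, hQ0, hzQ⟩
  obtain ⟨f, hf, hass⟩ := UniqueFactorizationMonoid.exists_mem_normalizedFactors_of_dvd hQ0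
    (minpoly.irreducible hint) (minpoly.dvd ℚ _ hzQ)
  have hfS : f ∈ S := Multiset.mem_toFinset.2 hf
  have hfz : aeval (z : ℚ_[p]) f = 0 := by
    obtain ⟨c, hc⟩ := hass.dvd
    rw [hc, map_mul, minpoly.aeval, zero_mul]
  refine (hN f (hirr f hfS) p z m u hfz hfac hu).trans ?_
  exact Nat.cast_dvd_cast (dvd_prod_of_mem N hfS)

/-- The `p`-adic data of a root of `h`. -/
theorem exists_padic_factorization {h : ℤ[X]} (hh : Intersective h) (p : ℕ) [Fact p.Prime] :
    ∃ (z : ℤ_[p]) (m : ℕ) (u : ℤ_[p][X]), aeval z h = 0 ∧ 1 ≤ m ∧ m ≤ h.natDegree ∧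
      h.map (Int.castRingHom ℤ_[p]) = (X - C z) ^ m * u ∧ u.eval z ≠ 0 := by
  obtain ⟨z, hz⟩ := exists_padicInt_root hh p
  set P := h.map (Int.castRingHom ℤ_[p]) with hP
  have hP0 : P ≠ 0 := (Polynomial.map_ne_zero_iff (RingHom.injective_int _)).2 hh.1
  have hroot : P.IsRoot z := by
    rw [IsRoot, hP, show Int.castRingHom ℤ_[p] = algebraMap ℤ ℤ_[p] from rfl, eval_map_algebraMap, hz]
  obtain ⟨u, hu, hdvd⟩ := P.exists_eq_pow_rootMultiplicity_mul_and_not_dvd hP0 z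
  refine ⟨z, P.rootMultiplicity z, u, hz, (rootMultiplicity_pos hP0).2 hroot, ?_, hu, fun h =>
    hdvd (dvd_iff_isRoot.2 h)⟩
  refine (le_trans ?_ (natDegree_map_le (f := Int.castRingHom ℤ_[p]) (p := h)))
  have := natDegree_le_of_dvd (pow_rootMultiplicity_dvd P z) hP0
  simpa [natDegree_pow] using this

/-- If a polynomial is constant modulo `c`, so are its compositions. -/
theorem exists_comp_eq_add_mul {R : Type*} [CommRing R] {P : R[X]} {c : R}
    (h : ∀ j, 1 ≤ j → c ∣ P.coeff j) (Q : R[X]) (j : ℕ) (hj : 1 ≤ j) : c ∣ (P.comp Q).coeff j := by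
  have h1 : C c ∣ P - C (P.coeff 0) := by
    rw [C_dvd_iff_dvd_coeff]
    intro i
    rcases Nat.eq_zero_or_pos i with rfl | hi
    · simp
    · rw [coeff_sub, coeff_C_of_ne_zero hi.ne', sub_zero]
      exact h i hi
  obtain ⟨P', hP'⟩ := h1
  rw [sub_eq_iff_eq_add.1 hP']
  simp only [add_comp, mul_comp, C_comp, coeff_add, coeff_C_mul, coeff_C_of_ne_zero (by omega : j ≠ 0),
    add_zero]
  exact dvd_mul_right _ _

/-- Local analysis of `h(r + dX)` at a prime `p`, where `r ≡ z mod p^c` and `d` is `p^c` times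
a unit. -/
theorem padic_comp_linear {p : ℕ} [Fact p.Prime] {h : ℤ[X]} {z : ℤ_[p]} {m : ℕ} {u : ℤ_[p][X]}
    (hfac : h.map (Int.castRingHom ℤ_[p]) = (X - C z) ^ m * u) {r d c : ℕ} {t w : ℤ_[p]}
    (hr : (r : ℤ_[p]) = z + p ^ c * t) (hd : (d : ℤ_[p]) = p ^ c * w) :
    (h.comp (C (r : ℤ) + C (d : ℤ) * X)).map (Int.castRingHom ℤ_[p]) =
      C ((p : ℤ_[p]) ^ (c * m)) * ((C t + C w * X) ^ m * u.comp (C (r : ℤ_[p]) + C (d : ℤ_[p]) * X)) := by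
  rw [Polynomial.map_comp, hfac]
  simp only [Polynomial.map_add, Polynomial.map_mul, map_C, map_X, mul_comp, pow_comp, sub_comp,
    X_comp, C_comp, Int.coe_castRingHom, Int.cast_natCast]
  rw [show C (r : ℤ_[p]) + C (d : ℤ_[p]) * X - C z = C ((p : ℤ_[p]) ^ c) * (C t + C w * X) by
    rw [hr, hd]; simp only [C_add, C_mul]; ring]
  rw [mul_pow, ← C_pow, ← pow_mul, mul_assoc]

theorem dvd_cofactor_of_dvd_coeff {p : ℕ} [Fact p.Prime] {h H : ℤ[X]} {z : ℤ_[p]} {m : ℕ}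
    {u : ℤ_[p][X]} (hm : 1 ≤ m) (hfac : h.map (Int.castRingHom ℤ_[p]) = (X - C z) ^ m * u)
    {r d c G : ℕ} {t w g' : ℤ_[p]} (hr : (r : ℤ_[p]) = z + p ^ c * t)
    (hd : (d : ℤ_[p]) = p ^ c * w) (hw : IsUnit w) (hG : (G : ℤ_[p]) = p ^ (c * m) * g')
    (hH : C (G : ℤ) * H = h.comp (C (r : ℤ) + C (d : ℤ) * X)) {s : ℕ}
    (hs : ∀ j, 1 ≤ j → (p : ℤ) ^ s ∣ H.coeff j) : (p : ℤ_[p]) ^ s ∣ u.eval z := by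
  have hp0 : (p : ℤ_[p]) ≠ 0 := by exact_mod_cast (Fact.out : p.Prime).ne_zero
  set P := H.map (Int.castRingHom ℤ_[p]) with hP
  have h1 : C g' * P = (C t + C w * X) ^ m * u.comp (C (r : ℤ_[p]) + C (d : ℤ_[p]) * X) := by
    have h2 := congrArg (Polynomial.map (Int.castRingHom ℤ_[p])) hH
    rw [padic_comp_linear hfac hr hd, Polynomial.map_mul, map_C, eq_intCast, Int.cast_natCast, hG,
      C_mul, mul_assoc] at h2
    exact mul_left_cancel₀ (C_ne_zero.2 (pow_ne_zero _ hp0)) h2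
  have h3 : ∀ j, 1 ≤ j → (p : ℤ_[p]) ^ s ∣ (C g' * P).coeff j := by
    intro j hj
    rw [coeff_C_mul, hP, coeff_map]
    have := map_dvd (Int.castRingHom ℤ_[p]) (hs j hj)
    rw [map_pow, map_natCast] at this
    exact this.mul_left _
  obtain ⟨w', hw'⟩ := hw.exists_right_inv
  have h4 := exists_comp_eq_add_mul h3 (C w' * (X - C t)) m hm
  rw [h1, mul_comp, pow_comp, comp_assoc] at h4
  have h5 : (C t + C w * X).comp (C w' * (X - C t)) = X := by
    simp only [add_comp, C_comp, mul_comp, X_comp]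
    rw [← mul_assoc, ← C_mul, hw', C_1]
    ring
  have h6 : (C (r : ℤ_[p]) + C (d : ℤ_[p]) * X).comp (C w' * (X - C t)) = C z + C ((p : ℤ_[p]) ^ c) * X := by
    simp only [add_comp, C_comp, mul_comp, X_comp]
    rw [← mul_assoc, ← C_mul, hd, mul_assoc, hw', mul_one, hr, C_add, C_mul]
    ring
  rw [h5, h6, coeff_X_pow_mul', if_pos le_rfl, Nat.sub_self, coeff_zero_eq_eval_zero, eval_comp] at h4
  simpa using h4

/-- The modulus with `d_p^(m_p) = g_p^K`. -/
noncomputable def auxModulus (K g : ℕ) (m : ℕ → ℕ) : ℕ :=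
  ∏ p ∈ g.primeFactors, p ^ (K * g.factorization p / m p)

theorem auxModulus_pos (K g : ℕ) (m : ℕ → ℕ) : 0 < auxModulus K g m :=
  Finset.prod_pos fun _ hp => pow_pos (Nat.prime_of_mem_primeFactors hp).pos _

theorem auxModulus_le {K g : ℕ} (hg : g ≠ 0) (m : ℕ → ℕ) : auxModulus K g m ≤ g ^ K := by
  conv_rhs => rw [← Nat.prod_factorization_pow_eq_self hg]
  rw [Finsupp.prod, ← prod_pow, auxModulus, Nat.support_factorization]
  refine prod_le_prod' fun p hp => ?_
  rw [← pow_mul, mul_comm (g.factorization p)]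
  exact Nat.pow_le_pow_right (Nat.prime_of_mem_primeFactors hp).pos (Nat.div_le_self _ _)

theorem auxModulus_eq (K g : ℕ) (m : ℕ → ℕ) {p : ℕ} (hp : p.Prime) :
    ∃ w : ℕ, Nat.Coprime p w ∧
      auxModulus K g m = p ^ (K * g.factorization p / m p) * w := by
  refine ⟨∏ q ∈ g.primeFactors.erase p, q ^ (K * g.factorization q / m q), ?_, ?_⟩
  · refine Nat.Coprime.prod_right fun q hq => Nat.Coprime.pow_right _ ?_
    exact (Nat.coprime_primes hp (Nat.prime_of_mem_primeFactors (mem_of_mem_erase hq))).2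
      (ne_of_mem_erase hq).symm
  · by_cases hpg : p ∈ g.primeFactors
    · rw [auxModulus, ← mul_prod_erase _ _ hpg]
    · rw [erase_eq_of_notMem hpg]
      have : g.factorization p = 0 := by
        rwa [← Finsupp.notMem_support_iff, Nat.support_factorization]
      rw [this]
      simp [auxModulus]

theorem isUnit_natCast_padicInt {p w : ℕ} [Fact p.Prime] (h : Nat.Coprime p w) :
    IsUnit (w : ℤ_[p]) := by
  rw [PadicInt.isUnit_iff]
  have := (PadicInt.norm_intCast_eq_one_iff (p := p) (z := (w : ℤ))).2
    (Nat.isCoprime_iff_coprime.2 h.symm)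
  simpa using this

theorem abs_eval_le_of_le {P : ℤ[X]} {n : ℕ} (hP : P.natDegree ≤ n) {x y : ℤ} (hx : |x| ≤ y)
    (hy : 1 ≤ y) : |P.eval x| ≤ (∑ i ∈ range (n + 1), |P.coeff i|) * y ^ n := by
  rw [eval_eq_sum_range' (Nat.lt_succ_of_le hP), sum_mul]
  refine (abs_sum_le_sum_abs _ _).trans (sum_le_sum fun i hi => ?_)
  rw [abs_mul, abs_pow]
  gcongr
  calc |x| ^ i ≤ y ^ i := by gcongr
    _ ≤ y ^ n := by
      exact pow_le_pow_right₀ hy (Nat.lt_succ_iff.1 (mem_range.1 hi))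

theorem exists_abs_coeff_comp_linear_le (h : ℤ[X]) : ∃ C₀ : ℕ, ∀ r d : ℕ, r < d → ∀ j,
    |(h.comp (C (r : ℤ) + C (d : ℤ) * X)).coeff j| ≤ C₀ * d ^ h.natDegree := by
  set S : ℕ → ℤ := fun j => ∑ i ∈ range (h.natDegree - j + 1), |(hasseDeriv j h).coeff i| with hS
  have hS0 : ∀ j, 0 ≤ S j := fun j => sum_nonneg fun _ _ => abs_nonneg _
  refine ⟨(∑ j ∈ range (h.natDegree + 1), S j).toNat, fun r d hrd j => ?_⟩
  have hd : (1 : ℤ) ≤ d := by exact_mod_cast (by omega)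
  rw [Int.toNat_of_nonneg (sum_nonneg fun j _ => hS0 j)]
  have hcomp : h.comp (C (r : ℤ) + C (d : ℤ) * X) = (taylor (r : ℤ) h).comp (C (d : ℤ) * X) := by
    rw [taylor_apply, comp_assoc]
    congr 1
    simp [add_comm]
  rw [hcomp, comp_C_mul_X_coeff, taylor_coeff, abs_mul, abs_pow, Nat.abs_cast]
  rcases le_or_gt j h.natDegree with hj | hj
  · have h1 := abs_eval_le_of_le (natDegree_hasseDeriv_le h j) (x := r) (y := d)
      (by rw [Nat.abs_cast]; exact_mod_cast hrd.le) hd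
    calc _ ≤ S j * (d : ℤ) ^ (h.natDegree - j) * d ^ j := by gcongr
      _ = S j * d ^ h.natDegree := by rw [mul_assoc, ← pow_add, Nat.sub_add_cancel hj]
      _ ≤ _ := by
        gcongr
        exact single_le_sum (fun j _ => hS0 j) (mem_range.2 (by omega))
  · rw [hasseDeriv_eq_zero_of_lt_natDegree _ _ hj]
    simp only [eval_zero, abs_zero, zero_mul]
    exact mul_nonneg (sum_nonneg fun j _ => hS0 j) (by positivity)

/-- For an intersective polynomial `h`, the values of `h` divisible by a power `g^K` along a suitable
progression give a polynomial whose nonconstant content is bounded independently of `g`. -/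
theorem exists_auxiliary_polynomial {h : ℤ[X]} (hh : Intersective h) :
    ∃ (Γ C₀ : ℕ), 1 ≤ Γ ∧ ∀ K : ℕ, (∀ m, 1 ≤ m → m ≤ h.natDegree → m ∣ K) → ∀ g : ℕ, 1 ≤ g →
      ∃ H : ℤ[X], H.natDegree = h.natDegree ∧ ContentDvd H Γ ∧
        (∀ j, |H.coeff j| ≤ C₀ * |H.leadingCoeff|) ∧
        |H.leadingCoeff| ≤ C₀ * (g : ℤ) ^ (K * h.natDegree) ∧
        ∀ x : ℕ, 1 ≤ x → ∃ n : ℕ, 1 ≤ n ∧ h.eval (n : ℤ) = (g : ℤ) ^ K * H.eval (x : ℤ) := by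
  classical
  obtain ⟨Γ, hΓ, hcof⟩ := exists_cofactor_dvd hh.1
  obtain ⟨C₀, hC₀⟩ := exists_abs_coeff_comp_linear_le h
  refine ⟨Γ, C₀ + h.leadingCoeff.natAbs, hΓ, fun K hK g hg => ?_⟩
  choose z m u hz hm1 hmk hfac hu using fun (p : ℕ) (hp : Fact p.Prime) =>
    exists_padic_factorization hh p
  set m' : ℕ → ℕ := fun p => if hp : p.Prime then m p ⟨hp⟩ else 1 with hm'
  set c : ℕ → ℕ := fun p => K * g.factorization p / m' p with hc
  set d := auxModulus K g m' with hd
  have hd0 : 0 < d := auxModulus_pos _ _ _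
  obtain ⟨r₀, hr₀⟩ := Nat.chineseRemainderOfFinset
    (fun p => if hp : p.Prime then haveI := Fact.mk hp; (z p ⟨hp⟩).appr (c p) else 0)
    (fun p => p ^ c p) g.primeFactors
    (fun p hp => pow_ne_zero _ (Nat.prime_of_mem_primeFactors hp).ne_zero)
    (fun p hp q hq hpq => Nat.Coprime.pow _ _ ((Nat.coprime_primes (Nat.prime_of_mem_primeFactors hp)
      (Nat.prime_of_mem_primeFactors hq)).2 hpq))
  set r := r₀ % d with hr
  have hloc : ∀ (p : ℕ) (hp : Fact p.Prime), c p * m p hp = K * g.factorization p ∧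
      ∃ (t w g' : ℤ_[p]), IsUnit w ∧
      (r : ℤ_[p]) = z p hp + p ^ c p * t ∧ (d : ℤ_[p]) = p ^ c p * w ∧
        ((g ^ K : ℕ) : ℤ_[p]) = p ^ (c p * m p hp) * g' := by
    intro p hp
    have hm'p : m' p = m p hp := by rw [hm']; simp [hp.out]
    obtain ⟨w, hw, hdw⟩ := auxModulus_eq K g m' hp.out
    have hcm : c p * m p hp = K * g.factorization p := by
      rw [← hm'p, hc]
      refine Nat.div_mul_cancel (dvd_mul_of_dvd_left (hK _ ?_ ?_) _)
      · rw [hm'p]; exact hm1 p hp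
      · rw [hm'p]; exact hmk p hp
    have hrz : (p : ℤ_[p]) ^ c p ∣ (r : ℤ_[p]) - z p hp := by
      by_cases hpg : p ∈ g.primeFactors
      · have h1 := hr₀ p hpg
        simp only [hp.out, dif_pos] at h1
        have h2 : r ≡ r₀ [MOD p ^ c p] := (Nat.mod_modEq r₀ d).of_dvd (Dvd.intro w (hdw.symm.trans hd.symm))
        have h3 := (h2.trans h1).symm
        have h4 := (Nat.modEq_iff_dvd.1 h3)
        have h5 := map_dvd (Int.castRingHom ℤ_[p]) h4
        have h6 := Ideal.mem_span_singleton.1 (PadicInt.appr_spec (c p) (z p hp))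
        simp only [eq_intCast, Int.cast_natCast, Int.cast_sub, Nat.cast_pow, Int.cast_pow] at h5
        have h7 := dvd_sub h5 h6
        rwa [show ∀ a b e : ℤ_[p], a - b - (e - b) = a - e by intros; ring] at h7
      · have : g.factorization p = 0 := by
          rwa [← Finsupp.notMem_support_iff, Nat.support_factorization]
        simp [hc, this]
    obtain ⟨t, ht⟩ := hrz
    refine ⟨hcm, t, w, ((g ^ K / p ^ (K * g.factorization p) : ℕ) : ℤ_[p]), isUnit_natCast_padicInt hw,
      by rw [← ht]; ring, ?_, ?_⟩
    · rw [hd, hdw]; push_cast; rfl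
    · rw [hcm, ← Nat.cast_pow, ← Nat.cast_mul, Nat.mul_div_cancel']
      rw [mul_comm, pow_mul]
      exact pow_dvd_pow_of_dvd (Nat.ordProj_dvd g p) K
  set Q := h.comp (C (r : ℤ) + C (d : ℤ) * X) with hQ
  have hdvd : C ((g ^ K : ℕ) : ℤ) ∣ Q := by
    rw [C_dvd_iff_dvd_coeff]
    intro j
    rw [Int.natCast_dvd]
    refine (Nat.dvd_iff_prime_pow_dvd_dvd _ _).2 fun p s hp hs => ?_
    have := Fact.mk hp
    obtain ⟨hcm, t, w, g', hw, h1, h2, h3⟩ := hloc p ⟨hp⟩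
    rw [← Int.natCast_dvd]
    push_cast
    rw [← PadicInt.pow_p_dvd_int_iff]
    have h4 := congrArg (fun P => coeff P j) (padic_comp_linear (hfac p ⟨hp⟩) h1 h2)
    rw [coeff_map, coeff_C_mul, eq_intCast] at h4
    rw [hQ, h4, hcm]
    refine Dvd.dvd.mul_right (pow_dvd_pow _ ?_) _
    rwa [hp.pow_dvd_iff_le_factorization (pow_ne_zero K (by omega)), Nat.factorization_pow] at hs
  obtain ⟨H, hH⟩ := hdvd
  have hg0 : ((g ^ K : ℕ) : ℤ) ≠ 0 := by exact_mod_cast pow_ne_zero K (by omega)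
  have hlin : (C (r : ℤ) + C (d : ℤ) * X).natDegree = 1 := by
    rw [add_comm]; exact natDegree_linear (by exact_mod_cast hd0.ne')
  have hlinc : (C (r : ℤ) + C (d : ℤ) * X).leadingCoeff = (d : ℤ) := by
    rw [add_comm]; exact leadingCoeff_linear (by exact_mod_cast hd0.ne')
  have hdeg : H.natDegree = h.natDegree := by
    rw [← natDegree_C_mul hg0, ← hH, hQ, natDegree_comp, hlin, mul_one]
  have hlead : (g ^ K : ℕ) * H.leadingCoeff = h.leadingCoeff * d ^ h.natDegree := by
    have := congrArg leadingCoeff hH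
    rw [hQ, leadingCoeff_comp (by rw [hlin]; exact one_ne_zero), hlinc, leadingCoeff_mul,
      leadingCoeff_C] at this
    exact this.symm
  have hlead1 : 1 ≤ |h.leadingCoeff| := Int.one_le_abs (leadingCoeff_ne_zero.2 hh.1)
  have hgpos : (0 : ℤ) < (g ^ K : ℕ) := by positivity
  have hleadabs : ((g ^ K : ℕ) : ℤ) * |H.leadingCoeff| = |h.leadingCoeff| * d ^ h.natDegree := by
    have := congrArg abs hlead
    rwa [abs_mul, abs_mul, Nat.abs_cast, abs_pow, Nat.abs_cast] at this
  refine ⟨H, hdeg, ?_, ?_, ?_, ?_⟩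
  · intro n hn
    refine (Nat.dvd_iff_prime_pow_dvd_dvd _ _).2 fun p s hp hs => ?_
    have := Fact.mk hp
    obtain ⟨hcm, t, w, g', hw, h1, h2, h3⟩ := hloc p ⟨hp⟩
    have h4 := dvd_cofactor_of_dvd_coeff (hm1 p ⟨hp⟩) (hfac p ⟨hp⟩) h1 h2 hw h3 hH.symm (s := s)
      fun j hj => (by exact_mod_cast hs : (p : ℤ) ^ s ∣ (n : ℤ)).trans (hn j hj)
    have h5 := h4.trans (hcof p (z p ⟨hp⟩) (m p ⟨hp⟩) (u p ⟨hp⟩) (hz p ⟨hp⟩) (hfac p ⟨hp⟩) (hu p ⟨hp⟩))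
    rw [← Int.cast_natCast (R := ℤ_[p]) Γ, PadicInt.pow_p_dvd_int_iff] at h5
    exact_mod_cast h5
  · intro j
    have h1 := hC₀ r d (Nat.mod_lt _ hd0) j
    rw [← hQ, hH, coeff_C_mul, abs_mul, Nat.abs_cast] at h1
    refine le_of_mul_le_mul_left (h1.trans ?_) hgpos
    calc (C₀ : ℤ) * d ^ h.natDegree ≤ C₀ * (|h.leadingCoeff| * d ^ h.natDegree) := by
          gcongr
          exact le_mul_of_one_le_left (by positivity) hlead1
      _ = (g ^ K : ℕ) * (C₀ * |H.leadingCoeff|) := by rw [← hleadabs]; ring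
      _ ≤ _ := by
        gcongr
        linarith [abs_nonneg h.leadingCoeff]
  · calc |H.leadingCoeff| ≤ (g ^ K : ℕ) * |H.leadingCoeff| :=
          le_mul_of_one_le_left (abs_nonneg _) hgpos
      _ = |h.leadingCoeff| * d ^ h.natDegree := hleadabs
      _ ≤ |h.leadingCoeff| * ((g : ℤ) ^ K) ^ h.natDegree := by
        gcongr
        exact_mod_cast auxModulus_le (by omega) m'
      _ = |h.leadingCoeff| * (g : ℤ) ^ (K * h.natDegree) := by rw [pow_mul]
      _ ≤ _ := by
        gcongr
        push_cast
        linarith [(Nat.cast_nonneg C₀ : (0 : ℤ) ≤ C₀)]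
  · intro x hx
    refine ⟨r + d * x, by nlinarith, ?_⟩
    have := congrArg (eval (x : ℤ)) hH
    rw [hQ, eval_comp] at this
    simpa using this

theorem norm_sum_mul_sub_mean_mul_sum_le {F Φ : ℕ → ℂ} {q : ℕ} (hq : 1 ≤ q)
    (hF : Function.Periodic F q) (hF1 : ∀ x, ‖F x‖ ≤ 1) (hΦ1 : ∀ x, ‖Φ x‖ ≤ 1) {M : ℕ} {E : ℝ}
    (hE : 0 ≤ E) (hΦ : ∀ x y, y < q → x + y < M → ‖Φ (x + y) - Φ x‖ ≤ E) :
    ‖∑ x ∈ range M, F x * Φ x - (∑ s ∈ range q, F s) / q * ∑ x ∈ range M, Φ x‖ ≤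
      2 * q + 2 * E * M := by
  set G := (∑ s ∈ range q, F s) / q with hG
  have hq0 : (q : ℂ) ≠ 0 := by exact_mod_cast (by omega : q ≠ 0)
  have hG1 : ‖G‖ ≤ 1 := by
    rw [hG, norm_div, Complex.norm_natCast]
    refine div_le_one_of_le₀ ((norm_sum_le _ _).trans ?_) (by positivity)
    exact (sum_le_sum fun x _ => hF1 x).trans (by simp)
  set T := M / q with hT
  set ρ := M % q with hρ
  have hM : M = q * T + ρ := (Nat.div_add_mod M q).symm
  have hρq : ρ ≤ q := (Nat.mod_lt M (by omega)).le
  have hper : ∀ y s, F (q * y + s) = F s := fun y s => by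
    have := hF.nat_mul y s
    rw [← this]; congr 1; simp; ring
  have hmain : ∑ x ∈ range (q * T), F x * Φ x - G * ∑ x ∈ range (q * T), Φ x =
      ∑ s ∈ range q, ∑ y ∈ range T, (F s - G) * (Φ (q * y + s) - Φ (q * y)) := by
    have h0 : ∑ s ∈ range q, ∑ y ∈ range T, (F s - G) * Φ (q * y) = 0 := by
      simp only [← mul_sum]
      rw [← sum_mul, sum_sub_distrib, sum_const, card_range, nsmul_eq_mul, hG,
        mul_div_cancel₀ _ hq0, sub_self, zero_mul]
    have h1 : ∑ s ∈ range q, ∑ y ∈ range T, (F s - G) * (Φ (q * y + s) - Φ (q * y)) =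
        ∑ s ∈ range q, ∑ y ∈ range T, (F s - G) * Φ (q * y + s) -
          ∑ s ∈ range q, ∑ y ∈ range T, (F s - G) * Φ (q * y) := by
      simp only [mul_sub (F _ - G), sum_sub_distrib]
    rw [h1, h0, sub_zero]
    simp only [sum_sub_distrib, sum_range_mul_eq, hper, sub_mul, mul_sum]
  have hmainle : ‖∑ x ∈ range (q * T), F x * Φ x - G * ∑ x ∈ range (q * T), Φ x‖ ≤ 2 * E * M := by
    rw [hmain]
    calc _ ≤ ∑ s ∈ range q, ∑ y ∈ range T, 2 * E := by
          refine (norm_sum_le _ _).trans (sum_le_sum fun s hs => ?_)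
          refine (norm_sum_le _ _).trans (sum_le_sum fun y hy => ?_)
          rw [norm_mul]
          have h1 : ‖F s - G‖ ≤ 2 := (norm_sub_le _ _).trans (by linarith [hF1 s])
          have h2 := hΦ (q * y) s (mem_range.1 hs) (by
            have h3 := mem_range.1 hs
            have h4 : q * (y + 1) ≤ q * T := Nat.mul_le_mul_left _ (mem_range.1 hy)
            rw [mul_add] at h4
            omega)
          exact mul_le_mul h1 h2 (norm_nonneg _) (by norm_num)
      _ = 2 * E * (q * T : ℕ) := by simp; ring
      _ ≤ _ := by gcongr; omega
  have htail : ∀ f : ℕ → ℂ, (∀ x, ‖f x‖ ≤ 1) → ‖∑ x ∈ range ρ, f (q * T + x)‖ ≤ q := by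
    intro f hf
    refine (norm_sum_le _ _).trans ((sum_le_sum fun x _ => hf _).trans ?_)
    simpa using hρq
  have h1 := htail (fun x => F x * Φ x) fun x => by
    rw [norm_mul]; exact mul_le_one₀ (hF1 x) (norm_nonneg _) (hΦ1 x)
  have h2 := htail Φ hΦ1
  rw [hM, sum_range_add, sum_range_add]
  have h3 : ‖G * ∑ x ∈ range ρ, Φ (q * T + x)‖ ≤ q := by
    rw [norm_mul]
    calc _ ≤ 1 * ‖∑ x ∈ range ρ, Φ (q * T + x)‖ := by gcongr
      _ ≤ q := by rw [one_mul]; exact h2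
  rw [← hM]
  calc _ = ‖(∑ x ∈ range (q * T), F x * Φ x - G * ∑ x ∈ range (q * T), Φ x) +
        (∑ x ∈ range ρ, F (q * T + x) * Φ (q * T + x)) - G * ∑ x ∈ range ρ, Φ (q * T + x)‖ := by
        congr 1; ring
    _ ≤ _ := norm_sub_le_of_le (norm_add_le _ _) le_rfl
    _ ≤ 2 * E * M + q + q := by gcongr
    _ = _ := by ring

theorem sum_ex_mul_div_eq_ite {L : ℕ} (hL : L ≠ 0) (n : ℤ) :
    ∑ t ∈ range L, ex (n * (t / L : ℝ)) = if (L : ℤ) ∣ n then (L : ℂ) else 0 := by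
  have hconv : ∀ t : ℕ, (n : ℝ) * (t / L : ℝ) = ((n * t : ℤ) : ℝ) / L := fun t => by
    push_cast; ring
  simp only [hconv]
  split_ifs with h
  · have : ∀ t : ℕ, ex (((n * t : ℤ) : ℝ) / L) = 1 := fun t =>
      (ex_div_eq_one_iff hL).2 (h.mul_right _)
    simp only [this, sum_const, card_range, nsmul_eq_mul, mul_one]
  · exact sum_ex_mul_div_eq_zero hL h

/-- Parseval's identity on `ℤ/L` for functions supported on a set of diameter less than `L`. -/
theorem sum_norm_sq_fourier {L : ℕ} (hL : L ≠ 0) (S : Finset ℤ)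
    (hS : ∀ z ∈ S, ∀ w ∈ S, |z - w| < L) (F : ℤ → ℝ) :
    ∑ t ∈ range L, ‖∑ z ∈ S, (F z : ℂ) * ex (z * (t / L : ℝ))‖ ^ 2 = L * ∑ z ∈ S, F z ^ 2 := by
  have hsq : ∀ t : ℕ, ((‖∑ z ∈ S, (F z : ℂ) * ex (z * (t / L : ℝ))‖ ^ 2 : ℝ) : ℂ) =
      ∑ z ∈ S, ∑ w ∈ S, ((F z * F w : ℝ) : ℂ) * ex (((z - w : ℤ) : ℝ) * (t / L : ℝ)) := by
    intro t
    rw [Complex.ofReal_pow, ← Complex.mul_conj', map_sum, sum_mul_sum]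
    refine sum_congr rfl fun z _ => sum_congr rfl fun w _ => ?_
    rw [map_mul, Complex.conj_ofReal, ← ex_neg]
    rw [show (((z - w : ℤ) : ℝ) * (t / L : ℝ)) = z * (t / L : ℝ) + -(w * (t / L : ℝ)) by
      push_cast; ring, ex_add]
    push_cast
    ring
  have : ((∑ t ∈ range L, ‖∑ z ∈ S, (F z : ℂ) * ex (z * (t / L : ℝ))‖ ^ 2 : ℝ) : ℂ) =
      ((L * ∑ z ∈ S, F z ^ 2 : ℝ) : ℂ) := by
    rw [Complex.ofReal_sum]
    simp only [hsq]
    rw [sum_comm, Complex.ofReal_mul, Complex.ofReal_sum, mul_sum]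
    refine sum_congr rfl fun z hz => ?_
    rw [sum_comm, sum_eq_single_of_mem z hz]
    · rw [← mul_sum, sum_ex_mul_div_eq_ite hL]
      simp
      ring
    · intro w hw hwz
      rw [← mul_sum, sum_ex_mul_div_eq_ite hL, if_neg, mul_zero]
      intro h
      exact hwz (by have := Int.eq_zero_of_abs_lt_dvd h (hS z hz w hw); omega)
  exact_mod_cast this

/-- The normalised exponential sum of `H` over the points `1, …, M`. -/
noncomputable def weylMean (H : ℤ[X]) (M : ℕ) (θ : ℝ) : ℂ :=
  (∑ x ∈ range M, ex ((H.eval ((x : ℤ) + 1) : ℤ) * θ)) / M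

theorem norm_weylMean_le_one (H : ℤ[X]) (M : ℕ) (θ : ℝ) : ‖weylMean H M θ‖ ≤ 1 := by
  rw [weylMean, norm_div, Complex.norm_natCast]
  exact div_le_one_of_le₀ (norm_sum_ex_le _ _) (by positivity)

theorem abs_eval_sub_eval_le {H : ℤ[X]} {k : ℕ} {b : ℝ} (hk : H.natDegree ≤ k)
    (hb : ∀ j, |(H.coeff j : ℝ)| ≤ b) {u v M : ℤ} (hu : 0 ≤ u) (hv : 0 ≤ v) (huM : u ≤ M)
    (hvM : v ≤ M) (hM : 1 ≤ M) :
    |((H.eval u : ℤ) : ℝ) - (H.eval v : ℤ)| * M ≤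
      (k + 1) ^ 2 * b * |(u : ℝ) - v| * M ^ H.natDegree := by
  have hb0 : 0 ≤ b := (abs_nonneg _).trans (hb 0)
  have hM' : (1 : ℝ) ≤ M := by exact_mod_cast hM
  have hu' : |(u : ℝ)| ≤ M := by rw [abs_of_nonneg (by exact_mod_cast hu)]; exact_mod_cast huM
  have hv' : |(v : ℝ)| ≤ M := by rw [abs_of_nonneg (by exact_mod_cast hv)]; exact_mod_cast hvM
  have h1 : ((H.eval u : ℤ) : ℝ) - (H.eval v : ℤ) =
      ∑ j ∈ range (H.natDegree + 1), (H.coeff j : ℝ) * ((u : ℝ) ^ j - (v : ℝ) ^ j) := by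
    rw [eval_eq_sum_range, eval_eq_sum_range, ← Int.cast_sub, ← sum_sub_distrib]
    push_cast
    exact sum_congr rfl fun j _ => by ring
  rw [h1]
  calc _ ≤ (∑ j ∈ range (H.natDegree + 1), b * (|(u : ℝ) - v| * j * (M : ℝ) ^ (j - 1))) * M := by
        gcongr
        refine (abs_sum_le_sum_abs _ _).trans (sum_le_sum fun j _ => ?_)
        rw [abs_mul]
        refine mul_le_mul (hb j) ((abs_pow_sub_pow_le _ _ _).trans ?_) (abs_nonneg _) hb0
        gcongr
        exact max_le hu' hv'
    _ = ∑ j ∈ range (H.natDegree + 1), b * (|(u : ℝ) - v| * j * (M : ℝ) ^ j) := by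
        rw [sum_mul]
        refine sum_congr rfl fun j _ => ?_
        rcases j with _ | j
        · simp
        · rw [Nat.add_sub_cancel, pow_succ]; ring
    _ ≤ ∑ j ∈ range (H.natDegree + 1),
          b * (|(u : ℝ) - v| * (k + 1 : ℝ) * (M : ℝ) ^ H.natDegree) := by
        refine sum_le_sum fun j hj => ?_
        have hj' : j ≤ H.natDegree := Nat.lt_succ_iff.1 (mem_range.1 hj)
        have : (j : ℝ) ≤ k + 1 := by exact_mod_cast (hj'.trans hk).trans (Nat.le_succ k)
        gcongr
    _ = (H.natDegree + 1 : ℝ) * (b * (|(u : ℝ) - v| * (k + 1 : ℝ) * (M : ℝ) ^ H.natDegree)) := by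
        simp
    _ ≤ (k + 1 : ℝ) * (b * (|(u : ℝ) - v| * (k + 1 : ℝ) * (M : ℝ) ^ H.natDegree)) := by
        gcongr
    _ = _ := by ring

theorem norm_weylMean_sub_le {H : ℤ[X]} {k q M : ℕ} {a : ℤ} {b β θ T : ℝ}
    (hk : H.natDegree ≤ k) (hb : ∀ j, |(H.coeff j : ℝ)| ≤ b) (hq : 1 ≤ q) (hM : 1 ≤ M)
    (hT : b * M ^ H.natDegree * |β| ≤ T) (hθ : θ = a / q + β) :
    ‖weylMean H M θ - completeSum H a q * weylMean H M β‖ * M ≤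
      (2 + 14 * (k + 1) ^ 2 * T) * q := by
  have hb0 : 0 ≤ b := (abs_nonneg _).trans (hb 0)
  have hT0 : 0 ≤ T := le_trans (by positivity) hT
  have hM0 : (0 : ℝ) < M := by exact_mod_cast hM
  have hMc : (M : ℂ) ≠ 0 := by exact_mod_cast hM0.ne'
  have hqc : (q : ℂ) ≠ 0 := by exact_mod_cast (by omega : q ≠ 0)
  have hper := periodic_ex_eval (C a * H.comp (X + 1)) q
  have hev : ∀ x : ℕ, (C a * H.comp (X + 1)).eval (x : ℤ) = a * H.eval ((x : ℤ) + 1) := by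
    intro x; simp
  simp only [hev] at hper
  have hsum : (∑ s ∈ range q, ex (((a * H.eval ((s : ℤ) + 1) : ℤ) : ℝ) / q)) / q =
      completeSum H a q := by
    rw [completeSum]
    congr 1
    have h1 := sum_range_succ' (fun x : ℕ => ex (((a * H.eval (x : ℤ) : ℤ) : ℝ) / q)) q
    rw [sum_range_succ] at h1
    have h2 : ex (((a * H.eval (q : ℤ) : ℤ) : ℝ) / q) =
        ex (((a * H.eval ((0 : ℕ) : ℤ) : ℤ) : ℝ) / q) := by
      have h3 := periodic_ex_eval (C a * H) q 0
      simpa using h3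
    rw [h2] at h1
    have h4 := add_right_cancel h1
    push_cast at h4 ⊢
    simp only [eval_mul, eval_C, Int.cast_mul]
    exact h4.symm
  have key := norm_sum_mul_sub_mean_mul_sum_le (F := fun x : ℕ =>
      ex (((a * H.eval ((x : ℤ) + 1) : ℤ) : ℝ) / q))
    (Φ := fun x : ℕ => ex ((H.eval ((x : ℤ) + 1) : ℤ) * β)) hq hper (fun x => (norm_ex _).le)
    (fun x => (norm_ex _).le) (M := M) (E := 7 * ((k + 1) ^ 2 * T * q / M)) (by positivity) ?_
  · have e1 : weylMean H M θ - completeSum H a q * weylMean H M β =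
        (∑ x ∈ range M, ex (((a * H.eval ((x : ℤ) + 1) : ℤ) : ℝ) / q) *
            ex ((H.eval ((x : ℤ) + 1) : ℤ) * β) -
          (∑ s ∈ range q, ex (((a * H.eval ((s : ℤ) + 1) : ℤ) : ℝ) / q)) / q *
            ∑ x ∈ range M, ex ((H.eval ((x : ℤ) + 1) : ℤ) * β)) / M := by
      rw [hsum, sub_div, weylMean, weylMean, mul_div_assoc]
      congr 2
      refine sum_congr rfl fun x _ => ?_
      rw [← ex_add, hθ]
      congr 1
      push_cast
      ring
    rw [e1, norm_div, Complex.norm_natCast, div_mul_cancel₀ _ hM0.ne']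
    refine key.trans (le_of_eq ?_)
    field_simp
    ring
  · intro x y hy hxy
    refine (norm_ex_sub_ex_le _ _).trans ?_
    gcongr
    rw [← sub_mul, abs_mul, le_div_iff₀ hM0]
    have h5 := abs_eval_sub_eval_le hk hb (u := ((x + y : ℕ) : ℤ) + 1) (v := (x : ℤ) + 1)
      (M := M) (by positivity) (by positivity) (by omega) (by omega) (by omega)
    have h6 : |((((x + y : ℕ) : ℤ) + 1 : ℤ) : ℝ) - ((x : ℤ) + 1 : ℤ)| ≤ q := by
      push_cast
      rw [show (x : ℝ) + y + 1 - (x + 1) = y by ring, abs_of_nonneg (by positivity)]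
      exact_mod_cast hy.le
    calc _ = |((H.eval (((x + y : ℕ) : ℤ) + 1) : ℤ) : ℝ) - (H.eval ((x : ℤ) + 1) : ℤ)| *
          (M : ℤ) * |β| := by push_cast; ring
      _ ≤ ((k + 1) ^ 2 * b * q * M ^ H.natDegree) * |β| := by
          refine mul_le_mul_of_nonneg_right (h5.trans ?_) (abs_nonneg _)
          push_cast at h6 ⊢
          gcongr
      _ = (k + 1) ^ 2 * (b * M ^ H.natDegree * |β|) * q := by ring
      _ ≤ _ := by gcongr

theorem mul_pow_mono {R : ℝ} (hR : 1 ≤ R) {m n : ℕ} (h : m ≤ n) :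
    (m : ℝ) * R ^ m ≤ n * R ^ n := by
  have : (m : ℝ) ≤ n := by exact_mod_cast h
  have := pow_le_pow_right₀ hR h
  gcongr

theorem exists_rat_approx_of_large_weylMean (k : ℕ) : ∃ K : ℕ, ∀ (R N : ℝ) (H : ℤ[X]) (M : ℕ)
    (θ : ℝ), 1 ≤ R → 1 ≤ M → 1 ≤ H.natDegree → H.natDegree ≤ k →
    N ≤ R * (|(H.leadingCoeff : ℝ)| * M ^ H.natDegree) → 1 ≤ R * ‖weylMean H M θ‖ →
    ∃ (q : ℕ) (a : ℤ), 1 ≤ q ∧ IsCoprime a (q : ℤ) ∧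
      (q : ℝ) ≤ K * R ^ K * |(H.leadingCoeff : ℝ)| ∧ |θ - a / q| * N ≤ K * R ^ K := by
  choose c hc using inverse_weyl
  set K := ∑ i ∈ range k, (c i + 1) with hK
  refine ⟨K, fun R N H M θ hR hM hd1 hdk hN hS => ?_⟩
  obtain ⟨d, hd⟩ : ∃ d, H.natDegree = d + 1 := ⟨H.natDegree - 1, by omega⟩
  have hcK : c d + 1 ≤ K := by
    rw [hK]
    exact single_le_sum (f := fun i => c i + 1) (fun i _ => Nat.zero_le _)
      (mem_range.2 (by omega : d < k))
  have hM0 : (0 : ℝ) < M := by exact_mod_cast hM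
  set b := H.leadingCoeff with hb
  have hb0 : b ≠ 0 := by
    rw [hb, Ne, leadingCoeff_eq_zero]
    rintro rfl
    simp at hd1
  set g : ℝ[X] := C θ * (H.comp (X + 1)).map (Int.castRingHom ℝ) with hg
  have hcompd : (H.comp (X + 1 : ℤ[X])).natDegree = d + 1 := by
    rw [natDegree_comp, show (X + 1 : ℤ[X]) = X + C 1 by simp, natDegree_X_add_C, hd, mul_one]
  have hgd : g.natDegree ≤ d + 1 :=
    (natDegree_C_mul_le _ _).trans (natDegree_map_le.trans hcompd.le)
  have hcoef : g.coeff (d + 1) = θ * b := by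
    rw [hg, coeff_C_mul, coeff_map, ← hcompd, coeff_natDegree]
    rw [show (X + 1 : ℤ[X]) = X + C 1 by simp, leadingCoeff_comp (by rw [natDegree_X_add_C]; simp),
      leadingCoeff_X_add_C, one_pow, mul_one]
    simp [hb]
  have hev : ∀ x : ℕ, g.eval (x : ℝ) = ((H.eval ((x : ℤ) + 1) : ℤ) : ℝ) * θ := by
    intro x
    rw [hg, eval_mul, eval_C, mul_comm]
    congr 1
    simp
  obtain ⟨q₀, hq₀, hq₀le, a₀, ha₀⟩ := hc d R M g hR hM hgd (by
    simp only [hev]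
    rw [weylMean, norm_div, Complex.norm_natCast, ← mul_div_assoc, le_div_iff₀ hM0, one_mul] at hS
    exact hS)
  rw [hcoef] at ha₀
  have hbabs : (b.natAbs : ℝ) = |(b : ℝ)| := by
    rw [← Int.cast_abs, Int.abs_eq_natAbs]; simp
  have hs : ∃ a₁ : ℤ, |(((q₀ * b.natAbs : ℕ)) : ℝ) * θ - a₁| = |(q₀ : ℝ) * (θ * b) - a₀| := by
    rw [Nat.cast_mul, hbabs]
    rcases abs_choice (b : ℝ) with h | h
    · refine ⟨a₀, ?_⟩
      rw [h]
      congr 1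
      ring
    · refine ⟨-a₀, ?_⟩
      rw [← abs_neg]
      rw [h]
      congr 1
      push_cast
      ring
  obtain ⟨a₁, ha₁⟩ := hs
  set n := q₀ * b.natAbs with hn
  have hb1 : 1 ≤ b.natAbs := Int.natAbs_pos.2 hb0
  have hn1 : 1 ≤ n := Nat.mul_pos hq₀ hb1
  have hn0 : (0 : ℝ) < n := by exact_mod_cast hn1
  have hnb : |(b : ℝ)| ≤ n := by
    rw [← hbabs]; exact_mod_cast Nat.le_mul_of_pos_left _ hq₀
  set r : ℚ := (a₁ : ℚ) / ((n : ℤ) : ℚ) with hr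
  have hrc : (r.num : ℝ) / r.den = a₁ / n := by
    have : (r : ℝ) = a₁ / n := by rw [hr]; push_cast; ring
    rw [← this, Rat.cast_def]
  have hKpow : (c d : ℝ) * R ^ (c d) ≤ K * R ^ K := mul_pow_mono hR (by omega)
  refine ⟨r.den, r.num, r.den_pos, ?_, ?_, ?_⟩
  · exact Int.isCoprime_iff_gcd_eq_one.2 r.reduced
  · have h1 : (r.den : ℤ) ∣ (n : ℤ) := by
      rw [hr, ← Rat.divInt_eq_div]
      exact Rat.den_dvd a₁ n
    have h2 : r.den ≤ n := Nat.le_of_dvd hn1 (by exact_mod_cast h1)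
    calc (r.den : ℝ) ≤ n := by exact_mod_cast h2
      _ = q₀ * |(b : ℝ)| := by rw [hn, Nat.cast_mul, hbabs]
      _ ≤ _ := by gcongr; exact hq₀le.trans hKpow
  · rw [hrc]
    rw [← ha₁] at ha₀
    have h3 : |θ - a₁ / n| * n = |(n : ℝ) * θ - a₁| := by
      rw [← abs_of_pos hn0, ← abs_mul, abs_of_pos hn0]
      congr 1
      field_simp
    calc |θ - a₁ / n| * N ≤ |θ - a₁ / n| * (R * (|(b : ℝ)| * M ^ H.natDegree)) := by gcongr
      _ ≤ |θ - a₁ / n| * (R * (n * M ^ H.natDegree)) := by gcongr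
      _ = R * (|(n : ℝ) * θ - a₁| * M ^ (d + 1)) := by rw [← h3, hd]; ring
      _ ≤ R * (c d * R ^ c d) := by gcongr
      _ = c d * R ^ (c d + 1) := by ring
      _ ≤ ((c d + 1 : ℕ) : ℝ) * R ^ (c d + 1) := by gcongr; simp
      _ ≤ _ := mul_pow_mono hR hcK

theorem mul_pow_le_mul_pow_of_le {R x : ℝ} (hR : 1 ≤ R) {m n : ℕ} (hx : x ≤ n) (h : m ≤ n) :
    x * R ^ m ≤ n * R ^ n := by
  have := pow_le_pow_right₀ hR h
  gcongr

theorem prod_three_le {x g : Fin 3 → ℝ} {e : ℝ} (hx0 : ∀ i, 0 ≤ x i) (hx1 : ∀ i, x i ≤ 1)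
    (hg0 : ∀ i, 0 ≤ g i) (hg1 : ∀ i, g i ≤ 1) (he : ∀ i, x i ≤ g i + e) (he0 : 0 ≤ e) :
    ∏ i, x i ≤ ∏ i, g i + 3 * e := by
  simp only [Fin.prod_univ_three]
  have h1 : x 0 * x 1 * x 2 ≤ x 0 * x 1 * g 2 + e := by
    have := mul_le_mul_of_nonneg_left (he 2) (mul_nonneg (hx0 0) (hx0 1))
    have h3 : x 0 * x 1 ≤ 1 := mul_le_one₀ (hx1 0) (hx0 1) (hx1 1)
    nlinarith
  have h2 : x 0 * x 1 * g 2 ≤ x 0 * g 1 * g 2 + e := by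
    have := mul_le_mul_of_nonneg_left (he 1) (mul_nonneg (hx0 0) (hg0 2))
    have h3 : x 0 * g 2 ≤ 1 := mul_le_one₀ (hx1 0) (hg0 2) (hg1 2)
    nlinarith
  have h3 : x 0 * g 1 * g 2 ≤ g 0 * g 1 * g 2 + e := by
    have := mul_le_mul_of_nonneg_left (he 0) (mul_nonneg (hg0 1) (hg0 2))
    have h3 : g 1 * g 2 ≤ 1 := mul_le_one₀ (hg1 1) (hg0 2) (hg1 2)
    nlinarith
  linarith

theorem exists_pointwise_bound (k Γ C₀ : ℕ) (hΓ : 1 ≤ Γ) : ∃ (v : ℕ → ℝ) (W : ℝ) (K : ℕ),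
    (∀ q, 0 ≤ v q) ∧ 1 ≤ W ∧ (∀ Y : ℕ, ∑ q ∈ Icc 1 Y, v q ≤ W) ∧ 1 ≤ K ∧
    ∀ (R B N : ℝ) (H : Fin 3 → ℤ[X]) (M : Fin 3 → ℕ) (θ : ℝ), 1 ≤ R → 1 ≤ B →
      (∀ i, 1 ≤ (H i).natDegree) → (∀ i, (H i).natDegree ≤ k) → (∀ i, ContentDvd (H i) Γ) →
      (∀ i j, |((H i).coeff j : ℝ)| ≤ C₀ * |((H i).leadingCoeff : ℝ)|) →
      (∀ i, |((H i).leadingCoeff : ℝ)| ≤ B) →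
      (∀ i, N ≤ R * (|((H i).leadingCoeff : ℝ)| * M i ^ (H i).natDegree)) →
      (∀ i, |((H i).leadingCoeff : ℝ)| * M i ^ (H i).natDegree ≤ N) →
      (∀ i, K * R ^ K * B ≤ M i) →
      ∏ i, ‖weylMean (H i) (M i) θ‖ ≤ 1 / R ∨
      ∃ (q : ℕ) (a : ℤ), 1 ≤ q ∧ (q : ℝ) ≤ K * R ^ K ∧ |θ - a / q| * N ≤ K * R ^ K ∧
        ∏ i, ‖weylMean (H i) (M i) θ‖ ≤ v q + 1 / R := by
  obtain ⟨v, W, hv0, hvW, hv⟩ := exists_majorant_completeSum k Γ hΓ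
  obtain ⟨c, hc⟩ := exists_rat_approx_of_large_weylMean k
  obtain ⟨m, hm⟩ := modulus_le_of_large_completeSum k Γ hΓ
  set E : ℕ := 2 + 14 * (k + 1) ^ 2 * C₀ with hE
  set K : ℕ := 4 * E * (c + 1) ^ 2 + (2 * c + 1) + m * 2 ^ m + m + 1 with hK
  refine ⟨v, max W 1, K, hv0, le_max_right _ _, fun Y => (hvW Y).trans (le_max_left _ _),
    by omega, fun R B N H M θ hR hB hd1 hdk hcont hcoef hlead hN1 hN2 hM => ?_⟩
  have hR0 : 0 < R := by linarith
  have hKR : (1 : ℝ) ≤ K * R ^ K := by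
    have : (1 : ℝ) ≤ K := by exact_mod_cast (by omega : 1 ≤ K)
    exact one_le_mul_of_one_le_of_one_le this (one_le_pow₀ hR)
  have hMr : ∀ i, (1 : ℝ) ≤ M i := fun i =>
    (one_le_mul_of_one_le_of_one_le hKR hB).trans (hM i)
  have hM1 : ∀ i, 1 ≤ M i := fun i => by exact_mod_cast hMr i
  by_cases hS : ‖weylMean (H 0) (M 0) θ‖ ≤ 1 / R
  · left
    rw [Fin.prod_univ_three]
    have h1 := norm_weylMean_le_one (H 1) (M 1) θ
    have h2 := norm_weylMean_le_one (H 2) (M 2) θ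
    calc _ ≤ 1 / R * 1 * 1 := by gcongr
      _ = _ := by ring
  right
  push Not at hS
  obtain ⟨q, a, hq, hcop, hqle, hβ⟩ := hc R N (H 0) (M 0) θ hR (hM1 0) (hd1 0) (hdk 0) (hN1 0)
    (by rw [div_lt_iff₀ hR0] at hS; linarith)
  have hqB : (q : ℝ) ≤ c * R ^ c * B := hqle.trans (by gcongr; exact hlead 0)
  have herr : ∀ i, ‖weylMean (H i) (M i) θ -
      completeSum (H i) a q * weylMean (H i) (M i) (θ - a / q)‖ ≤ 1 / (4 * R) := by
    intro i
    have h1 := norm_weylMean_sub_le (H := H i) (k := k) (q := q) (M := M i) (a := a)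
      (b := C₀ * |((H i).leadingCoeff : ℝ)|) (β := θ - a / q) (θ := θ) (T := C₀ * (c * R ^ c))
      (hdk i) (hcoef i) hq (hM1 i) (by
        calc _ = C₀ * (|θ - a / q| * (|((H i).leadingCoeff : ℝ)| * M i ^ (H i).natDegree)) := by
              ring
          _ ≤ C₀ * (|θ - a / q| * N) := by gcongr; exact hN2 i
          _ ≤ _ := by gcongr) (by ring)
    have h2 : (2 + 14 * ((k : ℝ) + 1) ^ 2 * (C₀ * (c * R ^ c))) ≤ E * (c + 1) * R ^ c := by
      have h3 : (1 : ℝ) ≤ R ^ c := one_le_pow₀ hR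
      have h4 : (1 : ℝ) ≤ (c + 1) * R ^ c :=
        one_le_mul_of_one_le_of_one_le (by simp) h3
      have h5 : (c : ℝ) * R ^ c ≤ (c + 1) * R ^ c := by gcongr; simp
      have h6 : (E : ℝ) = 2 + 14 * ((k : ℝ) + 1) ^ 2 * C₀ := by rw [hE]; push_cast; ring
      calc _ ≤ 2 * ((c + 1) * R ^ c) + 14 * ((k : ℝ) + 1) ^ 2 * (C₀ * ((c + 1) * R ^ c)) := by
            gcongr
            linarith
        _ = _ := by rw [h6]; ring
    have hMi : (0 : ℝ) < M i := by linarith [hMr i]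
    rw [le_div_iff₀ (by positivity)]
    refine le_of_mul_le_mul_right ?_ hMi
    calc _ = ‖weylMean (H i) (M i) θ -
          completeSum (H i) a q * weylMean (H i) (M i) (θ - a / q)‖ * M i * (4 * R) := by ring
      _ ≤ (E * (c + 1) * R ^ c * (c * R ^ c * B)) * (4 * R) := by
          exact mul_le_mul_of_nonneg_right (h1.trans (by gcongr)) (by positivity)
      _ ≤ (E * (c + 1) * R ^ c * ((c + 1) * R ^ c * B)) * (4 * R) := by gcongr; simp
      _ = ((4 * E * (c + 1) ^ 2 : ℕ) : ℝ) * R ^ (2 * c + 1) * B := by push_cast; ring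
      _ ≤ K * R ^ K * B := by
          gcongr ?_ * B
          exact mul_pow_le_mul_pow_of_le hR (by exact_mod_cast (by omega)) (by omega)
      _ ≤ 1 * M i := by rw [one_mul]; exact hM i
  have he : ∀ i, ‖weylMean (H i) (M i) θ‖ ≤ ‖completeSum (H i) a q‖ + 1 / (4 * R) := by
    intro i
    have h1 := norm_le_norm_add_norm_sub' (weylMean (H i) (M i) θ)
      (completeSum (H i) a q * weylMean (H i) (M i) (θ - a / q))
    have h2 : ‖completeSum (H i) a q * weylMean (H i) (M i) (θ - a / q)‖ ≤
        ‖completeSum (H i) a q‖ := by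
      rw [norm_mul]
      exact mul_le_of_le_one_right (norm_nonneg _) (norm_weylMean_le_one _ _ _)
    linarith [herr i]
  have hcmono : (c : ℝ) * R ^ c ≤ K * R ^ K := mul_pow_mono hR (by omega)
  refine ⟨q, a, hq, ?_, hβ.trans hcmono, ?_⟩
  · have h1 : 1 ≤ (2 * R) * ‖completeSum (H 0) a q‖ := by
      have h2 := he 0
      have h3 : 1 / R = 2 * (1 / (2 * R)) := by field_simp
      have h4 : 1 / (4 * R) ≤ 1 / (2 * R) := by gcongr; norm_num
      have h5 : 1 / (2 * R) ≤ ‖completeSum (H 0) a q‖ := by linarith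
      rwa [div_le_iff₀' (by positivity)] at h5
    calc (q : ℝ) ≤ m * (2 * R) ^ m := hm (2 * R) q a (H 0) (by linarith) hq hcop (hdk 0) (hcont 0) h1
      _ = ((m * 2 ^ m : ℕ) : ℝ) * R ^ m := by push_cast; rw [mul_pow]; ring
      _ ≤ K * R ^ K := mul_pow_le_mul_pow_of_le hR (by exact_mod_cast (by omega)) (by omega)
  · have h1 := prod_three_le (x := fun i => ‖weylMean (H i) (M i) θ‖)
      (g := fun i => ‖completeSum (H i) a q‖) (fun i => norm_nonneg _)
      (fun i => norm_weylMean_le_one _ _ _) (fun i => norm_nonneg _)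
      (fun i => norm_completeSum_le_one _ _ _) he (by positivity)
    have h2 := hv q a H hq hcop hdk hcont
    have h3 : 3 * (1 / (4 * R)) ≤ 1 / R := by
      have : 3 * (1 / (4 * R)) = 3 / 4 * (1 / R) := by field_simp
      have : 0 < 1 / R := by positivity
      linarith
    linarith

/-- The indicator function of `A` minus `δ`. -/
noncomputable def balanced (A : Finset ℤ) (δ : ℝ) (z : ℤ) : ℝ := (if z ∈ A then 1 else 0) - δ

/-- The Fourier transform of the balanced function of `A` on `{1, …, N}`. -/
noncomputable def balancedHat (A : Finset ℤ) (δ : ℝ) (N : ℕ) (θ : ℝ) : ℂ :=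
  ∑ z ∈ Icc 1 (N : ℤ), (balanced A δ z : ℂ) * ex (z * θ)

theorem card_sub_abs_le {A : Finset ℤ} {N : ℕ} (hA : A ⊆ Icc 1 (N : ℤ)) (D : ℤ) :
    (#A : ℤ) - |D| ≤ #{a ∈ A | a - D ∈ Icc 1 (N : ℤ)} := by
  have h1 := card_filter_add_card_filter_not (s := A) (fun a => a - D ∈ Icc 1 (N : ℤ))
  have h2 : #{a ∈ A | ¬ a - D ∈ Icc 1 (N : ℤ)} ≤ #(Icc 1 D ∪ Ioc (N + D) (N : ℤ)) := by
    refine card_le_card fun a ha => ?_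
    rw [mem_filter] at ha
    have h3 := mem_Icc.1 (hA ha.1)
    have h4 := ha.2
    simp only [mem_Icc, not_and_or, not_le, mem_union, mem_Ioc] at h4 ⊢
    omega
  have h3 := h2.trans (card_union_le _ _)
  rw [Int.card_Icc, Int.card_Ioc] at h3
  rcases abs_cases D with ⟨h, _⟩ | ⟨h, _⟩ <;> rw [h] <;> omega

theorem sum_balanced_mul_le {A : Finset ℤ} {N : ℕ} {δ : ℝ} (hδ : 0 ≤ δ)
    (hA : A ⊆ Icc 1 (N : ℤ)) (D : ℤ) (hD : ∀ a ∈ A, ∀ a' ∈ A, a ≠ a' → a - a' ≠ D) :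
    ∑ z ∈ Icc 1 (N : ℤ), balanced A δ z *
        (if z - D ∈ Icc 1 (N : ℤ) then balanced A δ (z - D) else 0) ≤
      (if D = 0 then (#A : ℝ) else 0) - 2 * δ * (#A - |D|) + δ ^ 2 * N := by
  set I := Icc 1 (N : ℤ) with hI
  have hterm : ∀ z, balanced A δ z * (if z - D ∈ I then balanced A δ (z - D) else 0) =
      (if z ∈ A ∧ z - D ∈ A then (1 : ℝ) else 0) - δ * (if z ∈ A ∧ z - D ∈ I then 1 else 0) -
        δ * (if z - D ∈ A then 1 else 0) + δ ^ 2 * (if z - D ∈ I then 1 else 0) := by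
    intro z
    have hAI := @hA (z - D)
    clear_value I
    clear hI hA hD
    unfold balanced
    by_cases h1 : z ∈ A <;> by_cases h2 : z - D ∈ A <;> by_cases h3 : z - D ∈ I <;>
      simp_all <;> ring
  simp only [hterm, sum_add_distrib, sum_sub_distrib, ← mul_sum]
  have e1 : ∑ z ∈ I, (if z ∈ A ∧ z - D ∈ A then (1 : ℝ) else 0) ≤
      if D = 0 then (#A : ℝ) else 0 := by
    rw [sum_boole]
    split_ifs with h
    · refine Nat.cast_le.2 (card_le_card fun z hz => ((mem_filter.1 hz).2).1)
    · refine le_of_eq ?_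
      rw [Nat.cast_eq_zero, card_eq_zero, filter_eq_empty_iff]
      rintro z - ⟨h1, h2⟩
      exact hD z h1 _ h2 (by omega) (by ring)
  have e2 : (#A : ℝ) - |D| ≤ ∑ z ∈ I, (if z ∈ A ∧ z - D ∈ I then (1 : ℝ) else 0) := by
    have h1 := card_sub_abs_le hA D
    have h2 : #{a ∈ A | a - D ∈ I} ≤ #{z ∈ I | z ∈ A ∧ z - D ∈ I} := card_le_card fun a ha => by
      rw [mem_filter] at ha ⊢
      exact ⟨hA ha.1, ha⟩
    rw [sum_boole]
    have h3 : (#A : ℤ) - |D| ≤ (#{z ∈ I | z ∈ A ∧ z - D ∈ I} : ℤ) :=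
      h1.trans (by exact_mod_cast h2)
    exact_mod_cast h3
  have e3 : (#A : ℝ) - |D| ≤ ∑ z ∈ I, (if z - D ∈ A then (1 : ℝ) else 0) := by
    have h1 := card_sub_abs_le hA (-D)
    have h2 : #{a ∈ A | a - -D ∈ I} ≤ #{z ∈ I | z - D ∈ A} := by
      refine card_le_card_of_injOn (fun a => a + D) (fun a ha => ?_)
        (fun a _ b _ h => add_right_cancel h)
      simp only [coe_filter, Set.mem_ofPred_eq, sub_neg_eq_add, add_sub_cancel_right] at ha ⊢
      exact ha.symm
    rw [abs_neg] at h1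
    rw [sum_boole]
    have h3 : (#A : ℤ) - |D| ≤ (#{z ∈ I | z - D ∈ A} : ℤ) := h1.trans (by exact_mod_cast h2)
    exact_mod_cast h3
  have e4 : ∑ z ∈ I, (if z - D ∈ I then (1 : ℝ) else 0) ≤ N := by
    rw [sum_boole]
    calc _ ≤ ((#I : ℕ) : ℝ) := Nat.cast_le.2 (card_filter_le _ _)
      _ = N := by simp [hI]
  have := mul_le_mul_of_nonneg_left e2 hδ
  have := mul_le_mul_of_nonneg_left e3 hδ
  have := mul_le_mul_of_nonneg_left e4 (sq_nonneg δ)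
  linarith

theorem sum_norm_sq_balancedHat_mul {A : Finset ℤ} {N : ℕ} (hN : 1 ≤ N) {δ : ℝ} {D : ℤ}
    (hD : |D| ≤ N) :
    ∑ t ∈ range (2 * N), ((‖balancedHat A δ N (t / (2 * N : ℕ))‖ ^ 2 : ℝ) : ℂ) *
        ex (-(D * (t / (2 * N : ℕ) : ℝ))) =
      ((2 * N * ∑ z ∈ Icc 1 (N : ℤ), balanced A δ z *
        (if z - D ∈ Icc 1 (N : ℤ) then balanced A δ (z - D) else 0) : ℝ) : ℂ) := by
  set I := Icc 1 (N : ℤ) with hI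
  have hL : 2 * N ≠ 0 := by omega
  set L := 2 * N with hLdef
  have hsq : ∀ t : ℕ, ((‖balancedHat A δ N (t / L)‖ ^ 2 : ℝ) : ℂ) * ex (-(D * (t / L : ℝ))) =
      ∑ z ∈ I, ∑ w ∈ I, ((balanced A δ z * balanced A δ w : ℝ) : ℂ) *
        ex (((z - w - D : ℤ) : ℝ) * (t / L : ℝ)) := by
    intro t
    rw [balancedHat, Complex.ofReal_pow, ← Complex.mul_conj', map_sum, sum_mul_sum, sum_mul]
    refine sum_congr rfl fun z _ => ?_
    rw [sum_mul]
    refine sum_congr rfl fun w _ => ?_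
    rw [map_mul, Complex.conj_ofReal, ← ex_neg]
    rw [show (((z - w - D : ℤ) : ℝ) * (t / L : ℝ)) =
      z * (t / L : ℝ) + -(w * (t / L : ℝ)) + -(D * (t / L : ℝ)) by
      push_cast; ring, ex_add, ex_add]
    push_cast
    ring
  simp only [hsq]
  rw [sum_comm, Complex.ofReal_mul, Complex.ofReal_sum, mul_sum]
  refine sum_congr rfl fun z hz => ?_
  rw [sum_comm]
  have hcases : ∀ w ∈ I, ∑ t ∈ range L, ((balanced A δ z * balanced A δ w : ℝ) : ℂ) *
      ex (((z - w - D : ℤ) : ℝ) * (t / L : ℝ)) =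
      if w = z - D then ((balanced A δ z * balanced A δ w : ℝ) : ℂ) * L else 0 := by
    intro w hw
    rw [← mul_sum, sum_ex_mul_div_eq_ite hL]
    have hz' := mem_Icc.1 hz
    have hw' := mem_Icc.1 hw
    have hiff : ((L : ℤ) ∣ z - w - D) ↔ w = z - D := by
      constructor
      · intro h
        have h1 : |z - w - D| < L := by
          have := abs_le.1 hD
          rw [abs_lt, hLdef]
          push_cast
          omega
        have := Int.eq_zero_of_abs_lt_dvd h h1
        omega
      · rintro rfl
        simp
    simp only [hiff, mul_ite, mul_zero]
  rw [sum_congr rfl hcases, sum_ite_eq' I (z - D)]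
  split_ifs with h
  · rw [hLdef]; push_cast; ring
  · simp

theorem le_sum_norm_sq_balancedHat_mul {ι : Type*} {A : Finset ℤ} {N : ℕ} (hN : 1 ≤ N) {δ : ℝ}
    (hδ0 : 0 < δ) (hδ1 : δ ≤ 1) (hA : A ⊆ Icc 1 (N : ℤ)) (hAδ : (#A : ℝ) = δ * N)
    (X : Finset ι) (D : ι → ℤ) (hD : ∀ x ∈ X, ∀ a ∈ A, ∀ a' ∈ A, a ≠ a' → a - a' ≠ D x)
    (hDN : ∀ x ∈ X, (|D x| : ℝ) ≤ δ * N / 16) (hD0 : (#{x ∈ X | D x = 0} : ℝ) ≤ δ / 8 * #X) :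
    δ ^ 2 * N ^ 2 * #X ≤ ∑ t ∈ range (2 * N), ‖balancedHat A δ N (t / (2 * N : ℕ))‖ ^ 2 *
      ‖∑ x ∈ X, ex (D x * (t / (2 * N : ℕ) : ℝ))‖ := by
  have hN0 : (0 : ℝ) < N := by exact_mod_cast hN
  set c : ι → ℝ := fun x => ∑ z ∈ Icc 1 (N : ℤ), balanced A δ z *
    (if z - D x ∈ Icc 1 (N : ℤ) then balanced A δ (z - D x) else 0) with hc
  have hcle : ∀ x ∈ X, c x ≤ (if D x = 0 then δ * N else 0) - 7 / 8 * δ ^ 2 * N := by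
    intro x hx
    have h1 := sum_balanced_mul_le hδ0.le hA (D x) (hD x hx)
    rw [hAδ] at h1
    have h2 := mul_le_mul_of_nonneg_left (hDN x hx) hδ0.le
    push_cast at h1
    simp only [hc]
    nlinarith
  have hsum : ∑ x ∈ X, c x ≤ -(1 / 2 * δ ^ 2 * N * #X) := by
    have h1 := sum_le_sum hcle
    rw [sum_sub_distrib, sum_const, ← sum_filter, sum_const, nsmul_eq_mul, nsmul_eq_mul] at h1
    have h2 := mul_le_mul_of_nonneg_right hD0 (mul_pos hδ0 hN0).le
    have h3 : 0 ≤ δ ^ 2 * N * #X := by positivity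
    nlinarith
  have hkey : ((2 * N * ∑ x ∈ X, c x : ℝ) : ℂ) =
      ∑ t ∈ range (2 * N), ((‖balancedHat A δ N (t / (2 * N : ℕ))‖ ^ 2 : ℝ) : ℂ) *
        ∑ x ∈ X, ex (-(D x * (t / (2 * N : ℕ) : ℝ))) := by
    simp only [mul_sum]
    rw [sum_comm, Complex.ofReal_sum]
    refine sum_congr rfl fun x hx => ?_
    rw [sum_norm_sq_balancedHat_mul hN]
    have h1 : (|D x| : ℝ) ≤ N := (hDN x hx).trans (by nlinarith)
    exact_mod_cast h1
  have hnorm : |2 * N * ∑ x ∈ X, c x| ≤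
      ∑ t ∈ range (2 * N), ‖balancedHat A δ N (t / (2 * N : ℕ))‖ ^ 2 *
      ‖∑ x ∈ X, ex (D x * (t / (2 * N : ℕ) : ℝ))‖ := by
    rw [← Real.norm_eq_abs, ← Complex.norm_real, hkey]
    refine (norm_sum_le _ _).trans (le_of_eq (sum_congr rfl fun t _ => ?_))
    rw [norm_mul, Complex.norm_real, Real.norm_of_nonneg (sq_nonneg _)]
    congr 1
    simp only [ex_neg]
    rw [← map_sum, RCLike.norm_conj]
  refine le_trans ?_ hnorm
  refine le_trans ?_ (neg_le_abs _)
  nlinarith [mul_le_mul_of_nonneg_left hsum hN0.le]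

theorem sum_shift_eq {M : Type*} [AddCommMonoid M] {N d J : ℕ} {T : Finset ℤ}
    (hT : T ⊆ Icc 1 (N : ℤ)) {j : ℤ} (hj : j ∈ Icc 1 (J : ℤ)) (G : ℤ → M) :
    ∑ z ∈ Icc (1 - (d * J : ℤ)) N, (if z + d * j ∈ T then G (z + d * j) else 0) =
      ∑ w ∈ T, G w := by
  rw [← sum_filter]
  refine sum_nbij' (fun z => z + d * j) (fun w => w - d * j) ?_ ?_ ?_ ?_ ?_
  · intro z hz; exact (mem_filter.1 hz).2
  · intro w hw
    have h1 := mem_Icc.1 (hT hw)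
    have h2 := mem_Icc.1 hj
    have h3 : (d : ℤ) * j ≤ d * J := mul_le_mul_of_nonneg_left h2.2 (by positivity)
    have h4 : 0 ≤ (d : ℤ) * j := mul_nonneg (by positivity) (by omega)
    refine mem_filter.2 ⟨mem_Icc.2 ⟨by omega, by omega⟩, by simpa using hw⟩
  · intro z _; simp
  · intro w _; simp
  · intro z _; rfl

/-- The sum of the balanced function along the progression `z + d, z + 2d, …, z + Jd`. -/
noncomputable def progressionSum (A : Finset ℤ) (δ : ℝ) (N d J : ℕ) (z : ℤ) : ℝ :=
  ∑ j ∈ Icc 1 (J : ℤ), if z + d * j ∈ Icc 1 (N : ℤ) then balanced A δ (z + d * j) else 0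

theorem sum_progressionSum_mul_ex (A : Finset ℤ) (δ : ℝ) (N d J : ℕ) (θ : ℝ) :
    ∑ z ∈ Icc (1 - (d * J : ℤ)) N, (progressionSum A δ N d J z : ℂ) * ex (z * θ) =
      balancedHat A δ N θ * ∑ j ∈ Icc 1 (J : ℤ), ex (-((d * j : ℤ) * θ)) := by
  simp only [progressionSum, Complex.ofReal_sum, sum_mul, mul_sum]
  rw [sum_comm]
  refine sum_congr rfl fun j hj => ?_
  rw [balancedHat, sum_mul]
  rw [← sum_shift_eq (Subset.refl _) hj (d := d)]
  refine sum_congr rfl fun z _ => ?_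
  split_ifs
  · rw [mul_assoc, ← ex_add]
    congr 2
    push_cast
    ring
  · simp

theorem sum_norm_sq_balancedHat_mul_norm_sq (A : Finset ℤ) (δ : ℝ) {N d J : ℕ} (hN : 1 ≤ N)
    (hdJ : d * J ≤ N) :
    ∑ t ∈ range (2 * N), ‖balancedHat A δ N (t / (2 * N : ℕ))‖ ^ 2 *
        ‖∑ j ∈ Icc 1 (J : ℤ), ex ((d * j : ℤ) * (t / (2 * N : ℕ) : ℝ))‖ ^ 2 =
      2 * N * ∑ z ∈ Icc (1 - (d * J : ℤ)) N, progressionSum A δ N d J z ^ 2 := by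
  have h1 := sum_norm_sq_fourier (L := 2 * N) (by omega) (Icc (1 - (d * J : ℤ)) N) (by
    intro z hz w hw
    have hz' := mem_Icc.1 hz
    have hw' := mem_Icc.1 hw
    have : (d : ℤ) * J ≤ N := by exact_mod_cast hdJ
    rw [abs_lt]
    push_cast
    omega) (progressionSum A δ N d J)
  rw [Nat.cast_mul, Nat.cast_ofNat] at h1 ⊢
  rw [← h1]
  refine sum_congr rfl fun t _ => ?_
  rw [sum_progressionSum_mul_ex, norm_mul, mul_pow]
  congr 2
  simp only [ex_neg]
  rw [← map_sum, RCLike.norm_conj]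

theorem sum_norm_sq_balancedHat {A : Finset ℤ} {δ : ℝ} {N : ℕ} (hN : 1 ≤ N)
    (hA : A ⊆ Icc 1 (N : ℤ)) (hAδ : (#A : ℝ) = δ * N) :
    ∑ t ∈ range (2 * N), ‖balancedHat A δ N (t / (2 * N : ℕ))‖ ^ 2 ≤ 2 * N * (δ * N) := by
  have h1 := sum_norm_sq_fourier (L := 2 * N) (by omega) (Icc 1 (N : ℤ)) (by
    intro z hz w hw
    have hz' := mem_Icc.1 hz
    have hw' := mem_Icc.1 hw
    rw [abs_lt]
    push_cast
    omega) (balanced A δ)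
  rw [Nat.cast_mul, Nat.cast_ofNat] at h1 ⊢
  simp only [balancedHat]
  rw [h1]
  gcongr
  have hterm : ∀ z, balanced A δ z ^ 2 = (1 - 2 * δ) * (if z ∈ A then 1 else 0) + δ ^ 2 := by
    intro z
    unfold balanced
    split_ifs <;> ring
  simp only [hterm, sum_add_distrib, ← mul_sum]
  rw [sum_boole, filter_mem_eq_inter, inter_eq_right.2 hA, hAδ]
  simp
  nlinarith [mul_nonneg (sq_nonneg δ) (Nat.cast_nonneg (α := ℝ) N)]

/-- Without a density increment on progressions of difference `d` and length `J`, the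
progression sums of the balanced function are small in mean square. -/
theorem sum_sq_progressionSum_le {A : Finset ℤ} {δ ε : ℝ} {N d J : ℕ}
    (hA : A ⊆ Icc 1 (N : ℤ)) (hAδ : (#A : ℝ) = δ * N) (hδ : 0 ≤ δ) (hε1 : ε ≤ 1)
    (hinc : ∀ z : ℤ, (#{j ∈ Icc 1 (J : ℤ) | z + d * j ∈ A} : ℝ) ≤ (1 + ε) * δ * J) :
    ∑ z ∈ Icc (1 - (d * J : ℤ)) N, progressionSum A δ N d J z ^ 2 ≤
      J ^ 2 * δ ^ 2 * (ε * N + 8 * (d * J)) := by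
  set S := Icc (1 - (d * J : ℤ)) N with hS
  set I := Icc 1 (N : ℤ) with hI
  set a : ℤ → ℝ := fun z => ∑ j ∈ Icc 1 (J : ℤ), if z + d * j ∈ A then 1 else 0 with ha
  set b : ℤ → ℝ := fun z => ∑ j ∈ Icc 1 (J : ℤ), if z + d * j ∈ I then 1 else 0 with hb
  have ha' : ∀ z, a z ≤ (1 + ε) * δ * J := fun z => by
    simp only [ha]; rw [sum_boole]; exact hinc z
  have ha0 : ∀ z, 0 ≤ a z := fun z => sum_nonneg fun j _ => by positivity
  have hb0 : ∀ z, 0 ≤ b z := fun z => sum_nonneg fun j _ => by positivity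
  have hbJ : ∀ z, b z ≤ J := fun z => by
    simp only [hb]; rw [sum_boole]
    calc _ ≤ ((#(Icc 1 (J : ℤ)) : ℕ) : ℝ) := Nat.cast_le.2 (card_filter_le _ _)
      _ = J := by simp
  have hU : ∀ z, progressionSum A δ N d J z = a z - δ * b z := by
    intro z
    simp only [ha, hb, progressionSum, mul_sum, ← sum_sub_distrib]
    refine sum_congr rfl fun j _ => ?_
    have hAI := @hA (z + d * j)
    unfold balanced
    rw [← hI]
    by_cases h1 : z + d * j ∈ A
    · simp only [h1, hAI h1, if_true, mul_one]
    · by_cases h2 : z + d * j ∈ I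
      · simp only [h1, h2, if_true, if_false, mul_one]
      · simp only [h1, h2, if_false, mul_zero, sub_zero]
  have hsa : ∑ z ∈ S, a z = J * (δ * N) := by
    simp only [ha]
    rw [sum_comm, sum_congr rfl fun j hj => sum_shift_eq hA hj fun _ => (1 : ℝ)]
    simp [hAδ]
  have hsb : ∑ z ∈ S, b z = J * N := by
    simp only [hb]
    rw [sum_comm, sum_congr rfl fun j hj => sum_shift_eq (Subset.refl I) hj fun _ => (1 : ℝ)]
    simp [hI]
  have hedge : ∑ z ∈ S, a z * (J - b z) ≤ 2 * (d * J) * (2 * δ * J * J) := by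
    set E := Icc (1 - (d * J : ℤ)) (-d) ∪ Ioc (N - d * J : ℤ) N with hE
    have hz : ∀ z ∈ S, z ∉ E → a z * (J - b z) = 0 := by
      intro z hzS hzE
      have hbz : b z = J := by
        simp only [hb]
        rw [sum_congr rfl (g := fun _ => (1 : ℝ))]
        · simp
        · intro j hj
          rw [if_pos]
          have h2 := mem_Icc.1 hj
          have h3 : (d : ℤ) * j ≤ d * J := mul_le_mul_of_nonneg_left h2.2 (by positivity)
          have h4 : (d : ℤ) * 1 ≤ d * j := mul_le_mul_of_nonneg_left h2.1 (by positivity)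
          have h5 := mem_Icc.1 hzS
          simp only [hE, mem_union, mem_Icc, mem_Ioc, not_or, not_and_or, not_le, not_lt] at hzE
          rw [hI, mem_Icc]
          omega
      rw [hbz, sub_self, mul_zero]
    calc ∑ z ∈ S, a z * (J - b z) = ∑ z ∈ S with z ∈ E, a z * (J - b z) := by
          rw [sum_filter]
          refine sum_congr rfl fun z hzS => ?_
          split_ifs with h
          · rfl
          · exact hz z hzS h
      _ ≤ ∑ z ∈ S with z ∈ E, 2 * δ * J * J := by
          refine sum_le_sum fun z _ => ?_
          refine mul_le_mul ((ha' z).trans ?_) (by linarith [hb0 z]) (by linarith [hbJ z])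
            (by positivity)
          gcongr
          linarith
      _ = #{z ∈ S | z ∈ E} * (2 * δ * J * J) := by simp
      _ ≤ (2 * (d * J : ℕ) : ℕ) * (2 * δ * J * J) := by
          gcongr
          have h1 : #{z ∈ S | z ∈ E} ≤ #E := card_le_card fun z hz => (mem_filter.1 hz).2
          refine h1.trans ((card_union_le _ _).trans ?_)
          rw [Int.card_Icc, Int.card_Ioc]
          have : ((d * J : ℕ) : ℤ) = d * J := by push_cast; rfl
          omega
      _ = _ := by push_cast; ring
  have hterm : ∀ z, progressionSum A δ N d J z ^ 2 =
      a z * a z - 2 * δ * J * a z + 2 * δ * (a z * (J - b z)) + δ ^ 2 * (b z * b z) := by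
    intro z; rw [hU]; ring
  simp only [hterm, sum_add_distrib, sum_sub_distrib, ← mul_sum]
  have h1 : ∑ z ∈ S, a z * a z ≤ (1 + ε) * δ * J * (J * (δ * N)) := by
    rw [← hsa, mul_sum]
    exact sum_le_sum fun z _ => mul_le_mul_of_nonneg_right (ha' z) (ha0 z)
  have h2 : ∑ z ∈ S, b z * b z ≤ J * (J * N) := by
    rw [← hsb, mul_sum]
    exact sum_le_sum fun z _ => mul_le_mul_of_nonneg_right (hbJ z) (hb0 z)
  rw [hsa]
  have h3 := mul_le_mul_of_nonneg_left hedge hδ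
  have h4 := mul_le_mul_of_nonneg_left h2 (sq_nonneg δ)
  nlinarith

theorem exists_increment_of_fourier_bound {ι : Type*} {A : Finset ℤ} {N : ℕ} (hN : 1 ≤ N) {δ : ℝ}
    (hδ0 : 0 < δ) (hδ1 : δ ≤ 1) (hA : A ⊆ Icc 1 (N : ℤ)) (hAδ : (#A : ℝ) = δ * N)
    {X : Finset ι} (hX : X.Nonempty) {D : ι → ℤ}
    (hD : ∀ x ∈ X, ∀ a ∈ A, ∀ a' ∈ A, a ≠ a' → a - a' ≠ D x)
    (hDN : ∀ x ∈ X, (|D x| : ℝ) ≤ δ * N / 16) (hD0 : (#{x ∈ X | D x = 0} : ℝ) ≤ δ / 8 * #X)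
    {v : ℕ → ℝ} {W : ℝ} {Y J : ℕ} {d : ℕ → ℕ} (hv0 : ∀ q, 0 ≤ v q) (hW : 1 ≤ W)
    (hv : ∑ q ∈ Icc 1 Y, v q ≤ W) (hJ : 1 ≤ J)
    (hd : ∀ q ∈ Icc 1 Y, (512 * W * (d q * J) : ℝ) ≤ N)
    (hbound : ∀ θ : ℝ, ‖∑ x ∈ X, ex (D x * θ)‖ ≤ #X * (δ / 4 + ∑ q ∈ Icc 1 Y,
      2 * v q * (‖∑ j ∈ Icc 1 (J : ℤ), ex ((d q * j : ℤ) * θ)‖ ^ 2 / J ^ 2))) :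
    ∃ q ∈ Icc 1 Y, ∃ z : ℤ,
      (1 + 1 / (32 * W)) * δ * J < #{j ∈ Icc 1 (J : ℤ) | z + d q * j ∈ A} := by
  by_contra! hcon
  have hN0 : (0 : ℝ) < N := by exact_mod_cast hN
  have hJ0 : (0 : ℝ) < J := by exact_mod_cast hJ
  have hX0 : (0 : ℝ) < #X := by exact_mod_cast hX.card_pos
  have hW0 : 0 < W := by linarith
  have hT : ∀ q ∈ Icc 1 Y, ∑ t ∈ range (2 * N), ‖balancedHat A δ N (t / (2 * N : ℕ))‖ ^ 2 *
      (‖∑ j ∈ Icc 1 (J : ℤ), ex ((d q * j : ℤ) * (t / (2 * N : ℕ) : ℝ))‖ ^ 2 / J ^ 2) ≤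
      3 / 32 * δ ^ 2 * N ^ 2 / W := by
    intro q hq
    have h1 := hd q hq
    have hdJ : d q * J ≤ N := by
      have : (d q * J : ℝ) ≤ N := by
        refine le_trans ?_ h1
        refine le_mul_of_one_le_left (by positivity) (by linarith)
      exact_mod_cast this
    have h2 := sum_norm_sq_balancedHat_mul_norm_sq A δ hN hdJ
    have h3 := sum_sq_progressionSum_le (ε := 1 / (32 * W)) (d := d q) (J := J) hA hAδ hδ0.le
      (by rw [div_le_one (by positivity)]; linarith) (hcon q hq)
    simp only [mul_div_assoc' (_ ^ 2) (_ ^ 2)]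
    rw [← sum_div, h2, div_le_iff₀ (by positivity)]
    have h4 : (d q * J : ℝ) ≤ N / (512 * W) := by
      rw [le_div_iff₀ (by positivity)]; linarith
    calc _ ≤ 2 * N * (J ^ 2 * δ ^ 2 * (1 / (32 * W) * N + 8 * (N / (512 * W)))) := by
          refine mul_le_mul_of_nonneg_left (h3.trans ?_) (by positivity)
          gcongr
      _ = _ := by field_simp; ring
  have h1 := le_sum_norm_sq_balancedHat_mul hN hδ0 hδ1 hA hAδ X D hD hDN hD0
  have h2 : ∑ t ∈ range (2 * N), ‖balancedHat A δ N (t / (2 * N : ℕ))‖ ^ 2 *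
      ‖∑ x ∈ X, ex (D x * (t / (2 * N : ℕ) : ℝ))‖ ≤
      #X * (δ / 4 * (2 * N * (δ * N)) + 2 * (W * (3 / 32 * δ ^ 2 * N ^ 2 / W))) := by
    calc _ ≤ ∑ t ∈ range (2 * N), ‖balancedHat A δ N (t / (2 * N : ℕ))‖ ^ 2 *
          (#X * (δ / 4 + ∑ q ∈ Icc 1 Y, 2 * v q *
            (‖∑ j ∈ Icc 1 (J : ℤ), ex ((d q * j : ℤ) * (t / (2 * N : ℕ) : ℝ))‖ ^ 2 / J ^ 2))) := by
          gcongr with t _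
          exact hbound _
      _ = #X * (δ / 4 * ∑ t ∈ range (2 * N), ‖balancedHat A δ N (t / (2 * N : ℕ))‖ ^ 2 +
            2 * ∑ q ∈ Icc 1 Y, v q *
            ∑ t ∈ range (2 * N), ‖balancedHat A δ N (t / (2 * N : ℕ))‖ ^ 2 *
            (‖∑ j ∈ Icc 1 (J : ℤ), ex ((d q * j : ℤ) * (t / (2 * N : ℕ) : ℝ))‖ ^ 2 / J ^ 2)) := by
          simp only [mul_sum, mul_add, sum_add_distrib]
          congr 1
          · exact sum_congr rfl fun t _ => by ring
          · rw [sum_comm]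
            exact sum_congr rfl fun q _ => sum_congr rfl fun t _ => by ring
      _ ≤ _ := by
          gcongr
          · exact sum_norm_sq_balancedHat hN hA hAδ
          · calc _ ≤ ∑ q ∈ Icc 1 Y, v q * (3 / 32 * δ ^ 2 * N ^ 2 / W) :=
                sum_le_sum fun q hq => mul_le_mul_of_nonneg_left (hT q hq) (hv0 q)
              _ = (∑ q ∈ Icc 1 Y, v q) * (3 / 32 * δ ^ 2 * N ^ 2 / W) := by rw [sum_mul]
              _ ≤ _ := by gcongr
  have h3 := h1.trans h2
  rw [mul_div_cancel₀ _ hW0.ne'] at h3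
  have h4 : 0 < #X * (δ ^ 2 * (N : ℝ) ^ 2) := by positivity
  nlinarith

theorem exists_pow_le_lt {d k : ℕ} (hd : 1 ≤ d) (hdk : d ≤ k) {x : ℝ} (hx : 1 ≤ x) :
    ∃ M : ℕ, 1 ≤ M ∧ (M : ℝ) ^ d ≤ x ∧ x ≤ 2 ^ k * (M : ℝ) ^ d := by
  set p : ℕ → Prop := fun M => (M : ℝ) ^ d ≤ x
  have hbdd : ∀ M, p M → M ≤ ⌊x⌋₊ := by
    intro M hM
    refine Nat.le_floor (le_trans ?_ hM)
    rcases Nat.eq_zero_or_pos M with rfl | h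
    · simp
    · exact le_self_pow₀ (by exact_mod_cast h) (by omega)
  classical
  set M := Nat.findGreatest p ⌊x⌋₊ with hM
  have h1 : p 1 := by simpa [p] using hx
  have hMp : p M := Nat.findGreatest_spec (hbdd 1 h1) h1
  have hM1 : 1 ≤ M := Nat.le_findGreatest (hbdd 1 h1) h1
  refine ⟨M, hM1, hMp, ?_⟩
  have h2 : ¬ p (M + 1) := fun h => by
    have := Nat.le_findGreatest (hbdd _ h) h
    omega
  simp only [p, not_le] at h2
  refine h2.le.trans ?_
  have hM1' : (1 : ℝ) ≤ M := by exact_mod_cast hM1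
  calc ((M + 1 : ℕ) : ℝ) ^ d ≤ (2 * M) ^ d := by gcongr; push_cast; linarith
    _ = 2 ^ d * M ^ d := mul_pow _ _ _
    _ ≤ _ := by gcongr; norm_num

theorem half_le_norm_sq_sum_ex {q κ J : ℕ} {a : ℤ} {θ : ℝ} (hq : 1 ≤ q) (hκ : 1 ≤ κ) (hJ : 1 ≤ J)
    (h : (q : ℝ) ^ κ * J * |θ - a / q| ≤ 1 / 512) :
    1 / 2 ≤ ‖∑ j ∈ Icc 1 (J : ℤ), ex (((q ^ κ : ℕ) * j : ℤ) * θ)‖ ^ 2 / (J : ℝ) ^ 2 := by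
  have hJ0 : (0 : ℝ) < J := by exact_mod_cast hJ
  have hq0 : (q : ℝ) ≠ 0 := by exact_mod_cast (by omega : q ≠ 0)
  have h1 : ∀ j ∈ Icc 1 (J : ℤ), ‖ex (((q ^ κ : ℕ) * j : ℤ) * θ) - 1‖ ≤ 7 / 512 := by
    intro j hj
    have hj' := mem_Icc.1 hj
    obtain ⟨κ', rfl⟩ : ∃ κ', κ = κ' + 1 := ⟨κ - 1, by omega⟩
    have h2 : ((((q ^ (κ' + 1) : ℕ) * j : ℤ) : ℝ) * θ) =
        ((q : ℝ) ^ (κ' + 1) * j * (θ - a / q)) + ((q ^ κ' * j * a : ℤ) : ℝ) := by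
      push_cast
      field_simp
      ring
    rw [h2, ex_add_intCast]
    refine (norm_ex_sub_one_le _).trans ?_
    rw [abs_mul, abs_mul, abs_pow, Nat.abs_cast]
    have h3 : |(j : ℝ)| ≤ J := by
      rw [abs_of_nonneg (by exact_mod_cast (by omega : (0 : ℤ) ≤ j))]
      exact_mod_cast hj'.2
    have h4 : (q : ℝ) ^ (κ' + 1) * |(j : ℝ)| * |θ - a / q| ≤
        (q : ℝ) ^ (κ' + 1) * J * |θ - a / q| := by gcongr
    linarith
  have h5 : ‖∑ j ∈ Icc 1 (J : ℤ), ex (((q ^ κ : ℕ) * j : ℤ) * θ) - J‖ ≤ J * (7 / 512) := by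
    have h6 : ∑ j ∈ Icc 1 (J : ℤ), ex (((q ^ κ : ℕ) * j : ℤ) * θ) - J =
        ∑ j ∈ Icc 1 (J : ℤ), (ex (((q ^ κ : ℕ) * j : ℤ) * θ) - 1) := by
      rw [sum_sub_distrib]; simp
    rw [h6]
    refine (norm_sum_le _ _).trans ((sum_le_sum h1).trans ?_)
    simp
  have h7 := norm_le_norm_add_norm_sub (∑ j ∈ Icc 1 (J : ℤ), ex (((q ^ κ : ℕ) * j : ℤ) * θ))
    (J : ℂ)
  rw [Complex.norm_natCast] at h7
  have h8 : 3 / 4 * (J : ℝ) ≤ ‖∑ j ∈ Icc 1 (J : ℤ), ex (((q ^ κ : ℕ) * j : ℤ) * θ)‖ := by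
    linarith
  rw [le_div_iff₀ (by positivity)]
  nlinarith

theorem card_filter_eval_eq_le {H : ℤ[X]} (hH : 1 ≤ H.natDegree) (S : Finset ℕ) (c : ℤ) :
    #(S.filter fun x : ℕ => H.eval ((x : ℤ) + 1) = c) ≤ H.natDegree := by
  have hd : (H - C c).natDegree = H.natDegree := natDegree_sub_C
  have h0 : H - C c ≠ 0 := by
    intro h
    rw [h] at hd
    simp at hd
    omega
  calc #(S.filter fun x : ℕ => H.eval ((x : ℤ) + 1) = c) ≤ #(H - C c).roots.toFinset := by
        refine card_le_card_of_injOn (fun x => (x : ℤ) + 1) (fun x hx => ?_)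
          (fun x _ y _ h => by simpa using h)
        have hx' := (mem_filter.1 hx).2
        rw [mem_coe, Multiset.mem_toFinset, mem_roots h0]
        simp [hx', IsRoot]
    _ ≤ (H - C c).roots.card := Multiset.toFinset_card_le _
    _ ≤ H.natDegree := (card_roots' _).trans hd.le

theorem card_filter_sum_eq_zero_le {H : Fin 3 → ℤ[X]} (hH : 1 ≤ (H 0).natDegree) (M : Fin 3 → ℕ)
    (s : ℤ) :
    #{x ∈ Fintype.piFinset fun i => range (M i) | s + ∑ i, (H i).eval ((x i : ℤ) + 1) = 0} ≤
      (H 0).natDegree * (M 1 * M 2) := by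
  refine (card_le_mul_card_image_of_maps_to (f := fun x : Fin 3 → ℕ => (x 1, x 2))
    (t := range (M 1) ×ˢ range (M 2)) (fun x hx => ?_) (H 0).natDegree fun y _ => ?_).trans
    (by simp)
  · have := (mem_filter.1 hx).1
    rw [Fintype.mem_piFinset] at this
    exact mem_product.2 ⟨this 1, this 2⟩
  · refine le_trans ?_ (card_filter_eval_eq_le hH (range (M 0))
      (-s - (H 1).eval ((y.1 : ℤ) + 1) - (H 2).eval ((y.2 : ℤ) + 1)))
    refine card_le_card_of_injOn (fun x => x 0) (fun x hx => ?_) fun x hx z hz h => ?_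
    · have h1 := mem_filter.1 hx
      have h2 := mem_filter.1 h1.1
      have h3 := Fintype.mem_piFinset.1 h2.1 0
      have h4 := h2.2
      rw [Fin.sum_univ_three] at h4
      rw [← h1.2]
      exact mem_filter.2 ⟨h3, by dsimp only; linarith⟩
    · have h1 := (mem_filter.1 hx).2
      have h2 := (mem_filter.1 hz).2
      rw [← h2, Prod.mk.injEq] at h1
      funext i
      fin_cases i
      · exact h
      · exact h1.1
      · exact h1.2

theorem norm_sum_piFinset_ex (H : Fin 3 → ℤ[X]) {M : Fin 3 → ℕ} (hM : ∀ i, 1 ≤ M i) (s : ℤ)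
    (θ : ℝ) :
    ‖∑ x ∈ Fintype.piFinset fun i => range (M i),
        ex ((s + ∑ i, (H i).eval ((x i : ℤ) + 1) : ℤ) * θ)‖ =
      #(Fintype.piFinset fun i => range (M i)) * ∏ i, ‖weylMean (H i) (M i) θ‖ := by
  have h1 : ∑ x ∈ Fintype.piFinset fun i => range (M i),
      ex ((s + ∑ i, (H i).eval ((x i : ℤ) + 1) : ℤ) * θ) =
      ex (s * θ) * ∏ i, ∑ x ∈ range (M i), ex (((H i).eval ((x : ℤ) + 1) : ℤ) * θ) := by
    rw [prod_univ_sum, mul_sum]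
    refine sum_congr rfl fun x _ => ?_
    rw [Fin.prod_univ_three, Fin.sum_univ_three, ← ex_add, ← ex_add, ← ex_add]
    congr 1
    push_cast
    ring
  have h2 : ∀ i, ∑ x ∈ range (M i), ex (((H i).eval ((x : ℤ) + 1) : ℤ) * θ) =
      M i * weylMean (H i) (M i) θ := by
    intro i
    have : (M i : ℂ) ≠ 0 := by
      have := hM i
      exact_mod_cast (by omega : M i ≠ 0)
    rw [weylMean, mul_div_cancel₀ _ this]
  rw [h1, norm_mul, norm_ex, one_mul, norm_prod]
  simp only [h2, norm_mul, Complex.norm_natCast, prod_mul_distrib]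
  simp

theorem exists_increment_constant (k K κ c : ℕ) (W : ℝ) : ∃ C : ℕ, 1 ≤ C ∧ ∀ R B : ℝ, 1 ≤ R →
    1 ≤ B → K * (c * R) ^ K ≤ C * R ^ C ∧
      1024 * W * (K * (c * R) ^ K) ^ (κ + 1) ≤ C * R ^ C ∧
      2 * (c * R) * B * (8 * (k + 1) * (K * (c * R) ^ K) * B) ^ k ≤ C * R ^ C * B ^ C := by
  set p := K * c ^ K with hp
  set w := 1024 * ⌈W⌉₊ * p ^ (κ + 1) with hw
  set z := 2 * c * (8 * (k + 1) * p) ^ k with hz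
  set C := 1 + p + w + z + K + K * (κ + 1) + (1 + K * k) + (1 + k) with hC
  refine ⟨C, by omega, fun R B hR hB => ?_⟩
  have hP : (K : ℝ) * (c * R) ^ K = p * R ^ K := by rw [hp, mul_pow]; push_cast; ring
  rw [hP]
  refine ⟨mul_pow_le_mul_pow_of_le hR (by exact_mod_cast (by omega)) (by omega), ?_, ?_⟩
  · calc 1024 * W * (p * R ^ K) ^ (κ + 1) ≤ 1024 * ⌈W⌉₊ * (p * R ^ K) ^ (κ + 1) := by
          gcongr
          exact Nat.le_ceil W
      _ = w * R ^ (K * (κ + 1)) := by rw [hw, mul_pow, pow_mul]; push_cast; ring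
      _ ≤ _ := mul_pow_le_mul_pow_of_le hR (by exact_mod_cast (by omega)) (by omega)
  · calc 2 * (c * R) * B * (8 * (k + 1) * (p * R ^ K) * B) ^ k
        = z * R ^ (1 + K * k) * B ^ (1 + k) := by
          rw [show (8 * (k + 1) * (p * R ^ K) * B : ℝ) = 8 * (k + 1) * p * R ^ K * B by ring, hz,
            mul_pow, mul_pow, ← pow_mul]
          push_cast
          ring
      _ ≤ _ := by
          refine mul_le_mul (mul_pow_le_mul_pow_of_le hR (by exact_mod_cast (by omega)) (by omega))
            (pow_le_pow_right₀ hB (by omega)) (by positivity) (by positivity)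

theorem abs_eval_le_of_leadingCoeff {H : ℤ[X]} {k C₀ : ℕ} (hk : H.natDegree ≤ k)
    (hcoef : ∀ j, |(H.coeff j : ℝ)| ≤ C₀ * |(H.leadingCoeff : ℝ)|) {x M : ℕ} (hx : x ≤ M)
    (hM : 1 ≤ M) :
    |((H.eval (x : ℤ) : ℤ) : ℝ)| ≤
      (k + 1) * C₀ * (|(H.leadingCoeff : ℝ)| * (M : ℝ) ^ H.natDegree) := by
  have h1 := abs_eval_le_of_le (le_refl H.natDegree) (x := x) (y := M)
    (by rw [Nat.abs_cast]; exact_mod_cast hx) (by exact_mod_cast hM)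
  have h2 : |((H.eval (x : ℤ) : ℤ) : ℝ)| ≤
      (∑ i ∈ range (H.natDegree + 1), |(H.coeff i : ℝ)|) * (M : ℝ) ^ H.natDegree := by
    exact_mod_cast h1
  refine h2.trans ?_
  have h3 : ∑ i ∈ range (H.natDegree + 1), |(H.coeff i : ℝ)| ≤
      (k + 1) * (C₀ * |(H.leadingCoeff : ℝ)|) := by
    refine (sum_le_sum fun i _ => hcoef i).trans ?_
    rw [sum_const, card_range, nsmul_eq_mul]
    gcongr
    push_cast
    gcongr
  calc _ ≤ ((k + 1) * (C₀ * |(H.leadingCoeff : ℝ)|)) * (M : ℝ) ^ H.natDegree := by gcongr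
    _ = _ := by ring

set_option maxHeartbeats 2000000 in
/-- The density increment: a set `A ⊆ {1, …, N}` of density `δ` having no difference of distinct
elements of the form `s + H₀(x₀) + H₁(x₁) + H₂(x₂)` has larger density on a long arithmetic
progression whose difference is a small `κ`-th power. -/
theorem exists_density_increment (k Γ C₀ κ : ℕ) (hΓ : 1 ≤ Γ) (hκ : 1 ≤ κ) :
    ∃ (C : ℕ) (ε : ℝ), 1 ≤ C ∧ 0 < ε ∧ ∀ (N : ℕ) (δ B : ℝ) (H : Fin 3 → ℤ[X]) (s : ℤ)
      (A : Finset ℤ), 1 ≤ N → 0 < δ → δ ≤ 1 → 1 ≤ B → A ⊆ Icc 1 (N : ℤ) → (#A : ℝ) = δ * N →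
      (∀ i, 1 ≤ (H i).natDegree) → (∀ i, (H i).natDegree ≤ k) → (∀ i, ContentDvd (H i) Γ) →
      (∀ i j, |((H i).coeff j : ℝ)| ≤ C₀ * |((H i).leadingCoeff : ℝ)|) →
      (∀ i, |((H i).leadingCoeff : ℝ)| ≤ B) → |(s : ℝ)| ≤ B →
      (∀ a ∈ A, ∀ a' ∈ A, a ≠ a' → ∀ x : Fin 3 → ℕ, (∀ i, 1 ≤ x i) →
        a - a' ≠ s + ∑ i, (H i).eval (x i : ℤ)) →
      C * δ⁻¹ ^ C * B ^ C ≤ N →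
      ∃ (q J : ℕ) (z : ℤ), 1 ≤ q ∧ (q : ℝ) ≤ C * δ⁻¹ ^ C ∧ 1 ≤ J ∧ (N : ℝ) ≤ C * δ⁻¹ ^ C * J ∧
        (1 + ε) * δ * J ≤ #{j ∈ Icc 1 (J : ℤ) | z + (q ^ κ : ℕ) * j ∈ A} := by
  obtain ⟨v, W, K, hv0, hW, hvW, hK, hpt⟩ := exists_pointwise_bound k Γ C₀ hΓ
  set c₁ : ℕ := 64 * (k + 1) * (C₀ + 1) with hc₁
  set c : ℕ := 64 * 2 ^ k * c₁ with hc
  obtain ⟨C, hC1, hC⟩ := exists_increment_constant k K κ c W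
  refine ⟨C, 1 / (32 * W), hC1, by positivity, fun N δ B H s A hN hδ0 hδ1 hB hA hAδ hd1 hdk hcont
    hcoef hlead hs hav hNC => ?_⟩
  set R := δ⁻¹ with hR
  have hR1 : 1 ≤ R := one_le_inv₀ hδ0 |>.2 hδ1
  have hδR : δ * R = 1 := mul_inv_cancel₀ hδ0.ne'
  set R₁ := c * R with hR₁
  have hc₁1 : (1 : ℝ) ≤ c₁ := by
    have : 1 ≤ c₁ := Nat.mul_pos (by omega) (by omega)
    exact_mod_cast this
  have h2k : (1 : ℝ) ≤ 2 ^ k := one_le_pow₀ (by norm_num)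
  have hcr : (c : ℝ) = 64 * 2 ^ k * c₁ := by rw [hc]; push_cast; ring
  have hc64 : (64 : ℝ) ≤ c := by rw [hcr]; nlinarith
  have hR₁R : 64 * R ≤ R₁ := by rw [hR₁]; gcongr
  have hR₁1 : 1 ≤ R₁ := by linarith
  have hR₁c : 2 ^ k * c₁ * R ≤ R₁ := by
    rw [hR₁, hcr]
    have : 0 ≤ 2 ^ k * c₁ * R := by positivity
    linarith
  have hN0 : (0 : ℝ) < N := by exact_mod_cast hN
  set P := (K : ℝ) * R₁ ^ K with hP
  obtain ⟨hCP, hCJ, hCZ⟩ := hC R B hR1 hB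
  rw [← hR₁, ← hP] at hCP hCJ hCZ
  have hPR₁ : R₁ ≤ P := by
    calc R₁ ≤ R₁ ^ K := le_self_pow₀ hR₁1 (by omega)
      _ ≤ P := le_mul_of_one_le_left (by positivity) (by exact_mod_cast hK)
  have hP1 : 1 ≤ P := hR₁1.trans hPR₁
  set Z := 8 * (k + 1) * P * B with hZ
  have hk1 : (1 : ℝ) ≤ k + 1 := by simp
  have hZPB : P * B ≤ Z := by
    rw [hZ]
    have : 0 ≤ P * B := by positivity
    nlinarith
  have hZ1 : 1 ≤ Z := (one_le_mul_of_one_le_of_one_le hP1 hB).trans hZPB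
  have hZk : 1 ≤ Z ^ k := one_le_pow₀ hZ1
  have hNZ : 2 * R₁ * B * Z ^ k ≤ N := hCZ.trans hNC
  have hNB : R₁ * B ≤ N := by
    have : R₁ * B * 1 ≤ R₁ * B * Z ^ k := by gcongr
    have : 0 ≤ R₁ * B := by positivity
    linarith
  have hb1 : ∀ i, 1 ≤ |((H i).leadingCoeff : ℝ)| := by
    intro i
    have h0 : (H i).leadingCoeff ≠ 0 := by
      rw [Ne, leadingCoeff_eq_zero]
      intro h
      have := hd1 i
      rw [h] at this
      simp at this
    exact_mod_cast Int.one_le_abs h0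
  have hx : ∀ i, 1 ≤ δ * N / (c₁ * |((H i).leadingCoeff : ℝ)|) := by
    intro i
    have := hb1 i
    rw [le_div_iff₀ (by positivity), one_mul]
    calc c₁ * |((H i).leadingCoeff : ℝ)| ≤ c₁ * B := by gcongr; exact hlead i
      _ = δ * (1 * c₁ * R * B) := by linear_combination (-c₁ * B) * hδR
      _ ≤ δ * (2 ^ k * c₁ * R * B) := by gcongr
      _ ≤ δ * (R₁ * B) := by gcongr
      _ ≤ δ * N := by gcongr
  choose M hM1 hMle hMge using fun i => exists_pow_le_lt (hd1 i) (hdk i) (hx i)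
  have hMup : ∀ i, |((H i).leadingCoeff : ℝ)| * M i ^ (H i).natDegree ≤ δ * N / c₁ := by
    intro i
    have := hb1 i
    have h1 := hMle i
    rw [le_div_iff₀ (by positivity)] at h1
    rw [le_div_iff₀ (by positivity)]
    linarith
  have hMlow : ∀ i, (N : ℝ) ≤ R₁ * (|((H i).leadingCoeff : ℝ)| * M i ^ (H i).natDegree) := by
    intro i
    have := hb1 i
    have h1 := hMge i
    rw [div_le_iff₀ (by positivity)] at h1
    calc (N : ℝ) = R * (δ * N) := by linear_combination (-N : ℝ) * hδR
      _ ≤ R * (2 ^ k * M i ^ (H i).natDegree * (c₁ * |((H i).leadingCoeff : ℝ)|)) := by gcongr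
      _ = (2 ^ k * c₁ * R) * (|((H i).leadingCoeff : ℝ)| * M i ^ (H i).natDegree) := by ring
      _ ≤ _ := by gcongr
  have hMZ : ∀ i, Z ≤ M i := by
    intro i
    by_contra! hlt
    have := hb1 i
    have h2 : (M i : ℝ) ^ (H i).natDegree ≤ Z ^ k :=
      (pow_le_pow_left₀ (by positivity) hlt.le _).trans (pow_le_pow_right₀ hZ1 (hdk i))
    have h3 : (N : ℝ) ≤ R₁ * (B * Z ^ k) := (hMlow i).trans (by gcongr; exact hlead i)
    have h4 : 0 < R₁ * (B * Z ^ k) := by positivity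
    nlinarith
  set J := ⌊(N : ℝ) / (512 * W * P ^ (κ + 1))⌋₊ with hJ
  have hden : 0 < 512 * W * P ^ (κ + 1) := by positivity
  have hBC : (1 : ℝ) ≤ B ^ C := one_le_pow₀ hB
  have hNJ : 1024 * W * P ^ (κ + 1) ≤ N := by
    refine hCJ.trans (le_trans ?_ hNC)
    exact le_mul_of_one_le_right (by positivity) hBC
  have hJ1 : 1 ≤ J := by
    rw [hJ, Nat.one_le_floor_iff, le_div_iff₀ hden]
    linarith
  have hJle : (J : ℝ) * (512 * W * P ^ (κ + 1)) ≤ N := by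
    rw [← le_div_iff₀ hden]
    exact Nat.floor_le (by positivity)
  have hJge : (N : ℝ) ≤ 1024 * W * P ^ (κ + 1) * J := by
    have h1 := (Nat.lt_floor_add_one ((N : ℝ) / (512 * W * P ^ (κ + 1)))).le
    rw [div_le_iff₀ hden, ← hJ] at h1
    have h2 : (1 : ℝ) ≤ J := by exact_mod_cast hJ1
    nlinarith
  set X := Fintype.piFinset fun i => range (M i) with hX
  set D : (Fin 3 → ℕ) → ℤ := fun x => s + ∑ i, (H i).eval ((x i : ℤ) + 1) with hDdef
  have hXne : X.Nonempty := by
    rw [hX, Fintype.piFinset_nonempty]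
    intro i
    have := hM1 i
    exact nonempty_range_iff.2 (by omega)
  have hqP : ∀ q ∈ Icc 1 ⌊P⌋₊, 1 ≤ q ∧ (q : ℝ) ≤ P := fun q hq => by
    have := mem_Icc.1 hq
    exact ⟨this.1, (Nat.le_floor_iff (by positivity)).1 this.2⟩
  have key : ∃ q ∈ Icc 1 ⌊P⌋₊, ∃ z : ℤ,
      (1 + 1 / (32 * W)) * δ * J < #{j ∈ Icc 1 (J : ℤ) | z + (q ^ κ : ℕ) * j ∈ A} := by
    refine exists_increment_of_fourier_bound hN hδ0 hδ1 hA hAδ hXne (D := D)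
      (v := v) (W := W) (Y := ⌊P⌋₊) (J := J) (d := fun q => q ^ κ) ?_ ?_ ?_ hv0 hW (hvW _) hJ1 ?_ ?_
    · intro x _ a ha a' ha' hne
      have := hav a ha a' ha' hne (fun i => x i + 1) (fun i => by omega)
      push_cast at this
      exact this
    · intro x hxX
      have hxX' := Fintype.mem_piFinset.1 hxX
      have h1 : ∀ i, |(((H i).eval ((x i : ℤ) + 1) : ℤ) : ℝ)| ≤ δ * N / 64 := by
        intro i
        have h2 := abs_eval_le_of_leadingCoeff (hdk i) (hcoef i) (x := x i + 1) (M := M i)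
          (mem_range.1 (hxX' i)) (hM1 i)
        push_cast at h2
        refine h2.trans ?_
        calc _ ≤ ((k : ℝ) + 1) * (C₀ + 1) * (δ * N / c₁) := by
              gcongr
              · simp
              · exact hMup i
          _ = _ := by rw [hc₁]; push_cast; field_simp
      have h3 : |(s : ℝ)| ≤ δ * N / 64 := by
        refine hs.trans ?_
        calc B = δ * (64 * R * B) / 64 := by linear_combination (-B) * hδR
          _ ≤ δ * (R₁ * B) / 64 := by gcongr
          _ ≤ _ := by gcongr
      have h4 : ((|D x| : ℤ) : ℝ) = |(s : ℝ) + ∑ i, (((H i).eval ((x i : ℤ) + 1) : ℤ) : ℝ)| := by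
        rw [hDdef]; push_cast; rfl
      have h5 : |(D x : ℝ)| = |(s : ℝ) + ∑ i, (((H i).eval ((x i : ℤ) + 1) : ℤ) : ℝ)| := by
        rw [← h4]; push_cast; rfl
      rw [h5, Fin.sum_univ_three]
      have a1 := abs_le.1 (h1 0)
      have a2 := abs_le.1 (h1 1)
      have a3 := abs_le.1 (h1 2)
      have a4 := abs_le.1 h3
      rw [abs_le]
      constructor <;> linarith
    · have h1 := card_filter_sum_eq_zero_le (hd1 0) M s
      have h2 : (#{x ∈ X | D x = 0} : ℝ) ≤ (H 0).natDegree * (M 1 * M 2) := by exact_mod_cast h1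
      have h3 : (#X : ℝ) = M 0 * (M 1 * M 2) := by
        rw [hX, Fintype.card_piFinset, Fin.prod_univ_three]
        simp
        ring
      have h4 : (8 * k * R : ℝ) ≤ M 0 := by
        refine le_trans ?_ (hMZ 0)
        rw [hZ]
        have h5 : R ≤ P := by linarith
        calc (8 * k * R : ℝ) ≤ 8 * (k + 1) * P * 1 := by rw [mul_one]; gcongr; simp
          _ ≤ _ := by gcongr
      have h6 : ((H 0).natDegree : ℝ) ≤ k := by exact_mod_cast hdk 0
      have h7 : (k : ℝ) ≤ δ / 8 * M 0 := by
        calc (k : ℝ) = δ / 8 * (8 * k * R) := by linear_combination (-k : ℝ) * hδR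
          _ ≤ _ := by gcongr
      rw [h3]
      calc _ ≤ ((H 0).natDegree : ℝ) * (M 1 * M 2) := h2
        _ ≤ (δ / 8 * M 0) * (M 1 * M 2) := by gcongr; exact h6.trans h7
        _ = _ := by ring
    · intro q hq
      obtain ⟨-, hqP'⟩ := hqP q hq
      calc _ = 512 * W * ((q : ℝ) ^ κ * J) := by push_cast; ring
        _ ≤ 512 * W * (P ^ (κ + 1) * J) := by
            gcongr
            exact (pow_le_pow_left₀ (by positivity) hqP' _).trans
              (pow_le_pow_right₀ hP1 (by omega))
        _ ≤ N := by linarith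
    · intro θ
      rw [hDdef, norm_sum_piFinset_ex H hM1 s θ]
      gcongr ?_ * ?_
      have hR4 : 1 / R₁ ≤ δ / 4 := by
        rw [div_le_iff₀ (by positivity)]
        nlinarith
      have hnn : ∀ q, 0 ≤ 2 * v q *
          (‖∑ j ∈ Icc 1 (J : ℤ), ex (((q ^ κ : ℕ) * j : ℤ) * θ)‖ ^ 2 / (J : ℝ) ^ 2) := fun q => by
        have := hv0 q
        positivity
      have hMN : ∀ i, |((H i).leadingCoeff : ℝ)| * M i ^ (H i).natDegree ≤ N := fun i => by
        refine (hMup i).trans ((div_le_self (by positivity) hc₁1).trans ?_)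
        nlinarith
      rcases hpt R₁ B N H M θ hR₁1 hB hd1 hdk hcont hcoef hlead hMlow hMN
        (fun i => hZPB.trans (hMZ i)) with h | ⟨q, a, hq, hqP', hβ, h⟩
      · have := sum_nonneg fun q (_ : q ∈ Icc 1 ⌊P⌋₊) => hnn q
        linarith
      · have hqmem : q ∈ Icc 1 ⌊P⌋₊ := mem_Icc.2 ⟨hq, Nat.le_floor hqP'⟩
        have h1 := single_le_sum (fun q _ => hnn q) hqmem
        have h2 := half_le_norm_sq_sum_ex (q := q) (κ := κ) (J := J) (a := a) (θ := θ) hq hκ hJ1 (by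
          have h3 : (q : ℝ) ^ κ ≤ P ^ κ := pow_le_pow_left₀ (by positivity) hqP' _
          have h4 : P ^ κ * J * 512 * P ≤ N := by
            refine le_trans ?_ hJle
            have : 0 ≤ P ^ (κ + 1) * J * 512 := by positivity
            calc P ^ κ * J * 512 * P = P ^ (κ + 1) * J * 512 * 1 := by ring
              _ ≤ P ^ (κ + 1) * J * 512 * W := by gcongr
              _ = _ := by ring
          have h5 : (q : ℝ) ^ κ * J * |θ - a / q| ≤ P ^ κ * J * |θ - a / q| := by gcongr
          have h6 : P ^ κ * J * 512 * (|θ - a / q| * N) ≤ P ^ κ * J * 512 * P := by gcongr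
          have h7 : (P ^ κ * J * |θ - a / q| * 512) * N ≤ 1 * N := by linarith
          have h8 := le_of_mul_le_mul_right h7 hN0
          linarith)
        have h9 := mul_le_mul_of_nonneg_left h2 (by have := hv0 q; positivity : 0 ≤ 2 * v q)
        linarith
  obtain ⟨q, hq, z, hz⟩ := key
  exact ⟨q, J, z, (hqP q hq).1, (hqP q hq).2.trans hCP, hJ1, hJge.trans (by gcongr), hz.le⟩

/-- No nonzero element of `A - A`, dilated by `g ^ κ`, is a sum of values of the `h i`. -/
def Avoids {ι : Type*} [Fintype ι] (h : ι → ℤ[X]) (κ g : ℕ) (A : Finset ℤ) : Prop :=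
  ∀ a ∈ A, ∀ a' ∈ A, a ≠ a' → ∀ n : ι → ℕ, (∀ i, 1 ≤ n i) →
    (g : ℤ) ^ κ * (a - a') ≠ ∑ i, (h i).eval (n i : ℤ)

lemma Avoids.dilate {ι : Type*} [Fintype ι] {h : ι → ℤ[X]} {κ g : ℕ} {A : Finset ℤ}
    (hA : Avoids h κ g A) {q : ℕ} (hq : 1 ≤ q) (z : ℤ) (S : Finset ℤ) :
    Avoids h κ (g * q) {j ∈ S | z + (q ^ κ : ℕ) * j ∈ A} := by
  intro a ha a' ha' hne n hn heq
  have hq0 : ((q ^ κ : ℕ) : ℤ) ≠ 0 := by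
    exact_mod_cast (pow_pos hq κ).ne'
  refine hA _ (mem_filter.1 ha).2 _ (mem_filter.1 ha').2 (fun h => hne ?_) n hn ?_
  · exact mul_left_cancel₀ hq0 (add_left_cancel h)
  · rw [← heq]
    push_cast
    ring

lemma _root_.Intersective.one_le_natDegree {h : ℤ[X]} (hh : Intersective h) : 1 ≤ h.natDegree := by
  by_contra! hlt
  obtain ⟨c, rfl⟩ := natDegree_eq_zero.1 (Nat.lt_one_iff.1 hlt)
  obtain ⟨n, -, hn⟩ := hh.2 (c.natAbs + 1) (by omega)
  rw [eval_C] at hn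
  have h1 : c = 0 := by
    refine Int.eq_zero_of_abs_lt_dvd hn ?_
    rw [Int.abs_eq_natAbs]
    push_cast
    omega
  exact hh.1 (by rw [h1, C_0])

theorem exists_avoids_increment {r : ℕ} (h : Fin (3 + r) → ℤ[X]) (hint : ∀ i, Intersective (h i)) :
    ∃ (κ C : ℕ) (ε : ℝ), 1 ≤ C ∧ 0 < ε ∧ ∀ (N g : ℕ) (δ : ℝ) (A : Finset ℤ),
      1 ≤ N → 1 ≤ g → 0 < δ → δ ≤ 1 → A ⊆ Icc 1 (N : ℤ) → (#A : ℝ) = δ * N → Avoids h κ g A →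
      C * δ⁻¹ ^ C * (g : ℝ) ^ C ≤ N →
      ∃ (q J : ℕ) (A' : Finset ℤ), 1 ≤ q ∧ (q : ℝ) ≤ C * δ⁻¹ ^ C ∧ 1 ≤ J ∧
        (N : ℝ) ≤ C * δ⁻¹ ^ C * J ∧ A' ⊆ Icc 1 (J : ℤ) ∧ (1 + ε) * δ * J ≤ #A' ∧
        Avoids h κ (g * q) A' := by
  choose Γ C₀ hΓ haux using fun i => exists_auxiliary_polynomial (hint i)
  set k := ∑ i, (h i).natDegree with hk
  set c₀ := ∑ i, C₀ i with hc₀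
  have hdk : ∀ i, (h i).natDegree ≤ k := fun i =>
    single_le_sum (f := fun i => (h i).natDegree) (fun _ _ => Nat.zero_le _) (mem_univ i)
  have hcc : ∀ i, C₀ i ≤ c₀ := fun i =>
    single_le_sum (f := C₀) (fun _ _ => Nat.zero_le _) (mem_univ i)
  have hκ : 1 ≤ k.factorial := Nat.factorial_pos k
  obtain ⟨C, ε, hC, hε, hinc⟩ := exists_density_increment k (∏ i, Γ i) c₀ k.factorial
    (Nat.one_le_iff_ne_zero.2 (prod_ne_zero_iff.2 fun i _ => Nat.one_le_iff_ne_zero.1 (hΓ i))) hκ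
  set b : ℕ := 1 + c₀ + r * ((k + 1) * c₀ * c₀) with hb
  refine ⟨k.factorial, C * b ^ C + k.factorial * k * C + C, ε, by omega, hε, ?_⟩
  intro N g δ A hN hg hδ0 hδ1 hA hAδ hav hNC
  set κ := k.factorial
  set C' := C * b ^ C + κ * k * C + C with hC'
  have hg1 : (1 : ℝ) ≤ g := by exact_mod_cast hg
  have hg1' : (1 : ℤ) ≤ g := by exact_mod_cast hg
  have hR1 : 1 ≤ δ⁻¹ := one_le_inv₀ hδ0 |>.2 hδ1
  choose H hdeg hcont hcoef hlead heval using fun i =>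
    haux i κ (fun m hm1 hm => Nat.dvd_factorial hm1 (hm.trans (hdk i))) g hg
  have hcoef' : ∀ i j, |(H i).coeff j| ≤ c₀ * |(H i).leadingCoeff| := fun i j =>
    (hcoef i j).trans (by gcongr; exact hcc i)
  have hlead' : ∀ i, |(H i).leadingCoeff| ≤ c₀ * (g : ℤ) ^ (κ * k) := fun i => by
    refine (hlead i).trans ?_
    gcongr
    · exact hcc i
    · exact hdk i
  set s : ℤ := ∑ i : Fin r, (H (Fin.natAdd 3 i)).eval 1 with hs
  have hs' : |s| ≤ r * ((k + 1) * c₀ * c₀) * (g : ℤ) ^ (κ * k) := by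
    have h1 : ∀ i, |(H i).eval 1| ≤ (k + 1) * c₀ * c₀ * (g : ℤ) ^ (κ * k) := by
      intro i
      have h2 := abs_eval_le_of_le ((hdeg i).trans_le (hdk i)) (x := 1) (y := 1) (by simp) le_rfl
      rw [one_pow, mul_one] at h2
      have h3 := sum_le_card_nsmul (range (k + 1)) (fun j => |(H i).coeff j|)
        (c₀ * (c₀ * (g : ℤ) ^ (κ * k)))
        (fun j _ => (hcoef' i j).trans (by gcongr; exact hlead' i))
      rw [card_range, nsmul_eq_mul] at h3
      refine h2.trans (h3.trans (le_of_eq ?_))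
      push_cast
      ring
    refine (abs_sum_le_sum_abs _ _).trans ?_
    refine (sum_le_card_nsmul _ _ _ fun i _ => h1 _).trans (le_of_eq ?_)
    rw [card_univ, Fintype.card_fin, nsmul_eq_mul]
    ring
  have hbB : (1 : ℝ) ≤ g ^ (κ * k) := one_le_pow₀ hg1
  have hbR : (b : ℝ) = 1 + c₀ + r * ((k + 1) * c₀ * c₀) := by rw [hb]; push_cast; ring
  have hnn : (0 : ℝ) ≤ r * ((k + 1) * c₀ * c₀) := by positivity
  have hc0 : (0 : ℝ) ≤ c₀ := by positivity
  have hb1 : (1 : ℝ) ≤ b := by rw [hbR]; linarith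
  have hCC : C * b ^ C ≤ C' ∧ C ≤ C' ∧ κ * k * C ≤ C' := by omega
  have hle : (C : ℝ) * δ⁻¹ ^ C ≤ C' * δ⁻¹ ^ C' := by
    gcongr
    · exact hCC.2.1
    · exact hCC.2.1
  obtain ⟨q, J, z, hq1, hqC, hJ1, hNJ, hinc'⟩ := hinc N δ (b * g ^ (κ * k))
    (fun i => H (Fin.castAdd r i)) s A hN hδ0 hδ1
    (one_le_mul_of_one_le_of_one_le hb1 hbB) hA hAδ
    (fun i => (hdeg _).symm ▸ (hint _).one_le_natDegree)
    (fun i => (hdeg _).trans_le (hdk _))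
    (fun i n hn => (hcont _ n hn).trans (dvd_prod_of_mem Γ (mem_univ _)))
    (fun i j => by exact_mod_cast hcoef' _ j)
    (fun i => by
      have h1 : (|((H (Fin.castAdd r i)).leadingCoeff : ℝ)|) ≤ c₀ * (g : ℝ) ^ (κ * k) := by
        exact_mod_cast hlead' _
      refine h1.trans ?_
      gcongr
      omega)
    (by
      have h1 : |(s : ℝ)| ≤ r * ((k + 1) * c₀ * c₀) * (g : ℝ) ^ (κ * k) := by exact_mod_cast hs'
      refine h1.trans ?_
      gcongr
      rw [hbR]
      linarith)
    (fun a ha a' ha' hne x hx heq => by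
      choose n hn1 hn using fun i => heval i (Fin.append x (fun _ => 1) i) (by
        refine Fin.addCases (fun i => ?_) (fun i => ?_) i
        · rw [Fin.append_left]; exact hx i
        · rw [Fin.append_right])
      refine hav a ha a' ha' hne n hn1 ?_
      rw [sum_congr rfl fun i _ => hn i, ← mul_sum, heq, Fin.sum_univ_add, hs]
      simp only [Fin.append_left, Fin.append_right, Nat.cast_one]
      ring)
    (by
      refine le_trans ?_ hNC
      calc (C : ℝ) * δ⁻¹ ^ C * (b * g ^ (κ * k)) ^ C
          = (C * b ^ C : ℕ) * δ⁻¹ ^ C * g ^ (κ * k * C) := by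
            push_cast
            ring
        _ ≤ C' * δ⁻¹ ^ C' * g ^ C' := by
            gcongr
            · exact hCC.1
            · exact hCC.2.1
            · exact hCC.2.2)
  exact ⟨q, J, _, hq1, hqC.trans hle, hJ1, hNJ.trans (by gcongr), filter_subset _ _, hinc',
    hav.dilate hq1 z _⟩

theorem exists_le_pow_of_avoids {r : ℕ} (h : Fin (3 + r) → ℤ[X])
    (hint : ∀ i, Intersective (h i)) :
    ∃ (κ C : ℕ) (ε : ℝ), 1 ≤ C ∧ 0 < ε ∧ ∀ (δ₀ : ℝ), 0 < δ₀ → δ₀ ≤ 1 →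
      ∀ (n m N g : ℕ) (δ : ℝ) (A : Finset ℤ), δ₀ ≤ δ → 1 < (1 + ε) ^ n * δ →
      1 ≤ N → 1 ≤ g → (g : ℝ) ≤ (C * δ₀⁻¹ ^ C) ^ m →
      A ⊆ Icc 1 (N : ℤ) → (#A : ℝ) = δ * N → Avoids h κ g A →
      (N : ℝ) ≤ (C * δ₀⁻¹ ^ C) ^ ((n + 1) + (m + n) * C) := by
  obtain ⟨κ, C, ε, hC, hε, hstep⟩ := exists_avoids_increment h hint
  refine ⟨κ, C, ε, hC, hε, fun δ₀ hδ₀ hδ₀1 => ?_⟩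
  set T := C * δ₀⁻¹ ^ C with hT
  have hC1 : (1 : ℝ) ≤ C := by exact_mod_cast hC
  have hT1 : 1 ≤ T :=
    one_le_mul_of_one_le_of_one_le hC1 (one_le_pow₀ (one_le_inv₀ hδ₀ |>.2 hδ₀1))
  intro n
  induction n with
  | zero =>
    intro m N g δ A _ hlt hN _ _ hA hAδ _
    exfalso
    have h1 : (#A : ℝ) ≤ N := by
      have := card_le_card hA
      rw [Int.card_Icc] at this
      have h2 : #A ≤ N := by omega
      exact_mod_cast h2
    have hN0 : (0 : ℝ) < N := by exact_mod_cast hN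
    rw [pow_zero, one_mul] at hlt
    nlinarith
  | succ n ih =>
    intro m N g δ A hδ hlt hN hg hgT hA hAδ hav
    have hδ0 : 0 < δ := hδ₀.trans_le hδ
    have hδ1 : δ ≤ 1 := by
      have h1 : (#A : ℝ) ≤ N := by
        have := card_le_card hA
        rw [Int.card_Icc] at this
        have h2 : #A ≤ N := by omega
        exact_mod_cast h2
      have hN0 : (0 : ℝ) < N := by exact_mod_cast hN
      rw [hAδ] at h1
      exact le_of_mul_le_mul_right (by linarith) hN0
    have hTδ : C * δ⁻¹ ^ C ≤ T := by
      rw [hT]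
      gcongr
    by_cases hNC : C * δ⁻¹ ^ C * (g : ℝ) ^ C ≤ N
    · obtain ⟨q, J, A', hq, hqC, hJ, hNJ, hA', hinc, hav'⟩ :=
        hstep N g δ A hN hg hδ0 hδ1 hA hAδ hav hNC
      have hJ0 : (0 : ℝ) < J := by exact_mod_cast hJ
      have hδ' : (1 + ε) * δ ≤ #A' / J := by rwa [le_div_iff₀ hJ0]
      have hJT := ih (m + 1) J (g * q) (#A' / J) A' (by nlinarith) (by
          refine hlt.trans_le ?_
          rw [pow_succ, mul_assoc]
          gcongr) hJ (Nat.mul_pos hg hq) (by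
          rw [pow_succ]
          push_cast
          gcongr
          exact hqC.trans hTδ) hA' (by field_simp) hav'
      calc (N : ℝ) ≤ T * T ^ ((n + 1) + (m + 1 + n) * C) := hNJ.trans (by gcongr)
        _ = _ := by ring
    · push Not at hNC
      calc (N : ℝ) ≤ T * (T ^ m) ^ C := hNC.le.trans (by gcongr)
        _ = T ^ (1 + m * C) := by ring
        _ ≤ _ := by
          gcongr
          · omega
          · omega

/-- If `N ≤ (C δ ^ (-C)) ^ (C + 1) (n + 1)` with `n` of order `log (1 / δ)`, then `δ` is at most
`exp (-c √(log N))`. -/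
lemma exists_le_exp_neg_sqrt (C : ℕ) (hC : 1 ≤ C) {ε : ℝ} (hε : 0 < ε) :
    ∃ c : ℝ, 0 < c ∧ ∀ (N : ℕ) (δ : ℝ), 1 ≤ N → 0 < δ → δ ≤ 1 →
      (∀ n : ℕ, 1 < (1 + ε) ^ n * δ → (N : ℝ) ≤ (C * δ⁻¹ ^ C) ^ ((n + 1) + n * C)) →
      δ ≤ Real.exp 1 * Real.exp (-c * √(Real.log N)) := by
  have hl : 0 < Real.log (1 + ε) := Real.log_pos (by linarith)
  have hC1 : (1 : ℝ) ≤ C := by exact_mod_cast hC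
  have hC0 : (0 : ℝ) < C := by linarith
  have hlC : 0 ≤ Real.log C := Real.log_nonneg hC1
  set D := (C + 1) * (1 / Real.log (1 + ε) + 2) * (Real.log C + C) with hD
  have hD0 : 0 < D := by positivity
  refine ⟨1 / √D, by positivity, fun N δ hN hδ0 hδ1 hbound => ?_⟩
  have hN0 : (0 : ℝ) < N := by exact_mod_cast hN
  set L := -Real.log δ with hL
  have hL0 : 0 ≤ L := by
    have := Real.log_nonpos hδ0.le hδ1
    linarith
  set n := ⌊L / Real.log (1 + ε)⌋₊ + 1 with hn
  have hn1 : L < n * Real.log (1 + ε) := by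
    rw [← div_lt_iff₀ hl, hn]
    push_cast
    exact Nat.lt_floor_add_one _
  have hn2 : (n : ℝ) ≤ L / Real.log (1 + ε) + 1 := by
    rw [hn]
    push_cast
    gcongr
    exact Nat.floor_le (by positivity)
  have h1 := hbound n (by
    rw [← Real.log_pos_iff (by positivity), Real.log_mul (by positivity) hδ0.ne', Real.log_pow]
    linarith)
  have h2 : Real.log N ≤ D * (L + 1) ^ 2 := by
    have h3 := Real.log_le_log hN0 h1
    rw [Real.log_pow, Real.log_mul (by positivity) (by positivity), Real.log_pow,
      Real.log_inv, ← hL] at h3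
    push_cast at h3
    calc Real.log N ≤ ((n : ℝ) + 1 + n * C) * (Real.log C + C * L) := h3
      _ ≤ ((C + 1) * (n + 1)) * ((Real.log C + C) * (L + 1)) := by
          gcongr
          · nlinarith
          · nlinarith
      _ ≤ ((C + 1) * ((1 / Real.log (1 + ε) + 2) * (L + 1))) * ((Real.log C + C) * (L + 1)) := by
          gcongr
          have : 0 ≤ 1 / Real.log (1 + ε) := by positivity
          calc (n : ℝ) + 1 ≤ L / Real.log (1 + ε) + 1 + 1 := by linarith
            _ = 1 / Real.log (1 + ε) * L + 2 := by ring
            _ ≤ _ := by nlinarith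
      _ = _ := by rw [hD]; ring
  have h4 : √(Real.log N) ≤ √D * (L + 1) := by
    rw [Real.sqrt_le_left (by positivity), mul_pow, Real.sq_sqrt hD0.le]
    exact h2
  have h5 : 1 / √D * √(Real.log N) ≤ L + 1 := by
    rw [one_div, inv_mul_le_iff₀ (by positivity)]
    exact h4
  rw [← Real.exp_add, ← Real.log_le_iff_le_exp hδ0]
  linarith

lemma rpow_ite_le_one_add_sqrt {x : ℝ} (hx : 0 ≤ x) (p : Prop) [Decidable p] :
    x ^ (if p then (1 : ℝ) / 2 else (1 : ℝ) / 4) ≤ 1 + √x := by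
  rw [Real.sqrt_eq_rpow]
  split_ifs
  · linarith
  · rcases le_total x 1 with h | h
    · have h1 := Real.rpow_le_one hx h (by norm_num : (0 : ℝ) ≤ 1 / 4)
      have h2 := Real.rpow_nonneg hx (1 / 2)
      linarith
    · have h1 := Real.rpow_le_rpow_of_exponent_le h (by norm_num : (1 : ℝ) / 4 ≤ 1 / 2)
      linarith

theorem exists_card_le_exp_neg_sqrt {r : ℕ} (h : Fin (3 + r) → ℤ[X])
    (hint : ∀ i, Intersective (h i)) :
    ∃ c : ℝ, 0 < c ∧ ∀ N : ℕ, 1 ≤ N → ∀ A : Finset ℕ, A ⊆ Icc 1 N →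
      (∀ a ∈ A, ∀ a' ∈ A, a ≠ a' → ∀ n : Fin (3 + r) → ℕ, (∀ i, 1 ≤ n i) →
        (a : ℤ) - (a' : ℤ) ≠ ∑ i, (h i).eval (n i : ℤ)) →
      (#A : ℝ) ≤ Real.exp 1 * N * Real.exp (-c * √(Real.log N)) := by
  obtain ⟨κ, C, ε, hC, hε, hiter⟩ := exists_le_pow_of_avoids h hint
  obtain ⟨c, hc, hexp⟩ := exists_le_exp_neg_sqrt C hC hε
  refine ⟨c, hc, fun N hN A hA hav => ?_⟩
  have hN0 : (0 : ℝ) < N := by exact_mod_cast hN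
  rcases A.eq_empty_or_nonempty with rfl | hne
  · rw [card_empty, Nat.cast_zero]
    positivity
  have hcard : (#A : ℝ) ≤ N := by
    have := card_le_card hA
    rw [Nat.card_Icc, Nat.add_sub_cancel] at this
    exact_mod_cast this
  have hA0 : (0 : ℝ) < #A := by exact_mod_cast hne.card_pos
  have hδ0 : 0 < (#A : ℝ) / N := by positivity
  have hδ1 : (#A : ℝ) / N ≤ 1 := (div_le_one hN0).2 hcard
  have key := hexp N (#A / N) hN hδ0 hδ1 fun n hn => by
    have := hiter (#A / N) hδ0 hδ1 n 0 N 1 (#A / N) (A.map Nat.castEmbedding) le_rfl hn hN le_rfl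
      (by simp) (fun a ha => by
        obtain ⟨b, hb, rfl⟩ := mem_map.1 ha
        have := mem_Icc.1 (hA hb)
        rw [Nat.castEmbedding_apply, mem_Icc]
        omega) (by rw [card_map]; field_simp) (fun a ha a' ha' hne' n hn => by
        obtain ⟨b, hb, rfl⟩ := mem_map.1 ha
        obtain ⟨b', hb', rfl⟩ := mem_map.1 ha'
        have := hav b hb b' hb' (fun e => hne' (by rw [e])) n hn
        simpa using this)
    rwa [zero_add] at this
  rw [div_le_iff₀ hN0] at key
  linarith

end IntersectiveSums

open Classical in
/-- **Sums of `ℓ ≥ 3` intersective polynomials.** With `μ = 1/2` if the reciprocals of the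
degrees sum to at least `1` and `μ = 1/4` otherwise, any `A ⊆ {1,…,N}` with no difference of
distinct elements of the form `h₁(n₁)+⋯+h_ℓ(n_ℓ)` satisfies
`|A| ≤ C · N · exp(-c (log N)^μ)`. -/
theorem sum_of_many_intersective_polys
    (l : ℕ) (hl : 3 ≤ l) (h : Fin l → Polynomial ℤ) (hint : ∀ i, Intersective (h i)) :
    ∃ c C : ℝ, 0 < c ∧ 0 < C ∧
      ∀ N : ℕ, 2 ≤ N → ∀ A : Finset ℕ, A ⊆ Finset.Icc 1 N →
        (∀ a ∈ A, ∀ a' ∈ A, a ≠ a' → ∀ n : Fin l → ℕ, (∀ i, 1 ≤ n i) →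
          (a : ℤ) - (a' : ℤ) ≠ ∑ i, (h i).eval ((n i : ℤ))) →
        (A.card : ℝ) ≤ C * N * Real.exp (-c * Real.log N ^
          (if (1 : ℝ) ≤ ∑ i, (((h i).natDegree : ℝ))⁻¹ then (1 : ℝ) / 2 else (1 : ℝ) / 4)) := by
  obtain ⟨r, rfl⟩ := Nat.exists_eq_add_of_le hl
  obtain ⟨c, hc, hbound⟩ := IntersectiveSums.exists_card_le_exp_neg_sqrt h hint
  refine ⟨c, Real.exp 1 * Real.exp c, hc, by positivity, fun N hN A hA hav => ?_⟩
  refine (hbound N (by omega) A hA hav).trans ?_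
  have h1 := IntersectiveSums.rpow_ite_le_one_add_sqrt (Real.log_natCast_nonneg N)
    ((1 : ℝ) ≤ ∑ i, (((h i).natDegree : ℝ))⁻¹)
  have h2 := mul_le_mul_of_nonneg_left h1 hc.le
  calc _ ≤ Real.exp 1 * N * (Real.exp c * Real.exp (-c * Real.log N ^
          (if (1 : ℝ) ≤ ∑ i, (((h i).natDegree : ℝ))⁻¹ then (1 : ℝ) / 2 else (1 : ℝ) / 4))) := by
        rw [← Real.exp_add]
        gcongr
        linarith
    _ = _ := by ring
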